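/- Let μₙ denote the Haar probability measure on the unitary group U(n). For each n let Iₙ ⊆ [0,2π) be an interval with n·|Iₙ| → ∞ as n → ∞. For U ∈ U(n), let Zₙ(U) be the infimum of |θⱼ(U) − θₖ(U)| over pairs j ≠ k of indices of eigenvalue angles satisfying (θⱼ(U) + θₖ(U))/2 ∈ Iₙ (with Zₙ(U) = +∞ if no such pair exists). Fix β > 0. Then as n → ∞, μₙ({U : Zₙ(U) · (n⁴·|Iₙ|/(144π²))^(1/3) > β}) → exp(−β³). -/

import Mathlib

open MeasureTheory Filter Topology Real
open scoped ENNReal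

noncomputable instance matrixMeasurableSpace {m n α : Type*} [MeasurableSpace α] :
    MeasurableSpace (Matrix m n α) :=
  inferInstanceAs (MeasurableSpace (m → n → α))

open MeasureTheory Filter Topology Real
open scoped ENNReal

namespace CUE

noncomputable section

/-- Laurent polynomials in `n` variables. -/
abbrev LR (n : ℕ) := AddMonoidAlgebra ℂ (Fin n → ℤ)
/-- Formal polynomials in the power sums. -/
abbrev SP := MvPolynomial ℤ ℂ

variable {n : ℕ}

/-- Euler derivation in the `j`-th variable, as a linear map. -/
def Dlin (j : Fin n) : LR n →ₗ[ℂ] LR n :=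
  (Finsupp.lsum ℂ (fun k : Fin n → ℤ => ((k j : ℤ) : ℂ) • AddMonoidAlgebra.lsingle (R := ℂ) k)) ∘ₗ
    (AddMonoidAlgebra.coeffLinearEquiv ℂ).toLinearMap

lemma Dlin_single (j : Fin n) (k : Fin n → ℤ) (c : ℂ) :
    Dlin j (AddMonoidAlgebra.single k c) = AddMonoidAlgebra.single k ((k j : ℂ) * c) := by
  simp [Dlin]

lemma Dlin_coeff (j : Fin n) (f : LR n) (k : Fin n → ℤ) :
    (Dlin j f).coeff k = (k j : ℂ) * f.coeff k := by
  induction f using AddMonoidAlgebra.induction_linear with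
  | zero => simp
  | add f g hf hg => simp [hf, hg, mul_add]
  | single m c =>
    rw [Dlin_single]
    by_cases h : m = k
    · subst h; simp
    · simp [h]

lemma Dlin_mul (j : Fin n) (f g : LR n) : Dlin j (f * g) = f • Dlin j g + g • Dlin j f := by
  induction f using AddMonoidAlgebra.induction_linear with
  | zero => simp
  | add f g hf hg => simp only [add_mul, map_add, hf, hg, smul_eq_mul, mul_add]; ring
  | single m c =>
    induction g using AddMonoidAlgebra.induction_linear with
    | zero => simp
    | add f g hf hg => simp only [mul_add, map_add, hf, hg, smul_eq_mul, add_mul]; ring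
    | single m' c' =>
      simp only [AddMonoidAlgebra.single_mul_single, Dlin_single, smul_eq_mul]
      rw [add_comm m' m, ← AddMonoidAlgebra.single_add]
      congr 1
      push_cast [Pi.add_apply]
      ring

/-- Euler derivation. -/
def D (j : Fin n) : Derivation ℂ (LR n) (LR n) := Derivation.mk' (Dlin j) (Dlin_mul j)

lemma D_apply (j : Fin n) (f : LR n) : D j f = Dlin j f := rfl

/-- The monomial `z_j ^ a`. -/
def zp (j : Fin n) (a : ℤ) : LR n := AddMonoidAlgebra.single (Pi.single j a) 1

lemma zp_mul (j : Fin n) (a b : ℤ) : zp j a * zp j b = zp j (a + b) := by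
  simp [zp, AddMonoidAlgebra.single_mul_single, Pi.single_add]

lemma zp_zero (j : Fin n) : zp j 0 = 1 := by
  simp [zp, AddMonoidAlgebra.one_def]

lemma zp_pow (j : Fin n) (k : ℕ) : zp j 1 ^ k = zp j k := by
  induction k with
  | zero => simp [zp_zero]
  | succ k ih => rw [pow_succ, ih, zp_mul]; push_cast; rfl

lemma D_zp (i j : Fin n) (a : ℤ) : D i (zp j a) = if i = j then (a : ℂ) • zp j a else 0 := by
  rw [D_apply, zp, Dlin_single]
  by_cases h : i = j
  · subst h; simp
  · simp [h]

/-- Power sums. -/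
def ps (n : ℕ) (a : ℤ) : LR n := ∑ j, zp j a

lemma D_ps (i : Fin n) (a : ℤ) : D i (ps n a) = (a : ℂ) • zp i a := by
  simp [ps, D_zp]

/-- Evaluate a formal polynomial in the power sums. -/
def evR (n : ℕ) : SP →ₐ[ℂ] LR n := MvPolynomial.aeval (ps n)

/-- The Weyl weight. -/
def ww (n : ℕ) : LR n :=
  ∏ i : Fin n, ∏ j ∈ Finset.Ioi i, ((zp j 1 - zp i 1) * (zp j (-1) - zp i (-1)))

/-- The first part of loop operators. -/
def Cc (k : ℤ) : SP :=
  if 0 ≤ k then ∑ l ∈ Finset.range k.toNat, MvPolynomial.X (l : ℤ) * MvPolynomial.X (k - l)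
  else - ∑ l ∈ Finset.range (-k).toNat, MvPolynomial.X (-(l : ℤ)) * MvPolynomial.X (k + l)

/-- derivation part of loop operators. -/
def dl (k : ℤ) : Derivation ℂ SP SP :=
  MvPolynomial.mkDerivation ℂ (fun a : ℤ => (a : ℂ) • (MvPolynomial.X (k + a) : SP))

/-- loop operators -/
def Lam (k : ℤ) (q : SP) : SP := Cc k * q + dl k q

lemma Lam_add (k : ℤ) (q q' : SP) : Lam k (q + q') = Lam k q + Lam k q' := by
  simp [Lam, mul_add]; ring

/-- conjugation reversing frequencies on formal polynomials -/
def crev : SP →+* SP :=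
  MvPolynomial.eval₂Hom (MvPolynomial.C.comp (starRingEnd ℂ)) (fun a => MvPolynomial.X (-a))

lemma crev_X (a : ℤ) : crev (MvPolynomial.X a) = MvPolynomial.X (-a) := by simp [crev]
lemma crev_C (a : ℂ) : crev (MvPolynomial.C a) = MvPolynomial.C (starRingEnd ℂ a) := by simp [crev]
lemma crev_smul (a : ℂ) (q : SP) : crev (a • q) = (starRingEnd ℂ a) • crev q := by
  rw [MvPolynomial.smul_eq_C_mul, map_mul, crev_C, MvPolynomial.smul_eq_C_mul]

lemma crev_crev (q : SP) : crev (crev q) = q := by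
  induction q using MvPolynomial.induction_on with
  | C a => simp [crev_C]
  | add p q hp hq => simp [hp, hq]
  | mul_X p a hp => simp [hp, crev_X]

lemma crev_Cc (k : ℕ) : crev (Cc k) = - Cc (-(k : ℤ)) := by
  rcases Nat.eq_zero_or_pos k with rfl | hk
  · simp [Cc]
  · have : ¬ (0 : ℤ) ≤ -(k : ℤ) := by omega
    simp only [Cc, Int.natCast_nonneg, if_true, this, if_false, neg_neg, map_sum, map_mul, crev_X,
      Int.toNat_natCast]
    refine Finset.sum_congr rfl fun l _ => ?_
    congr 2; ring

lemma crev_dl (k : ℤ) (q : SP) : crev (dl k q) = - dl (-k) (crev q) := by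
  induction q using MvPolynomial.induction_on with
  | C a => rw [crev_C, ← MvPolynomial.algebraMap_eq]; simp
  | add p q hp hq => simp only [map_add, hp, hq]; ring
  | mul_X p a hp =>
    rw [Derivation.leibniz, map_add, map_mul, Derivation.leibniz]
    simp only [smul_eq_mul, map_mul, hp, crev_X]
    simp only [dl, MvPolynomial.mkDerivation_X, crev_smul, crev_X]
    simp only [MvPolynomial.smul_eq_C_mul]
    rw [show -(k + a) = -k + -a by ring]
    simp
    ring

lemma crev_Lam (k : ℕ) (q : SP) : crev (Lam k q) = - Lam (-(k : ℤ)) (crev q) := by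
  simp only [Lam, map_add, map_mul, crev_Cc, crev_dl]; ring

/-- conjugation on Laurent polynomials -/
def st : LR n →+* LR n :=
  (AddMonoidAlgebra.mapDomainRingHom ℂ (-AddMonoidHom.id (Fin n → ℤ))).comp
    (AddMonoidAlgebra.mapRingHom _ (starRingEnd ℂ))

lemma st_single (k : Fin n → ℤ) (c : ℂ) :
    st (AddMonoidAlgebra.single k c) = AddMonoidAlgebra.single (-k) (starRingEnd ℂ c) := by
  simp [st]

lemma st_zp (j : Fin n) (a : ℤ) : st (zp j a) = zp j (-a) := by
  simp [zp, st_single, ← Pi.single_neg]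

lemma st_ps (a : ℤ) : st (ps n a) = ps n (-a) := by simp [ps, st_zp]

lemma st_ww : st (ww n) = ww n := by
  simp only [ww, map_prod, map_mul, map_sub, st_zp, neg_neg]
  refine Finset.prod_congr rfl fun i _ => Finset.prod_congr rfl fun j _ => by ring

lemma D_st (j : Fin n) (f : LR n) : D j (st f) = - st (D j f) := by
  induction f using AddMonoidAlgebra.induction_linear with
  | zero => simp
  | add f g hf hg => simp only [map_add, hf, hg]; ring
  | single m c =>
    simp only [D_apply, st_single, Dlin_single]
    rw [← AddMonoidAlgebra.single_neg]
    simp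

lemma st_evR (q : SP) : st (evR n q) = evR n (crev q) := by
  induction q using MvPolynomial.induction_on with
  | C a =>
    rw [crev_C, ← MvPolynomial.algebraMap_eq, AlgHom.commutes, AlgHom.commutes]
    simp [AddMonoidAlgebra.coe_algebraMap, st_single]
  | add p q hp hq => simp only [map_add, hp, hq]
  | mul_X p a hp => simp only [map_mul, hp, crev_X]; simp [evR, st_ps]

end
end CUE

open MeasureTheory Filter Topology Real
open scoped ENNReal

namespace CUE

noncomputable section
variable {n : ℕ}

lemma zp_inv (j : Fin n) : zp j 1 * zp j (-1) = 1 := by rw [zp_mul]; simp [zp_zero]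

/-- symmetric part -/
def TT (k : ℕ) (j i : Fin n) : LR n := ∑ l ∈ Finset.range k, zp j l * zp i ((k : ℤ) - l)

lemma TT_eq (k : ℕ) (j i : Fin n) : TT k j i =
    zp i 1 * ∑ l ∈ Finset.range k, zp j 1 ^ l * zp i 1 ^ (k - 1 - l) := by
  rw [TT, Finset.mul_sum]
  refine Finset.sum_congr rfl fun l hl => ?_
  have hl := Finset.mem_range.1 hl
  rw [zp_pow, zp_pow, mul_left_comm, zp_mul]
  congr 2; push_cast [Nat.cast_sub (show l ≤ k - 1 by omega), Nat.cast_sub (show 1 ≤ k by omega)]; ring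

lemma TT_id (k : ℕ) (j i : Fin n) :
    (zp j 1 - zp i 1) * (TT k j i + TT k i j) = (zp j 1 + zp i 1) * (zp j 1 ^ k - zp i 1 ^ k) := by
  rw [TT_eq, TT_eq]
  have h1 := geom_sum₂_mul (zp j 1) (zp i 1) k
  have h2 := geom_sum₂_mul (zp i 1) (zp j 1) k
  linear_combination (zp i 1) * h1 - (zp j 1) * h2

lemma TT_sum (k : ℕ) : ∑ i : Fin n, ∑ j ∈ Finset.Ioi i, (TT k j i + TT k i j) + (k : ℂ) • ps n k
    = ∑ l ∈ Finset.range k, ps n l * ps n ((k : ℤ) - l) := by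
  have h1 : ∑ l ∈ Finset.range k, ps n l * ps n ((k : ℤ) - l) = ∑ i : Fin n, ∑ j, TT k j i := by
    simp only [ps, Finset.sum_mul_sum, TT]
    rw [Finset.sum_comm]
    rw [Finset.sum_comm (s := Finset.univ (α := Fin n)) (t := Finset.univ (α := Fin n))]
    refine Finset.sum_congr rfl fun l hl => ?_
    rw [Finset.sum_comm]
  rw [h1, Finset.sum_sum_Ioi_add_eq_sum_sum_off_diag (fun j i => TT k j i), ps, Finset.smul_sum,
    ← Finset.sum_add_distrib]
  refine Finset.sum_congr rfl fun i _ => ?_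
  have : (k : ℂ) • zp i (k : ℤ) = TT k i i := by
    simp [TT, zp_mul, Nat.cast_smul_eq_nsmul]
  rw [this, add_comm, Fintype.sum_eq_add_sum_compl i]

/-- vector field. -/
def dk (k : ℤ) : Derivation ℂ (LR n) (LR n) := ∑ j : Fin n, zp j k • D j

lemma dk_apply (k : ℤ) (f : LR n) : dk k f = ∑ j : Fin n, zp j k * D j f := by
  rw [dk, ← Derivation.coeFnAddMonoidHom_apply, map_sum]; simp

lemma dk_zp (k : ℤ) (j : Fin n) (a : ℤ) : dk k (zp j a) = (a : ℂ) • zp j (k + a) := by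
  rw [dk_apply]; simp [D_zp, zp_mul]

lemma deriv_prod {ι : Type*} (d : Derivation ℂ (LR n) (LR n)) (s : Finset ι) (u c : ι → LR n)
    (h : ∀ i ∈ s, d (u i) = u i * c i) : d (∏ i ∈ s, u i) = (∏ i ∈ s, u i) * ∑ i ∈ s, c i := by
  classical
  induction s using Finset.induction_on with
  | empty => simp
  | insert a s ha ih =>
    rw [Finset.prod_insert ha, Finset.sum_insert ha, Derivation.leibniz,
      ih (fun i hi => h i (Finset.mem_insert_of_mem hi)), h a (Finset.mem_insert_self _ _)]
    simp only [smul_eq_mul]; ring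

lemma dk_ww (k : ℕ) : dk (k : ℤ) (ww n) =
    ww n * ∑ i : Fin n, ∑ j ∈ Finset.Ioi i, (TT k j i + TT k i j) := by
  unfold ww
  refine deriv_prod _ _ _ _ fun i _ => deriv_prod _ _ _ _ fun j _ => ?_
  rw [Derivation.leibniz]
  simp only [map_sub, dk_zp, smul_eq_mul]
  have e : ∀ j : Fin n, ∀ a : ℤ, zp j ((k : ℤ) + a) = zp j 1 ^ k * zp j a := fun j a => by
    rw [zp_pow, zp_mul]
  simp only [e]
  have := TT_id k j i
  have hj := zp_inv j
  have hi := zp_inv i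
  push_cast
  simp only [one_smul, neg_smul]
  linear_combination (zp i (-1) - zp j (-1)) * this + (-(zp j 1 ^ k - zp i 1 ^ k)) * hj + (zp j 1 ^ k - zp i 1 ^ k) * hi

lemma evR_X (a : ℤ) : evR n (MvPolynomial.X a) = ps n a := by simp [evR]

lemma dk_evR (k : ℤ) (q : SP) : dk k (evR n q) = evR n (dl k q) := by
  induction q using MvPolynomial.induction_on with
  | C a => rw [← MvPolynomial.algebraMap_eq, AlgHom.commutes, Derivation.map_algebraMap, Derivation.map_algebraMap, map_zero]
  | add p q hp hq => simp only [map_add, hp, hq]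
  | mul_X p a hp =>
    rw [map_mul, Derivation.leibniz, Derivation.leibniz, map_add, hp]
    simp only [smul_eq_mul, map_mul, dl, MvPolynomial.mkDerivation_X, evR_X, map_smul]
    congr 2
    rw [dk_apply]
    simp only [D_ps, mul_smul_comm, zp_mul]; simp only [ps, Finset.smul_sum]

lemma loop_nat (k : ℕ) (q : SP) :
    ∑ j : Fin n, D j (ww n * zp j k * evR n q) = ww n * evR n (Lam k q) := by
  have h1 : ∀ j : Fin n, D j (ww n * zp j k * evR n q) = zp j k * D j (ww n) * evR n q
      + ww n * ((k : ℂ) • zp j k) * evR n q + ww n * (zp j k * D j (evR n q)) := by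
    intro j
    rw [Derivation.leibniz, Derivation.leibniz, D_zp]
    simp only [smul_eq_mul, if_true]; push_cast; ring
  simp only [h1, Finset.sum_add_distrib, ← Finset.mul_sum, ← Finset.sum_mul, ← dk_apply]
  rw [dk_ww, dk_evR, Lam, map_add, map_mul, ← Finset.smul_sum]
  have : evR n (Cc k) = ∑ l ∈ Finset.range k, ps n l * ps n ((k : ℤ) - l) := by
    simp [Cc, evR_X]
  rw [this, ← TT_sum, ← ps]
  ring

lemma loop_int (k : ℤ) (q : SP) :
    ∑ j : Fin n, D j (ww n * zp j k * evR n q) = ww n * evR n (Lam k q) := by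
  obtain ⟨m, rfl | rfl⟩ := k.eq_nat_or_neg
  · exact loop_nat m q
  · have h := congrArg st (loop_nat (n := n) m (crev q))
    simp only [map_sum, map_mul, st_ww, st_evR, crev_Lam, crev_crev, map_neg] at h
    have h2 : ∀ j : Fin n, D j (ww n * zp j (-(m : ℤ)) * evR n q)
        = - st (D j (ww n * zp j m * evR n (crev q))) := by
      intro j
      rw [← D_st]; simp [st_ww, st_zp, st_evR, crev_crev]
    simp only [h2, Finset.sum_neg_distrib, h]; ring

end
end CUE

open MeasureTheory Filter Topology Real
open scoped ENNReal

namespace CUE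

noncomputable section
variable {n : ℕ}

/-- monomial of a multiset -/
def mon (M : Multiset ℤ) : SP := (M.map (fun a => (MvPolynomial.X a : SP))).prod
/-- weight of a multiset -/
def wt (M : Multiset ℤ) : ℕ := (M.map Int.natAbs).sum

lemma mon_cons (a : ℤ) (M : Multiset ℤ) : mon (a ::ₘ M) = MvPolynomial.X a * mon M := by simp [mon]
lemma mon_add (M N : Multiset ℤ) : mon (M + N) = mon M * mon N := by simp [mon]
lemma wt_cons (a : ℤ) (M : Multiset ℤ) : wt (a ::ₘ M) = a.natAbs + wt M := by simp [wt]
lemma wt_add (M N : Multiset ℤ) : wt (M + N) = wt M + wt N := by simp [wt]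

/-- Filtration. -/
def Sd (d : ℕ) : Submodule ℂ SP := Submodule.span ℂ {p | ∃ M, wt M ≤ d ∧ p = mon M}

lemma Sd_mono {d e : ℕ} (h : d ≤ e) : Sd d ≤ Sd e :=
  Submodule.span_mono fun _ ⟨M, hM, hp⟩ => ⟨M, hM.trans h, hp⟩

lemma mon_mem (M : Multiset ℤ) {d : ℕ} (h : wt M ≤ d) : mon M ∈ Sd d :=
  Submodule.subset_span ⟨M, h, rfl⟩

lemma Sd_mul {d e : ℕ} {p q : SP} (hp : p ∈ Sd d) (hq : q ∈ Sd e) : p * q ∈ Sd (d + e) := by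
  have : Sd d * Sd e ≤ Sd (d + e) := by
    rw [Sd, Sd, Submodule.span_mul_span]
    refine Submodule.span_le.2 ?_
    rintro _ ⟨_, ⟨M, hM, rfl⟩, _, ⟨N, hN, rfl⟩, rfl⟩
    simp only
    rw [← mon_add]
    exact mon_mem _ (by rw [wt_add]; omega)
  exact this (Submodule.mul_mem_mul hp hq)

lemma X_mem (a : ℤ) {d : ℕ} (h : a.natAbs ≤ d) : (MvPolynomial.X a : SP) ∈ Sd d := by
  have := mon_mem {a} (d := d) (by simpa [wt] using h)
  simpa [mon] using this

lemma Cc_mem (k : ℤ) : Cc k ∈ Sd k.natAbs := by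
  unfold Cc
  split_ifs with h
  · refine Submodule.sum_mem _ fun l hl => ?_
    have := Finset.mem_range.1 hl
    refine Sd_mono ?_ (Sd_mul (X_mem _ le_rfl) (X_mem _ le_rfl))
    omega
  · refine Submodule.neg_mem _ (Submodule.sum_mem _ fun l hl => ?_)
    have := Finset.mem_range.1 hl
    refine Sd_mono ?_ (Sd_mul (X_mem _ le_rfl) (X_mem _ le_rfl))
    omega

lemma dl_mon (k : ℤ) (M : Multiset ℤ) : dl k (mon M) ∈ Sd (k.natAbs + wt M) := by
  induction M using Multiset.induction_on with
  | empty => simp [mon]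
  | cons a M ih =>
    rw [mon_cons, Derivation.leibniz]
    simp only [dl, MvPolynomial.mkDerivation_X, smul_eq_mul] at ih ⊢
    refine Submodule.add_mem _ (Sd_mono ?_ (Sd_mul (X_mem a le_rfl) ih)) ?_
    · rw [wt_cons]; omega
    · rw [mul_smul_comm]
      refine Submodule.smul_mem _ _ (Sd_mono ?_ (Sd_mul (mon_mem M le_rfl) (X_mem (k + a) le_rfl)))
      rw [wt_cons]; omega

lemma dl_mem (k : ℤ) {d : ℕ} {q : SP} (hq : q ∈ Sd d) : dl k q ∈ Sd (k.natAbs + d) := by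
  induction hq using Submodule.span_induction with
  | mem x h => obtain ⟨M, hM, rfl⟩ := h; exact Sd_mono (by omega) (dl_mon k M)
  | zero => simp
  | add x y _ _ hx hy => rw [map_add]; exact Submodule.add_mem _ hx hy
  | smul a x _ hx => rw [Derivation.map_smul]; exact Submodule.smul_mem _ _ hx

lemma Lam_mem (k : ℤ) {d : ℕ} {q : SP} (hq : q ∈ Sd d) : Lam k q ∈ Sd (k.natAbs + d) :=
  Submodule.add_mem _ (Sd_mul (Cc_mem k) hq) (dl_mem k hq)

lemma exists_Sd (p : SP) : ∃ d, p ∈ Sd d := by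
  induction p using MvPolynomial.induction_on with
  | C a =>
    refine ⟨0, ?_⟩
    have := Submodule.smul_mem (Sd 0) a (mon_mem (0 : Multiset ℤ) (d := 0) (by simp [wt]))
    simpa [mon, MvPolynomial.smul_eq_C_mul] using this
  | add p q hp hq =>
    obtain ⟨d, hd⟩ := hp; obtain ⟨e, he⟩ := hq
    exact ⟨max d e, Submodule.add_mem _ (Sd_mono (le_max_left _ _) hd) (Sd_mono (le_max_right _ _) he)⟩
  | mul_X p a hp =>
    obtain ⟨d, hd⟩ := hp
    exact ⟨_, Sd_mul hd (X_mem a le_rfl)⟩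

/-- Loop span. -/
def Loop : Submodule ℂ SP := Submodule.span ℂ {p | ∃ k q, p = Lam k q}

/-- gradient module -/
def Qd (n d : ℕ) : Submodule ℂ (Fin n → LR n) :=
  Submodule.span ℂ {v | ∃ (a : ℤ) (e : ℕ) (q : SP), q ∈ Sd e ∧ a.natAbs + e ≤ d ∧
    v = fun j => zp j a * evR n q}

lemma Qd_mul {d e : ℕ} {v : Fin n → LR n} {q : SP} (hq : q ∈ Sd e) (hv : v ∈ Qd n d) :
    (fun j => evR n q * v j) ∈ Qd n (e + d) := by
  induction hv using Submodule.span_induction with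
  | mem x h =>
    obtain ⟨a, e', q', hq', h, rfl⟩ := h
    refine Submodule.subset_span ⟨a, e + e', q * q', Sd_mul hq hq', by omega, ?_⟩
    funext j; simp; ring
  | zero => convert Submodule.zero_mem (Qd n (e+d)) using 1; funext j; simp
  | add x y _ _ hx hy => convert Submodule.add_mem _ hx hy using 1; funext j; simp [mul_add]
  | smul a x _ hx => convert Submodule.smul_mem _ a hx using 1; funext j; simp

lemma Qd_mono {d e : ℕ} (h : d ≤ e) : Qd n d ≤ Qd n e :=
  Submodule.span_mono fun _ ⟨a, e, q, hq, h1, h2⟩ => ⟨a, e, q, hq, by omega, h2⟩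

lemma grad_mon (M : Multiset ℤ) : (fun j => D j (evR n (mon M))) ∈ Qd n (wt M) := by
  induction M using Multiset.induction_on with
  | empty => convert Submodule.zero_mem (Qd n _) using 1; funext j; simp [mon]
  | cons a M ih =>
    have : (fun j => D j (evR n (mon (a ::ₘ M)))) = (fun j => evR n (MvPolynomial.X a) * D j (evR n (mon M)))
        + (a : ℂ) • (fun j => zp j a * evR n (mon M)) := by
      funext j
      rw [mon_cons, map_mul, Derivation.leibniz, evR_X, D_ps]
      simp [mul_comm]
    rw [this, wt_cons]
    refine Submodule.add_mem _ (Qd_mul (X_mem a le_rfl) ih) (Submodule.smul_mem _ _ ?_)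
    exact Submodule.subset_span ⟨a, wt M, mon M, mon_mem M le_rfl, le_rfl, rfl⟩

lemma grad_mem {d : ℕ} {q : SP} (hq : q ∈ Sd d) : (fun j => D j (evR n q)) ∈ Qd n d := by
  induction hq using Submodule.span_induction with
  | mem x h => obtain ⟨M, hM, rfl⟩ := h; exact Qd_mono hM (grad_mon M)
  | zero => convert Submodule.zero_mem (Qd n d) using 1; funext j; simp
  | add x y _ _ hx hy => convert Submodule.add_mem _ hx hy using 1; funext j; simp
  | smul a x _ hx => convert Submodule.smul_mem _ a hx using 1; funext j; simp

lemma div_mem {d : ℕ} {v : Fin n → LR n} (hv : v ∈ Qd n d) :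
    ∃ g ∈ Sd d ⊓ Loop, ∑ j, D j (ww n * v j) = ww n * evR n g := by
  induction hv using Submodule.span_induction with
  | mem x h =>
    obtain ⟨a, e', q', hq', h, rfl⟩ := h
    refine ⟨Lam a q', ⟨Sd_mono h (Lam_mem a hq'), Submodule.subset_span ⟨_, _, rfl⟩⟩, ?_⟩
    rw [← loop_int]; simp only [mul_assoc]
  | zero => exact ⟨0, Submodule.zero_mem _, by simp⟩
  | add x y _ _ hx hy =>
    obtain ⟨g, hg, h1⟩ := hx
    obtain ⟨g', hg', h1'⟩ := hy
    exact ⟨g + g', Submodule.add_mem _ hg hg', by simp only [Pi.add_apply, mul_add, map_add, Finset.sum_add_distrib, h1, h1']⟩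
  | smul a x _ hx =>
    obtain ⟨g, hg, h1⟩ := hx
    exact ⟨a • g, Submodule.smul_mem _ a hg, by simp only [Pi.smul_apply, mul_smul_comm, Derivation.map_smul, map_smul, ← Finset.smul_sum, h1]⟩

/-- Box-supported Laurent polynomials. -/
def Bx (n d : ℕ) : Submodule ℂ (LR n) := Submodule.span ℂ
  ((fun k => AddMonoidAlgebra.single k (1 : ℂ)) '' Set.Icc (fun _ : Fin n => -(d : ℤ)) (fun _ => (d : ℤ)))

lemma Bx_mono {d e : ℕ} (h : d ≤ e) : Bx n d ≤ Bx n e := by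
  refine Submodule.span_mono (Set.image_mono (Set.Icc_subset_Icc ?_ ?_)) <;> intro j <;> simp <;> omega

lemma Bx_mul {d e : ℕ} {p q : LR n} (hp : p ∈ Bx n d) (hq : q ∈ Bx n e) : p * q ∈ Bx n (d + e) := by
  have : Bx n d * Bx n e ≤ Bx n (d + e) := by
    rw [Bx, Bx, Submodule.span_mul_span]
    refine Submodule.span_le.2 ?_
    rintro _ ⟨_, ⟨k, hk, rfl⟩, _, ⟨l, hl, rfl⟩, rfl⟩
    refine Submodule.subset_span ⟨k + l, ⟨fun j => ?_, fun j => ?_⟩, ?_⟩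
    · have := hk.1 j; have := hl.1 j; simp at *; omega
    · have := hk.2 j; have := hl.2 j; simp at *; omega
    · simp [AddMonoidAlgebra.single_mul_single]
  exact this (Submodule.mul_mem_mul hp hq)

lemma ps_mem (a : ℤ) : ps n a ∈ Bx n a.natAbs := by
  refine Submodule.sum_mem _ fun j _ => Submodule.subset_span ⟨Pi.single j a, ⟨fun i => ?_, fun i => ?_⟩, rfl⟩
  · by_cases h : i = j
    · subst h; simp only [Pi.single_eq_same]; omega
    · simp [h]
  · by_cases h : i = j
    · subst h; simp only [Pi.single_eq_same]; omega
    · simp [h]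

lemma evR_mem_Bx {d : ℕ} {q : SP} (hq : q ∈ Sd d) : evR n q ∈ Bx n d := by
  have hm : ∀ M : Multiset ℤ, evR n (mon M) ∈ Bx n (wt M) := by
    intro M
    induction M using Multiset.induction_on with
    | empty =>
      simp only [mon, Multiset.map_zero, Multiset.prod_zero, map_one]
      exact Submodule.subset_span ⟨0, by constructor <;> intro j <;> simp, rfl⟩
    | cons a M ih =>
      rw [mon_cons, map_mul, evR_X, wt_cons]
      exact Bx_mul (ps_mem a) ih
  induction hq using Submodule.span_induction with
  | mem x h => obtain ⟨M, hM, rfl⟩ := h; exact Bx_mono hM (hm M)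
  | zero => simp
  | add x y _ _ hx hy => simpa using Submodule.add_mem _ hx hy
  | smul a x _ hx => simpa using Submodule.smul_mem _ a hx

instance (d : ℕ) : FiniteDimensional ℂ (Bx n d) :=
  FiniteDimensional.span_of_finite ℂ ((Set.finite_Icc _ _).image _)

/-- constant term -/
def CT : LR n →ₗ[ℂ] ℂ := Finsupp.lapply 0 ∘ₗ (AddMonoidAlgebra.coeffLinearEquiv ℂ).toLinearMap

lemma CT_apply (f : LR n) : CT f = f.coeff 0 := rfl

lemma CT_D (j : Fin n) (f : LR n) : CT (D j f) = 0 := by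
  rw [CT_apply, D_apply, Dlin_coeff]; simp

lemma st_coeff (f : LR n) (k : Fin n → ℤ) : (st f).coeff (-k) = starRingEnd ℂ (f.coeff k) := by
  induction f using AddMonoidAlgebra.induction_linear with
  | zero => simp
  | add f g hf hg => simp [hf, hg]
  | single m c =>
    rw [st_single]
    by_cases h : m = k
    · subst h; simp
    · simp [h]

lemma CT_st_mul (f g : LR n) : CT (st f * g) = g.coeff.sum (fun k c => starRingEnd ℂ (f.coeff k) * c) := by
  induction g using AddMonoidAlgebra.induction_linear with
  | zero => simp
  | add g h hg hh =>
    rw [mul_add, map_add, hg, hh, AddMonoidAlgebra.coeff_add, Finsupp.sum_add_index'] <;> simp [mul_add]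
  | single m c =>
    rw [CT_apply]
    have := AddMonoidAlgebra.coeff_mul_single_apply (st f) c m (0 : Fin n → ℤ)
    simp [st_coeff]
end
end CUE

open MeasureTheory Filter Topology Real
open scoped ENNReal

namespace CUE

noncomputable section
variable {n : ℕ}

lemma CT_st_self (f : LR n) : CT (st f * f) = ((∑ k ∈ f.coeff.support, ‖f.coeff k‖ ^ 2 : ℝ) : ℂ) := by
  rw [CT_st_mul, Finsupp.sum]
  push_cast
  refine Finset.sum_congr rfl fun k _ => ?_
  rw [Complex.conj_mul']

lemma CT_st_self_nonneg (f : LR n) : 0 ≤ (CT (st f * f)).re := by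
  rw [CT_st_self, Complex.ofReal_re]; positivity

lemma eq_zero_of_CT (f : LR n) (h : (CT (st f * f)).re = 0) : f = 0 := by
  rw [CT_st_self, Complex.ofReal_re, Finset.sum_eq_zero_iff_of_nonneg (fun _ _ => by positivity)] at h
  ext k
  by_contra hk
  have := h k (Finsupp.mem_support_iff.2 hk)
  simp at this
  exact hk (by simpa using this)

/-- Vandermonde -/
def Van (n : ℕ) : LR n := ∏ i : Fin n, ∏ j ∈ Finset.Ioi i, (zp j 1 - zp i 1)

lemma ww_eq : ww n = st (Van n) * Van n := by
  simp only [Van, ww, map_prod, map_sub, st_zp, Finset.prod_mul_distrib]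
  rw [mul_comm]

lemma zp_ne {i j : Fin n} (h : i ≠ j) : zp j 1 - zp i 1 ≠ 0 := by
  intro h0
  have := congrArg (fun f : LR n => f.coeff (Pi.single j 1)) (sub_eq_zero.1 h0)
  simp only [zp, AddMonoidAlgebra.coeff_single, Finsupp.single_eq_same] at this
  rw [Finsupp.single_eq_of_ne] at this
  · simp at this
  · intro h2
    have := congrFun h2 j
    simp [h.symm] at this

lemma Van_ne : Van n ≠ 0 := by
  rw [Van, Finset.prod_ne_zero_iff]
  intro i _
  rw [Finset.prod_ne_zero_iff]
  intro j hj
  exact zp_ne (Finset.mem_Ioi.1 hj).ne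

lemma CT_ww_ne : CT (ww n) ≠ 0 := by
  intro h
  rw [ww_eq] at h
  exact Van_ne (eq_zero_of_CT _ (by rw [h]; simp))

lemma ww_ne : ww n ≠ 0 := fun h => CT_ww_ne (by rw [h, map_zero])

/-- Weighted Laplacian -/
def Lw (n : ℕ) : LR n →ₗ[ℂ] LR n :=
  ∑ j : Fin n, (D j).toLinearMap ∘ₗ LinearMap.mulLeft ℂ (ww n) ∘ₗ (D j).toLinearMap

lemma Lw_apply (f : LR n) : Lw n f = ∑ j : Fin n, D j (ww n * D j f) := by simp [Lw]

lemma Lw_ker {f : LR n} (h : Lw n f = 0) : ∃ c : ℂ, f = c • 1 := by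
  have h1 : CT (st f * Lw n f) = ∑ j : Fin n, CT (st (Van n * D j f) * (Van n * D j f)) := by
    rw [Lw_apply, Finset.mul_sum, map_sum]
    refine Finset.sum_congr rfl fun j _ => ?_
    have := CT_D j (st f * (ww n * D j f))
    rw [Derivation.leibniz, map_add, D_st] at this
    simp only [smul_eq_mul] at this
    rw [add_eq_zero_iff_eq_neg] at this
    rw [this, ← map_neg]
    congr 1
    rw [ww_eq, map_mul]; ring
  rw [h, mul_zero, map_zero] at h1
  have h2 := congrArg Complex.re h1
  rw [Complex.re_sum, Complex.zero_re, eq_comm,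
    Finset.sum_eq_zero_iff_of_nonneg (fun _ _ => CT_st_self_nonneg _)] at h2
  have h3 : ∀ j, D j f = 0 := fun j => by
    have := eq_zero_of_CT _ (h2 j (Finset.mem_univ _))
    exact (mul_eq_zero.1 this).resolve_left Van_ne
  refine ⟨f.coeff 0, ?_⟩
  ext k
  by_cases hk : k = 0
  · subst hk; simp [AddMonoidAlgebra.one_def]
  · obtain ⟨j, hj⟩ := Function.ne_iff.1 hk
    have h4 := congrArg (fun f : LR n => f.coeff k) (h3 j)
    simp only [D_apply, Dlin_coeff] at h4
    have h5 : f.coeff k = 0 := by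
      rcases mul_eq_zero.1 h4 with h | h
      · exact absurd (by exact_mod_cast h) hj
      · exact h
    rw [h5]
    simp [AddMonoidAlgebra.one_def, Ne.symm hk]

lemma CT_loop {g : SP} (hg : g ∈ Loop) : CT (ww n * evR n g) = 0 := by
  induction hg using Submodule.span_induction with
  | mem x h =>
    obtain ⟨k, q, rfl⟩ := h
    rw [← loop_int, map_sum]; exact Finset.sum_eq_zero fun j _ => CT_D j _
  | zero => simp
  | add x y _ _ hx hy => simp [mul_add, hx, hy]
  | smul a x _ hx => simp [hx]

lemma decomp (n d : ℕ) : (Sd d).map (evR n).toLinearMap =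
    (Sd d ⊓ Loop).map (evR n).toLinearMap ⊔ Submodule.span ℂ {1} := by
  set V := (Sd d).map (evR n).toLinearMap with hV
  set V0 := (Sd d ⊓ Loop).map (evR n).toLinearMap with hV0
  have hVB : V ≤ Bx n d := by
    rintro _ ⟨q, hq, rfl⟩; exact evR_mem_Bx hq
  have : FiniteDimensional ℂ V := Submodule.finiteDimensional_of_le hVB
  have hV0V : V0 ≤ V := Submodule.map_mono inf_le_left
  have : FiniteDimensional ℂ V0 := Submodule.finiteDimensional_of_le hV0V
  have h1V : (1 : LR n) ∈ V := ⟨1, by simpa [mon] using mon_mem 0 (d := d) (by simp [wt]), by simp⟩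
  have h1V0 : (1 : LR n) ∉ V0 := by
    rintro ⟨g, hg, h⟩
    have := CT_loop (n := n) hg.2
    simp only [AlgHom.toLinearMap_apply] at h
    rw [h, mul_one] at this
    exact CT_ww_ne this
  symm
  have hle : V0 ⊔ Submodule.span ℂ {1} ≤ V := by
    refine sup_le hV0V ?_
    rw [Submodule.span_singleton_le_iff_mem]; exact h1V
  refine Submodule.eq_of_le_of_finrank_le hle ?_
  have hinf : V0 ⊓ Submodule.span ℂ {1} = ⊥ := by
    rw [Submodule.eq_bot_iff]
    rintro x ⟨hx, hx1⟩
    obtain ⟨c, rfl⟩ := Submodule.mem_span_singleton.1 hx1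
    by_contra h0
    have hc : c ≠ 0 := fun h => h0 (by rw [h, zero_smul])
    apply h1V0
    have := V0.smul_mem c⁻¹ hx
    rwa [smul_smul, inv_mul_cancel₀ hc, one_smul] at this
  have e1 := Submodule.finrank_sup_add_finrank_inf_eq V0 (Submodule.span ℂ {(1 : LR n)})
  rw [hinf, finrank_bot, finrank_span_singleton one_ne_zero] at e1
  -- rank nullity
  set T : V →ₗ[ℂ] LR n := (Lw n).comp V.subtype with hT
  have e2 := LinearMap.finrank_range_add_finrank_ker T
  have hker : Module.finrank ℂ (LinearMap.ker T) ≤ 1 := by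
    have : LinearMap.ker T ≤ Submodule.span ℂ {(⟨1, h1V⟩ : V)} := by
      intro x hx
      obtain ⟨c, hc⟩ := Lw_ker (LinearMap.mem_ker.1 hx)
      refine Submodule.mem_span_singleton.2 ⟨c, ?_⟩
      ext1; exact hc.symm
    refine (Submodule.finrank_mono this).trans ?_
    exact (finrank_span_le_card _).trans (by simp)
  have hrange : Module.finrank ℂ (LinearMap.range T) ≤ Module.finrank ℂ V0 := by
    have : LinearMap.range T ≤ V0.map (LinearMap.mulLeft ℂ (ww n)) := by
      rintro _ ⟨⟨_, q, hq, rfl⟩, rfl⟩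
      obtain ⟨g, hg, h⟩ := div_mem (grad_mem (n := n) hq)
      refine ⟨evR n g, ⟨g, hg, rfl⟩, ?_⟩
      simp only [hT, LinearMap.comp_apply, Submodule.subtype_apply, AlgHom.toLinearMap_apply, Lw_apply,
        LinearMap.mulLeft_apply]
      exact h.symm
    exact (Submodule.finrank_mono this).trans (Submodule.finrank_map_le _ _)
  omega

/-- The algebraic form of Weyl's integration formula. -/
theorem weyl_alg (H : SP →ₗ[ℂ] ℂ) (hloop : ∀ k q, H (Lam k q) = 0) (h1 : H 1 = 1)
    (hev : ∀ s, evR n s = 0 → H s = 0) (s : SP) : CT (evR n s * ww n) = H s * CT (ww n) := by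
  obtain ⟨d, hd⟩ := exists_Sd s
  have : evR n s ∈ (Sd d).map (evR n).toLinearMap := ⟨s, hd, rfl⟩
  rw [decomp, Submodule.mem_sup] at this
  obtain ⟨_, ⟨g, hg, rfl⟩, y, hy, h⟩ := this
  obtain ⟨c, rfl⟩ := Submodule.mem_span_singleton.1 hy
  simp only [AlgHom.toLinearMap_apply] at h
  have hHg : H g = 0 := by
    have : Loop ≤ LinearMap.ker H := by
      refine Submodule.span_le.2 ?_
      rintro _ ⟨k, q, rfl⟩; exact hloop k q
    exact this hg.2
  have h2 := hev (s - g - c • 1) (by simp [← h])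
  rw [map_sub, map_sub, map_smul, h1, hHg] at h2
  have h3 : H s = c := by simpa [sub_eq_zero] using h2
  rw [← h, h3, add_mul, map_add, mul_comm, CT_loop hg.2]
  simp
end
end CUE

open MeasureTheory Filter Topology Real
open scoped ENNReal

namespace CUE

noncomputable section
variable {n : ℕ}

abbrev UG (n : ℕ) := Matrix.unitaryGroup (Fin n) ℂ
abbrev MT (n : ℕ) := Matrix (Fin n) (Fin n) ℂ

instance : BorelSpace (MT n) := inferInstanceAs (BorelSpace (Fin n → Fin n → ℂ))
instance : BorelSpace (UG n) := Subtype.borelSpace _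

lemma entry_bound (U : UG n) (i j : Fin n) : ‖(U : MT n) i j‖ ≤ 1 :=
  entry_norm_bound_of_unitary U.2 i j

lemma isCompact_UG : IsCompact (Matrix.unitaryGroup (Fin n) ℂ : Set (MT n)) := by
  have h1 : IsCompact (Set.pi Set.univ (fun _ => Set.pi Set.univ (fun _ => Metric.closedBall 0 1)) :
      Set (Fin n → Fin n → ℂ)) :=
    isCompact_univ_pi fun _ => isCompact_univ_pi fun _ => isCompact_closedBall 0 1
  refine IsCompact.of_isClosed_subset h1 ?_ ?_
  · have : (Matrix.unitaryGroup (Fin n) ℂ : Set (MT n)) = {A | star A * A = 1} ∩ {A | A * star A = 1} := by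
      ext A; simp only [SetLike.mem_coe, Set.mem_inter_iff, Set.mem_ofPred_eq]; exact Unitary.mem_iff
    rw [this]
    refine IsClosed.inter (isClosed_eq ?_ continuous_const) (isClosed_eq ?_ continuous_const)
    · exact (continuous_star.matrix_mul continuous_id)
    · exact (continuous_id.matrix_mul continuous_star)
  · intro A hA i _ j _
    simpa using entry_norm_bound_of_unitary hA i j

instance : CompactSpace (UG n) := isCompact_iff_compactSpace.1 isCompact_UG

instance : ContinuousMul (UG n) := inferInstance
instance : SecondCountableTopology (MT n) := inferInstanceAs (SecondCountableTopology (Fin n → Fin n → ℂ))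

lemma integ (μ : Measure (UG n)) [IsProbabilityMeasure μ] {f : UG n → ℂ} (hf : Continuous f) :
    Integrable f μ := by
  exact hf.integrable_of_hasCompactSupport (HasCompactSupport.of_compactSpace f)

/-- the invariance derivative lemma -/
lemma haar_deriv (μ : Measure (UG n)) [IsProbabilityMeasure μ] [μ.IsMulLeftInvariant]
    (V : ℝ → UG n) {f f' : UG n → ℂ} (hf : Continuous f) (hf' : Continuous f')
    (hd : ∀ U t, HasDerivAt (fun t => f (V t * U)) (f' (V t * U)) t) : ∫ U, f' U ∂μ = 0 := by
  obtain ⟨C, hC⟩ := (isCompact_range hf').isBounded.exists_norm_le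
  have h1 := hasDerivAt_integral_of_dominated_loc_of_deriv_le (μ := μ) (𝕜 := ℝ)
    (F := fun t U => f (V t * U)) (F' := fun t U => f' (V t * U)) (x₀ := 0) (bound := fun _ => C)
    (s := Set.univ) Filter.univ_mem
    (Eventually.of_forall fun t => (integ μ (hf.comp (continuous_const.mul continuous_id))).aestronglyMeasurable)
    (integ μ (hf.comp (continuous_const.mul continuous_id)))
    (integ μ (hf'.comp (continuous_const.mul continuous_id))).aestronglyMeasurable
    (Eventually.of_forall fun U t _ => hC _ ⟨_, rfl⟩)
    (integrable_const _)
    (Eventually.of_forall fun U t _ => hd U t)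
  have h2 := h1.2
  simp only [integral_mul_left_eq_self] at h2
  exact h2.unique (hasDerivAt_const _ _)

/-- entrywise derivative -/
def HD (A : ℝ → MT n) (A' : MT n) (t : ℝ) : Prop := ∀ i j, HasDerivAt (fun t => A t i j) (A' i j) t

lemma HD.mul {A B : ℝ → MT n} {A' B' : MT n} {t : ℝ} (hA : HD A A' t) (hB : HD B B' t) :
    HD (fun t => A t * B t) (A' * B t + A t * B') t := by
  intro i j
  simp only [Matrix.mul_apply, Matrix.add_apply]
  rw [← Finset.sum_add_distrib]
  exact HasDerivAt.fun_sum fun l _ => (hA i l).mul (hB l j)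

lemma HD.pow {A : ℝ → MT n} {A' : MT n} {t : ℝ} (hA : HD A A' t) (k : ℕ) :
    HD (fun t => A t ^ k) (∑ l ∈ Finset.range k, A t ^ l * A' * A t ^ (k - 1 - l)) t := by
  induction k with
  | zero => intro i j; simp; exact hasDerivAt_const _ _
  | succ k ih =>
    have := ih.mul hA
    simp only [← pow_succ] at this
    convert this using 1
    rw [Finset.sum_range_succ, Finset.sum_mul]
    congr 1
    · refine Finset.sum_congr rfl fun l hl => ?_
      have := Finset.mem_range.1 hl
      rw [mul_assoc _ (A t ^ (k - 1 - l)), ← pow_succ]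
      congr 2; omega
    · simp

/-- one-parameter group -/
def Vt (P : MT n) (t : ℝ) : MT n := 1 + (Complex.exp (t * Complex.I) - 1) • P

/-- projections -/
def IsPr (P : MT n) : Prop := P * P = P ∧ star P = P

lemma Vt_mem {P : MT n} (hP : IsPr P) (t : ℝ) : Vt P t ∈ Matrix.unitaryGroup (Fin n) ℂ := by
  rw [Matrix.mem_unitaryGroup_iff, Vt]
  have h1 : star (Complex.exp (t * Complex.I)) * Complex.exp (t * Complex.I) = 1 := by
    rw [Complex.star_def, ← Complex.exp_conj, ← Complex.exp_add]; simp
  set e := Complex.exp (t * Complex.I)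
  rw [star_add, star_smul, star_one, hP.2, add_mul, mul_add, mul_add, smul_mul_smul_comm, hP.1]
  simp only [one_mul, mul_one]
  rw [add_assoc, ← add_smul, ← add_smul]
  have : star (e - 1) + ((e - 1) + (e - 1) * star (e - 1)) = 0 := by
    simp only [star_sub, star_one]; linear_combination h1
  rw [this]; simp

lemma Vt_HD {P : MT n} (hP : IsPr P) (t : ℝ) : HD (Vt P) (Complex.I • (P * Vt P t)) t := by
  intro i j
  have h0 : P * Vt P t = Complex.exp (t * Complex.I) • P := by
    rw [Vt, mul_add, mul_smul_comm, hP.1, mul_one]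
    module
  rw [h0]
  have h1 : HasDerivAt (fun t : ℝ => Complex.exp (t * Complex.I)) (Complex.exp (t * Complex.I) * Complex.I) t := by
    have : HasDerivAt (fun t : ℝ => (t : ℂ) * Complex.I) Complex.I t := by
      simpa using (Complex.ofRealCLM.hasDerivAt (x := t)).mul_const Complex.I
    exact this.cexp
  have h2 := ((h1.sub_const 1).mul_const (P i j)).const_add ((1 : MT n) i j)
  simp only [Vt, Matrix.add_apply, Matrix.smul_apply, smul_eq_mul] at h2 ⊢
  exact h2.congr_deriv (by ring)

lemma VtU_HD {P : MT n} (hP : IsPr P) (U : MT n) (t : ℝ) :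
    HD (fun t => Vt P t * U) (Complex.I • (P * (Vt P t * U))) t := by
  have := (Vt_HD hP t).mul (B := fun _ => U) (B' := 0) (fun i j => by simpa using hasDerivAt_const _ _)
  convert this using 1
  simp [mul_assoc]

end
end CUE

open MeasureTheory Filter Topology Real
open scoped ENNReal

namespace CUE

noncomputable section
variable {n : ℕ}

/-- power as matrix -/
def mp (U : UG n) (a : ℤ) : MT n := ((U ^ a : UG n) : MT n)

/-- trace of power -/
def trU (U : UG n) (a : ℤ) : ℂ := (mp U a).trace

lemma mp_nat (U : UG n) (k : ℕ) : mp U k = (U : MT n) ^ k := by simp [mp]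
lemma mp_add (U : UG n) (a b : ℤ) : mp U (a + b) = mp U a * mp U b := by simp [mp, zpow_add]
lemma mp_neg (U : UG n) (a : ℤ) : mp U (-a) = star (mp U a) := by
  simp [mp, zpow_neg]
lemma trU_neg (U : UG n) (a : ℤ) : trU U (-a) = star (trU U a) := by
  rw [trU, mp_neg, trU, Matrix.star_eq_conjTranspose, Matrix.trace_conjTranspose]

lemma cont_mp (a : ℤ) : Continuous (fun U : UG n => mp U a) := by
  have : Continuous (fun U : UG n => (U ^ a : UG n)) := continuous_zpow a
  exact continuous_subtype_val.comp this

lemma cont_trU (a : ℤ) : Continuous (fun U : UG n => trU U a) := (cont_mp a).matrix_trace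

/-- unitary one-parameter group -/
def Vu (P : MT n) (hP : IsPr P) (t : ℝ) : UG n := ⟨Vt P t, Vt_mem hP t⟩

lemma Vu_HD (P : MT n) (hP : IsPr P) (U : UG n) (k : ℕ) (t : ℝ) :
    HD (fun t => mp (Vu P hP t * U) k)
      (Complex.I • ∑ l ∈ Finset.range k, mp (Vu P hP t * U) l * P * mp (Vu P hP t * U) ((k : ℤ) - l)) t := by
  have := (VtU_HD hP (U : MT n) t).pow k
  simp only [mp_nat]
  convert this using 1
  · rfl
  rw [Finset.smul_sum]
  refine Finset.sum_congr rfl fun l hl => ?_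
  have := Finset.mem_range.1 hl
  rw [show ((k : ℤ) - l) = ((k - 1 - l + 1 : ℕ) : ℤ) by omega, mp_nat, pow_succ']
  simp only [Vu, Submonoid.coe_mul, mul_smul_comm, smul_mul_assoc, mul_assoc]

lemma trU_HD (P : MT n) (hP : IsPr P) (U : UG n) (a : ℤ) (t : ℝ) :
    HasDerivAt (fun t => trU (Vu P hP t * U) a)
      (Complex.I * (a * (P * mp (Vu P hP t * U) a).trace)) t := by
  have key : ∀ k : ℕ, HasDerivAt (fun t => trU (Vu P hP t * U) k)
      (Complex.I * (k * (P * mp (Vu P hP t * U) k).trace)) t := by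
    intro k
    have h := HasDerivAt.fun_sum (u := Finset.univ) fun i _ => Vu_HD P hP U k t i i
    refine h.congr_deriv ?_
    change Matrix.trace _ = _
    rw [Matrix.trace_smul, Matrix.trace_sum, smul_eq_mul]
    congr 1
    rw [Finset.sum_congr rfl (g := fun _ => (P * mp (Vu P hP t * U) k).trace)]
    · simp
    · intro l _
      rw [Matrix.trace_mul_comm, ← mul_assoc, ← mp_add, Matrix.trace_mul_comm]; simp
  obtain ⟨m, rfl | rfl⟩ := a.eq_nat_or_neg
  · exact key m
  · have h := (key m).star
    simp only [trU_neg]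
    refine h.congr_deriv ?_
    rw [mp_neg]
    have : (P * star (mp (Vu P hP t * U) m)).trace = star ((P * mp (Vu P hP t * U) m).trace) := by
      rw [← Matrix.trace_conjTranspose, Matrix.conjTranspose_mul, Matrix.trace_mul_comm]
      rw [← Matrix.star_eq_conjTranspose P, hP.2, Matrix.star_eq_conjTranspose]
    rw [this]; simp

/-- evaluation on the unitary group -/
def evU (U : UG n) : SP →ₐ[ℂ] ℂ := MvPolynomial.aeval (trU U)

lemma evU_X (U : UG n) (a : ℤ) : evU U (MvPolynomial.X a) = trU U a := by simp [evU]

lemma cont_evU (q : SP) : Continuous (fun U : UG n => evU U q) := by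
  induction q using MvPolynomial.induction_on with
  | C a => simp only [← MvPolynomial.algebraMap_eq, AlgHom.commutes]; exact continuous_const
  | add p q hp hq => simp only [map_add]; exact hp.add hq
  | mul_X p a hp => simp only [map_mul, evU_X]; exact hp.mul (cont_trU a)

lemma evU_crev (U : UG n) (q : SP) : evU U (crev q) = starRingEnd ℂ (evU U q) := by
  induction q using MvPolynomial.induction_on with
  | C a => rw [crev_C, ← MvPolynomial.algebraMap_eq, AlgHom.commutes, AlgHom.commutes]; rfl
  | add p q hp hq => simp only [map_add, hp, hq]
  | mul_X p a hp => rw [map_mul, map_mul, hp, crev_X, evU_X, trU_neg, map_mul, evU_X, map_mul]; rfl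

/-- derivative of a monomial in direction `P` -/
def dm (U : UG n) (P : MT n) : List ℤ → ℂ
  | [] => 0
  | a :: L => trU U a * dm U P L + a * (P * mp U a).trace * evU U (mon L)

lemma dm_HD (P : MT n) (hP : IsPr P) (U : UG n) (L : List ℤ) (t : ℝ) :
    HasDerivAt (fun t => evU (Vu P hP t * U) (mon L)) (Complex.I * dm (Vu P hP t * U) P L) t := by
  induction L with
  | nil => simp only [dm, mon, Multiset.coe_nil, Multiset.map_zero, Multiset.prod_zero, map_one, mul_zero]; exact hasDerivAt_const _ _
  | cons a L ih =>
    have h := (trU_HD P hP U a t).mul ih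
    simp only [dm, ← Multiset.cons_coe, mon_cons, map_mul, evU_X]
    exact h.congr_deriv (by ring)

lemma dm_add (U : UG n) (P Q : MT n) (L : List ℤ) : dm U (P + Q) L = dm U P L + dm U Q L := by
  induction L with
  | nil => simp [dm]
  | cons a L ih => simp only [dm, ih, add_mul, Matrix.trace_add]; ring

lemma dm_smul (U : UG n) (c : ℂ) (P : MT n) (L : List ℤ) : dm U (c • P) L = c * dm U P L := by
  induction L with
  | nil => simp [dm]
  | cons a L ih => simp only [dm, ih, smul_mul_assoc, Matrix.trace_smul, smul_eq_mul]; ring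

lemma dm_sum (U : UG n) (k : ℤ) (L : List ℤ) :
    ∑ a, ∑ b, mp U k a b * dm U (Matrix.single a b 1) L = evU U (dl k (mon L)) := by
  induction L with
  | nil => simp [dm, mon]
  | cons c L ih =>
    rw [← Multiset.cons_coe, mon_cons, Derivation.leibniz]
    simp only [smul_eq_mul, map_add, map_mul, ← ih, evU_X, dm]
    have h1 : evU U (dl k (MvPolynomial.X c)) = ∑ a, ∑ b, mp U k a b * (c * (Matrix.single a b 1 * mp U c).trace) := by
      simp only [dl, MvPolynomial.mkDerivation_X, map_smul, evU_X, trU, mp_add]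
      have ht : ∀ (a b : Fin n) (M : MT n), (Matrix.single a b 1 * M).trace = M b a := by
        intro a b M
        simp [Matrix.trace, Matrix.mul_apply, Matrix.single_apply, ite_and]
      simp only [ht]
      simp only [Matrix.trace, Matrix.diag, Matrix.mul_apply, smul_eq_mul, Finset.mul_sum]
      refine Finset.sum_congr rfl fun a _ => Finset.sum_congr rfl fun b _ => ?_
      ring
    rw [h1, Finset.mul_sum, Finset.mul_sum, ← Finset.sum_add_distrib]
    refine Finset.sum_congr rfl fun a _ => ?_
    rw [Finset.mul_sum, Finset.mul_sum, ← Finset.sum_add_distrib]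
    refine Finset.sum_congr rfl fun b _ => ?_
    ring

lemma cont_dm (P : MT n) (L : List ℤ) : Continuous (fun U : UG n => dm U P L) := by
  induction L with
  | nil => exact continuous_const
  | cons a L ih =>
    exact ((cont_trU a).mul ih).add ((continuous_const.mul
      ((continuous_const.matrix_mul (cont_mp a)).matrix_trace)).mul (cont_evU _))

/-- total integrand -/
def tot (U : UG n) (k : ℕ) (L : List ℤ) (a b : Fin n) (P : MT n) : ℂ :=
  (∑ l ∈ Finset.range k, mp U l * P * mp U ((k : ℤ) - l)) a b * evU U (mon L) + mp U k a b * dm U P L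

lemma cont_tot (k : ℕ) (L : List ℤ) (a b : Fin n) (P : MT n) :
    Continuous (fun U : UG n => tot U k L a b P) := by
  refine Continuous.add (Continuous.mul ?_ (cont_evU _)) (((cont_mp k).matrix_elem a b).mul (cont_dm P L))
  refine Continuous.matrix_elem ?_ a b
  exact continuous_finsetSum _ fun l _ => ((cont_mp _).matrix_mul continuous_const).matrix_mul (cont_mp _)

lemma tot_add (U : UG n) (k : ℕ) (L : List ℤ) (a b : Fin n) (P Q : MT n) :
    tot U k L a b (P + Q) = tot U k L a b P + tot U k L a b Q := by
  simp only [tot, dm_add, mul_add, add_mul, Finset.sum_add_distrib, Matrix.add_apply]; ring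

lemma tot_smul (U : UG n) (k : ℕ) (L : List ℤ) (a b : Fin n) (c : ℂ) (P : MT n) :
    tot U k L a b (c • P) = c * tot U k L a b P := by
  simp only [tot, dm_smul, mul_smul_comm, smul_mul_assoc, ← Finset.smul_sum, Matrix.smul_apply, smul_eq_mul]; ring

lemma tot_proj (μ : Measure (UG n)) [IsProbabilityMeasure μ] [μ.IsMulLeftInvariant] (k : ℕ) (L : List ℤ)
    (a b : Fin n) {P : MT n} (hP : IsPr P) : ∫ U, tot U k L a b P ∂μ = 0 := by
  have := haar_deriv μ (Vu P hP) (f := fun U => mp U k a b * evU U (mon L))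
    (f' := fun U => Complex.I * tot U k L a b P) (((cont_mp k).matrix_elem a b).mul (cont_evU _))
    (continuous_const.mul (cont_tot k L a b P)) (fun U t => by
      refine ((Vu_HD P hP U k t a b).mul (dm_HD P hP U L t)).congr_deriv ?_
      simp only [tot, Matrix.smul_apply, smul_eq_mul]; ring)
  rw [integral_const_mul] at this
  exact (mul_eq_zero.1 this).resolve_left Complex.I_ne_zero

lemma isPr_diag (a : Fin n) : IsPr (Matrix.single a a 1 : MT n) := by
  constructor
  · simp
  · rw [Matrix.star_eq_conjTranspose]; simp

lemma isPr_off {a b : Fin n} (h : a ≠ b) (w : ℂ) (hw : star w * w = 1) :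
    IsPr ((1 / 2 : ℂ) • (Matrix.single a a 1 + Matrix.single b b 1 + w • Matrix.single a b 1
      + star w • Matrix.single b a 1) : MT n) := by
  constructor
  · simp only [smul_mul_smul_comm, mul_add, add_mul, mul_smul_comm, smul_mul_assoc,
      Matrix.single_mul_single_same, Matrix.single_mul_single_of_ne _ _ _ _ h,
      Matrix.single_mul_single_of_ne _ _ _ _ h.symm, mul_one, smul_smul, hw, mul_comm w, smul_zero, one_smul]
    simp only [add_zero, zero_add]
    linear_combination (norm := module) ((1/4 : ℂ) * hw) • (Matrix.single a a 1 + Matrix.single b b 1 : MT n)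
  · rw [Matrix.star_eq_conjTranspose]
    simp [Matrix.conjTranspose_add, Matrix.conjTranspose_smul]
    abel

lemma tot_single (μ : Measure (UG n)) [IsProbabilityMeasure μ] [μ.IsMulLeftInvariant] (k : ℕ) (L : List ℤ)
    (a b c d : Fin n) : ∫ U, tot U k L a b (Matrix.single c d 1) ∂μ = 0 := by
  by_cases h : c = d
  · subst h; exact tot_proj μ k L a b (isPr_diag c)
  · have h1 := tot_proj μ k L a b (isPr_off h 1 (by simp))
    have h2 := tot_proj μ k L a b (isPr_off h Complex.I (by simp))
    have h3 := tot_proj μ k L a b (isPr_diag c)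
    have h4 := tot_proj μ k L a b (isPr_diag d)
    set Q1 := ((1 / 2 : ℂ) • (Matrix.single c c 1 + Matrix.single d d 1 + (1:ℂ) • Matrix.single c d 1
      + star (1:ℂ) • Matrix.single d c 1) : MT n) with hQ1
    set Q2 := ((1 / 2 : ℂ) • (Matrix.single c c 1 + Matrix.single d d 1 + Complex.I • Matrix.single c d 1
      + star Complex.I • Matrix.single d c 1) : MT n) with hQ2
    have e : (Matrix.single c d 1 : MT n) = Q1 + (-Complex.I) • Q2 + (-(1 - Complex.I) / 2) • Matrix.single c c 1
        + (-(1 - Complex.I) / 2) • Matrix.single d d 1 := by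
      rw [hQ1, hQ2]
      have hs : star Complex.I = - Complex.I := Complex.conj_I
      rw [hs, star_one]
      simp only [smul_add, smul_smul]
      have h1 : -Complex.I * (1 / 2 * Complex.I) = 1 / 2 := by linear_combination (-1/2) * Complex.I_mul_I
      have h2 : -Complex.I * (1 / 2 * -Complex.I) = - (1 / 2) := by linear_combination (1/2) * Complex.I_mul_I
      rw [h1, h2]
      module
    have i := fun P : MT n => integ μ (cont_tot (n := n) k L a b P)
    rw [e]
    simp only [tot_add, tot_smul]
    rw [integral_add, integral_add, integral_add, integral_const_mul, integral_const_mul, integral_const_mul,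
      h1, h2, h3, h4]
    · simp
    · exact i _
    · exact (i _).const_mul _
    · exact (i _).add ((i _).const_mul _)
    · exact (i _).const_mul _
    · exact ((i _).add ((i _).const_mul _)).add ((i _).const_mul _)
    · exact (i _).const_mul _

lemma tot_sum (U : UG n) (k : ℕ) (L : List ℤ) :
    ∑ a, ∑ b, tot U k L a b (Matrix.single a b 1) = evU U (Lam k (mon L)) := by
  simp only [tot, Finset.sum_add_distrib, dm_sum, Lam, map_add, map_mul, ← Finset.sum_mul]
  congr 2
  have : evU U (Cc k) = ∑ l ∈ Finset.range k, trU U l * trU U ((k : ℤ) - l) := by simp [Cc, evU_X]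
  rw [this]
  simp only [Matrix.sum_apply]
  simp only [trU, Matrix.trace, Matrix.diag, Finset.sum_mul_sum]
  rw [Finset.sum_congr rfl fun _ _ => Finset.sum_comm, Finset.sum_comm]
  refine Finset.sum_congr rfl fun l _ => Finset.sum_congr rfl fun a _ => Finset.sum_congr rfl fun b _ => ?_
  simp [Matrix.mul_apply, Matrix.single_apply, ite_and, Finset.sum_mul]

lemma haar_loop_mon (μ : Measure (UG n)) [IsProbabilityMeasure μ] [μ.IsMulLeftInvariant] (k : ℕ) (L : List ℤ) :
    ∫ U, evU U (Lam k (mon L)) ∂μ = 0 := by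
  simp only [← tot_sum]
  rw [integral_finsetSum]
  · refine Finset.sum_eq_zero fun a _ => ?_
    rw [integral_finsetSum]
    · exact Finset.sum_eq_zero fun b _ => tot_single μ k L a b a b
    · intro b _; exact integ μ (cont_tot _ _ _ _ _)
  · intro a _; exact integ μ (continuous_finsetSum _ fun b _ => cont_tot _ _ _ _ _)

lemma Lam_smul (k : ℤ) (c : ℂ) (q : SP) : Lam k (c • q) = c • Lam k q := by
  simp [Lam, Derivation.map_smul]

/-- Haar expectation functional -/
def Hf (μ : Measure (UG n)) [IsProbabilityMeasure μ] : SP →ₗ[ℂ] ℂ where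
  toFun q := ∫ U, evU U q ∂μ
  map_add' p q := by
    simp only [map_add]
    exact integral_add (integ μ (cont_evU p)) (integ μ (cont_evU q))
  map_smul' c q := by
    simp only [map_smul]
    exact integral_smul _ _

lemma haar_loop_nat (μ : Measure (UG n)) [IsProbabilityMeasure μ] [μ.IsMulLeftInvariant] (k : ℕ) (q : SP) :
    Hf μ (Lam k q) = 0 := by
  obtain ⟨d, hd⟩ := exists_Sd q
  induction hd using Submodule.span_induction with
  | mem x h =>
    obtain ⟨M, -, rfl⟩ := h
    obtain ⟨L, rfl⟩ := Quot.exists_rep M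
    exact haar_loop_mon μ k L
  | zero => simp [Lam]
  | add x y _ _ hx hy => rw [Lam_add, map_add, hx, hy, add_zero]
  | smul a x _ hx => rw [Lam_smul, map_smul, hx, smul_zero]

lemma haar_loop (μ : Measure (UG n)) [IsProbabilityMeasure μ] [μ.IsMulLeftInvariant] (k : ℤ) (q : SP) :
    Hf μ (Lam k q) = 0 := by
  obtain ⟨m, rfl | rfl⟩ := k.eq_nat_or_neg
  · exact haar_loop_nat μ m q
  · have h := haar_loop_nat μ m (crev q)
    have e : Lam (-(m : ℤ)) q = - crev (Lam m (crev q)) := by rw [crev_Lam, crev_crev, neg_neg]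
    rw [e, map_neg]
    have : Hf μ (crev (Lam m (crev q))) = starRingEnd ℂ (Hf μ (Lam m (crev q))) := by
      simp only [Hf, LinearMap.coe_mk, AddHom.coe_mk, evU_crev]
      exact integral_conj
    rw [this, h]; simp

end
end CUE

open MeasureTheory Filter Topology Real
open scoped ENNReal

namespace CUE

noncomputable section
variable {n : ℕ}

open Polynomial in
lemma det_aeval (M : MT n) (p : ℂ[X]) :
    (aeval M p).det = (M.charpoly.roots.map (fun z => p.eval z)).prod := by
  have hM : M.charpoly = (M.charpoly.roots.map (fun a => X - C a)).prod :=
    (IsAlgClosed.splits M.charpoly).eq_prod_roots_of_monic M.charpoly_monic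
  have hcard : M.charpoly.roots.card = n := by
    rw [← (IsAlgClosed.splits M.charpoly).natDegree_eq_card_roots, Matrix.charpoly_natDegree_eq_dim]; simp
  have hlin : ∀ m : ℂ, (aeval M (X - C m)).det = (M.charpoly.roots.map (fun z => (X - C m : ℂ[X]).eval z)).prod := by
    intro m
    have h1 := Matrix.eval_charpoly M m
    have h2 : aeval M (X - C m) = -(Matrix.scalar (Fin n) m - M) := by
      simp [Matrix.algebraMap_eq_diagonal]
    rw [h2, Matrix.det_neg, ← h1, Fintype.card_fin]
    conv_lhs => rw [hM]
    rw [Polynomial.eval_multiset_prod, Multiset.map_map]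
    simp only [Function.comp_def, eval_sub, eval_X, eval_C]
    have : (M.charpoly.roots.map (fun z => z - m)) = (M.charpoly.roots.map (fun z => -1 * (m - z))) := by
      congr 1; funext z; ring
    rw [this, Multiset.prod_map_mul]
    simp [hcard]
  have hgen : ∀ s : Multiset ℂ, (aeval M ((s.map (fun a => X - C a)).prod)).det
      = (M.charpoly.roots.map (fun z => ((s.map (fun a => X - C a)).prod : ℂ[X]).eval z)).prod := by
    intro s
    induction s using Multiset.induction_on with
    | empty => simp
    | cons a s ih =>
      simp only [Multiset.map_cons, Multiset.prod_cons, map_mul, Matrix.det_mul, ih, hlin, eval_mul]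
      rw [Multiset.prod_map_mul]
  have hp := (IsAlgClosed.splits p).eq_prod_roots
  rw [hp, map_mul, Matrix.det_mul, hgen]
  simp only [eval_mul]
  rw [Multiset.prod_map_mul]
  congr 1
  simp [hcard, Matrix.algebraMap_eq_diagonal]

lemma trace_pow_roots (M : MT n) (k : ℕ) : (M ^ k).trace = (M.charpoly.roots.map (fun z => z ^ k)).sum := by
  have h : (M ^ k).charpoly = (M.charpoly.roots.map (fun z => Polynomial.X - Polynomial.C (z ^ k))).prod := by
    refine Polynomial.funext fun y => ?_
    rw [Matrix.eval_charpoly, Polynomial.eval_multiset_prod, Multiset.map_map]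
    have := det_aeval M (Polynomial.C y - Polynomial.X ^ k)
    simp only [map_sub, map_pow, Polynomial.aeval_X, Polynomial.aeval_C, Polynomial.eval_sub, Polynomial.eval_C,
      Polynomial.eval_pow, Polynomial.eval_X] at this
    simp only [Function.comp_def, Polynomial.eval_sub, Polynomial.eval_C, Polynomial.eval_X]
    rw [← this]; congr 1
  rw [Matrix.trace_eq_sum_roots_charpoly, h]
  have : (M.charpoly.roots.map (fun z => Polynomial.X - Polynomial.C (z ^ k))) =
    ((M.charpoly.roots.map (fun z => z ^ k)).map (fun z => Polynomial.X - Polynomial.C z)) := by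
    rw [Multiset.map_map]; rfl
  rw [this, Polynomial.roots_multiset_prod_X_sub_C]

/-- character evaluation -/
def evT (x : Fin n → ℝ) : LR n →ₐ[ℂ] ℂ :=
  AddMonoidAlgebra.lift ℂ ℂ (Fin n → ℤ)
    { toFun := fun k => Complex.exp ((∑ j, (Multiplicative.toAdd k j : ℂ) * x j) * Complex.I)
      map_one' := by simp
      map_mul' := fun a b => by
        rw [← Complex.exp_add, ← add_mul, ← Finset.sum_add_distrib]
        congr 2; refine Finset.sum_congr rfl fun j _ => ?_
        simp; ring }

lemma evT_single (x : Fin n → ℝ) (k : Fin n → ℤ) (c : ℂ) :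
    evT x (AddMonoidAlgebra.single k c) = c * Complex.exp ((∑ j, (k j : ℂ) * x j) * Complex.I) := by
  simp [evT, AddMonoidAlgebra.lift_single]

lemma evT_zp (x : Fin n → ℝ) (j : Fin n) (a : ℤ) : evT x (zp j a) = Complex.exp (a * x j * Complex.I) := by
  rw [zp, evT_single, one_mul, Finset.sum_eq_single j]
  · simp
  · intro i _ h; simp [h]
  · simp

lemma evT_ps (x : Fin n → ℝ) (a : ℤ) : evT x (ps n a) = ∑ j, Complex.exp (a * x j * Complex.I) := by
  simp [ps, evT_zp]

lemma evT_st (x : Fin n → ℝ) (f : LR n) : evT x (st f) = starRingEnd ℂ (evT x f) := by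
  induction f using AddMonoidAlgebra.induction_linear with
  | zero => simp
  | add f g hf hg => simp [hf, hg]
  | single m c =>
    rw [st_single, evT_single, evT_single, map_mul, ← Complex.exp_conj]
    simp

/-- Weyl density -/
def wden (x : Fin n → ℝ) : ℝ := ‖evT x (Van n)‖ ^ 2

lemma evT_ww (x : Fin n → ℝ) : evT x (ww n) = (wden x : ℂ) := by
  rw [ww_eq, map_mul, evT_st, Complex.conj_mul', wden]; push_cast; rfl

lemma cont_evT (f : LR n) : Continuous (fun x : Fin n → ℝ => evT x f) := by
  induction f using AddMonoidAlgebra.induction_linear with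
  | zero => simp only [map_zero]; exact continuous_const
  | add f g hf hg => simp only [map_add]; exact hf.add hg
  | single m c => simp only [evT_single]; fun_prop

lemma cont_wden : Continuous (wden (n := n)) := (cont_evT _).norm.pow 2

/-- uniform probability on [0,2π) -/
def nu : Measure ℝ := (ENNReal.ofReal (2 * π))⁻¹ • volume.restrict (Set.Ico 0 (2 * π))

instance : IsProbabilityMeasure nu := ⟨by
  simp only [nu, Measure.smul_apply, Measure.restrict_apply MeasurableSet.univ, Set.univ_inter, Real.volume_Ico, sub_zero,
    smul_eq_mul]
  exact ENNReal.inv_mul_cancel (by simp [Real.pi_pos]) ENNReal.ofReal_ne_top⟩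

lemma nu_int (k : ℤ) : ∫ x, Complex.exp (k * x * Complex.I) ∂nu = if k = 0 then 1 else 0 := by
  split_ifs with h
  · subst h; simp
  · rw [nu, integral_smul_measure, MeasureTheory.integral_Ico_eq_integral_Ioc,
      ← intervalIntegral.integral_of_le (by positivity)]
    have : ∀ x : ℝ, Complex.exp (k * x * Complex.I) = Complex.exp ((k * Complex.I) * x) := fun x => by ring_nf
    simp only [this]
    rw [integral_exp_mul_complex (by simp [h, Complex.I_ne_zero])]
    have e : Complex.exp (k * Complex.I * (2 * π : ℝ)) = 1 := by
      rw [Complex.exp_eq_one_iff]; exact ⟨k, by push_cast; ring⟩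
    rw [e]; simp

/-- product measure -/
abbrev piN (ι : Type*) [Fintype ι] : Measure (ι → ℝ) := Measure.pi (fun _ => nu)

lemma norm_evT_le (f : LR n) : ∃ C, ∀ x, ‖evT x f‖ ≤ C := by
  induction f using AddMonoidAlgebra.induction_linear with
  | zero => exact ⟨0, by simp⟩
  | add f g hf hg =>
    obtain ⟨C, hC⟩ := hf; obtain ⟨C', hC'⟩ := hg
    exact ⟨C + C', fun x => by rw [map_add]; exact (norm_add_le _ _).trans (add_le_add (hC x) (hC' x))⟩
  | single m c =>
    refine ⟨‖c‖, fun x => ?_⟩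
    rw [evT_single, norm_mul]
    have : (∑ j, (m j : ℂ) * x j) = ((∑ j, (m j : ℝ) * x j : ℝ) : ℂ) := by push_cast; rfl
    rw [this, Complex.norm_exp_ofReal_mul_I, mul_one]

lemma integ_evT (f : LR n) : Integrable (fun x => evT x f) (piN (Fin n)) := by
  obtain ⟨C, hC⟩ := norm_evT_le f
  exact Integrable.of_bound (cont_evT f).aestronglyMeasurable C (Eventually.of_forall hC)

lemma int_evT (f : LR n) : ∫ x, evT x f ∂(piN (Fin n)) = CT f := by
  induction f using AddMonoidAlgebra.induction_linear with
  | zero => simp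
  | add f g hf hg => simp only [map_add]; rw [integral_add (integ_evT f) (integ_evT g), hf, hg]
  | single m c =>
    simp only [evT_single]
    rw [integral_const_mul]
    simp only [Finset.sum_mul, Complex.exp_sum]
    rw [integral_fintype_prod_eq_prod (μ := fun _ => nu) (f := fun j (x : ℝ) => Complex.exp ((m j) * x * Complex.I))]
    simp only [nu_int, CT_apply, Finset.prod_ite_zero]
    by_cases h : m = 0
    · subst h; simp
    · have : ¬ ∀ i ∈ Finset.univ, m i = 0 := fun h2 => h (funext fun i => h2 i (Finset.mem_univ _))
      simp [h, this]; intro h3; exact absurd (funext h3) h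

lemma evU_eq (U : UG n) (x : Fin n → ℝ) (hx : (Matrix.charpoly (U : MT n)).roots
        = Multiset.map (fun j => Complex.exp ((x j : ℂ) * Complex.I)) (Finset.univ : Finset (Fin n)).val) (s : SP) :
    evU U s = evT x (evR n s) := by
  have hk : ∀ k : ℕ, trU U k = evT x (ps n k) := by
    intro k
    rw [trU, mp_nat, trace_pow_roots, hx, Multiset.map_map, evT_ps]
    simp only [Function.comp_def]
    rw [Finset.sum]
    congr 2; funext j
    rw [← Complex.exp_nat_mul]; congr 1; push_cast; ring
  induction s using MvPolynomial.induction_on with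
  | C a => rw [← MvPolynomial.algebraMap_eq, AlgHom.commutes, AlgHom.commutes, AlgHom.commutes]
  | add p q hp hq => simp only [map_add, hp, hq]
  | mul_X p a hp =>
    rw [map_mul, map_mul, map_mul, hp, evU_X, evR_X]
    congr 1
    obtain ⟨m, rfl | rfl⟩ := a.eq_nat_or_neg
    · exact hk m
    · rw [trU_neg, hk, ← st_ps, evT_st]; rfl

end
end CUE

open MeasureTheory Filter Topology Real
open scoped ENNReal

namespace CUE

noncomputable section
variable {n : ℕ}

section border
open Matrix
variable {ι : Type*} [Fintype ι] [DecidableEq ι]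

lemma border_inv (M : Matrix ι ι ℂ) (u : Matrix ι Unit ℂ) (v : Matrix Unit ι ℂ) (c : Matrix Unit Unit ℂ) (h : M.det ≠ 0) :
    (fromBlocks M u v c).det = c () () * M.det - (v * M.adjugate * u) () () := by
  have : Invertible M := M.invertibleOfIsUnitDet (isUnit_iff_ne_zero.2 h)
  rw [det_fromBlocks₁₁, det_unique (c - _), invOf_eq_nonsing_inv, Matrix.inv_def, Ring.inverse_eq_inv']
  simp only [Matrix.mul_smul, Matrix.smul_mul, Matrix.sub_apply, Matrix.smul_apply, smul_eq_mul]
  rw [show (default : Unit) = () from rfl]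
  field_simp

lemma border (M : Matrix ι ι ℂ) (u : Matrix ι Unit ℂ) (v : Matrix Unit ι ℂ) (c : Matrix Unit Unit ℂ) :
    (fromBlocks M u v c).det = c () () * M.det - (v * M.adjugate * u) () () := by
  set N : ℂ → Matrix ι ι ℂ := fun t => M + t • 1 with hN
  have hNc : Continuous N := by
    exact continuous_const.add (continuous_id.smul continuous_const)
  have hdet : ∀ t, (N t).det = (-M).charpoly.eval t := by
    intro t
    rw [Matrix.eval_charpoly, hN]
    congr 1
    ext i j
    simp [Matrix.one_apply, Matrix.scalar_apply, Matrix.diagonal_apply, add_comm]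
  have hfin : {t | (N t).det = 0}.Finite := by
    refine ((-M).charpoly.roots.toFinset.finite_toSet).subset fun t ht => ?_
    simp only [Finset.mem_coe, Multiset.mem_toFinset]
    rw [Polynomial.mem_roots (Matrix.charpoly_monic _).ne_zero, Polynomial.IsRoot, ← hdet]; exact ht
  have hdense : Dense ({t | (N t).det = 0}ᶜ) := Set.Countable.dense_compl ℝ hfin.countable
  have h1 : Continuous (fun t => (fromBlocks (N t) u v c).det) :=
    (hNc.matrix_fromBlocks continuous_const continuous_const continuous_const).matrix_det
  have h2 : Continuous (fun t => c () () * (N t).det - (v * (N t).adjugate * u) () ()) :=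
    (continuous_const.mul hNc.matrix_det).sub
      (((continuous_const.matrix_mul hNc.matrix_adjugate).matrix_mul continuous_const).matrix_elem _ _)
  have := congrFun (h1.ext_on hdense h2 (fun t ht => border_inv _ _ _ _ ht)) 0
  simpa [hN] using this
end border

section rho
variable {ι : Type*} [Fintype ι] [DecidableEq ι]

/-- centred frequencies -/
def kap (n : ℕ) (k : Fin n) : ℝ := (k : ℝ) - ((n : ℝ) - 1) / 2

/-- the single character -/
def ch (n : ℕ) (k : Fin n) (t : ℝ) : ℂ := Complex.exp ((kap n k * t : ℝ) * Complex.I)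

/-- frame matrix -/
def Am (n : ℕ) (y : ι → ℝ) : Matrix ι (Fin n) ℂ := Matrix.of fun i k => ch n k (y i)

/-- correlation kernel -/
def Km (n : ℕ) (y : ι → ℝ) : Matrix ι ι ℂ := Am n y * (Am n y).conjTranspose

/-- correlation functions -/
def rho (n : ℕ) (y : ι → ℝ) : ℝ := (Km n y).det.re

open scoped ComplexOrder

lemma Km_psd (y : ι → ℝ) : (Km n y).PosSemidef := Matrix.posSemidef_self_mul_conjTranspose _

lemma rho_det (y : ι → ℝ) : (Km n y).det = (rho n y : ℂ) := by
  have := (Km_psd (n := n) y).det_nonneg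
  rw [Complex.le_def] at this
  apply Complex.ext
  · simp [rho]
  · simp [this.2.symm]

lemma rho_nonneg (y : ι → ℝ) : 0 ≤ rho n y := by
  have := (Km_psd (n := n) y).det_nonneg
  rw [Complex.le_def] at this
  exact this.1

lemma ch_norm (k : Fin n) (t : ℝ) : ‖ch n k t‖ = 1 := Complex.norm_exp_ofReal_mul_I _

lemma ch_mul_conj (k : Fin n) (t : ℝ) : ch n k t * star (ch n k t) = 1 := by
  rw [Complex.star_def, Complex.mul_conj', ch_norm]; simp

lemma ch_cont (k : Fin n) : Continuous (ch n k) := by unfold ch; fun_prop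

lemma ch_int (k l : Fin n) : ∫ t, ch n k t * star (ch n l t) ∂nu = if k = l then 1 else 0 := by
  have : ∀ t : ℝ, ch n k t * star (ch n l t) = Complex.exp (((k : ℤ) - (l : ℤ) : ℤ) * t * Complex.I) := by
    intro t
    rw [ch, ch, Complex.star_def, ← Complex.exp_conj, ← Complex.exp_add]
    congr 1
    rw [map_mul, Complex.conj_ofReal, Complex.conj_I]
    unfold kap
    push_cast; ring
  simp only [this, nu_int, sub_eq_zero, Nat.cast_inj, Fin.val_inj]

lemma Am_cont : Continuous (fun y : ι → ℝ => Am n y) := by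
  refine continuous_matrix fun i k => ?_
  exact (ch_cont k).comp (continuous_apply i)

lemma rho_cont : Continuous (rho n : (ι → ℝ) → ℝ) := by
  unfold rho Km
  exact Complex.continuous_re.comp (Am_cont.matrix_mul Am_cont.matrix_conjTranspose).matrix_det

lemma Km_diag (y : ι → ℝ) (i : ι) : Km n y i i = n := by
  simp only [Km, Matrix.mul_apply, Matrix.conjTranspose_apply, Am, Matrix.of_apply, ch_mul_conj]; simp

lemma rho_reindex {κ : Type*} [Fintype κ] [DecidableEq κ] (e : κ ≃ ι) (y : ι → ℝ) : rho n (y ∘ e) = rho n y := by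
  rw [rho, rho, ← Matrix.det_submatrix_equiv_self e (Km n y)]; rfl

lemma wden_eq (x : Fin n → ℝ) : wden x = rho n x := by
  have h1 : evT x (Van n) = (Matrix.vandermonde (fun j => Complex.exp (x j * Complex.I))).det := by
    rw [Matrix.det_vandermonde, Van, map_prod]
    refine Finset.prod_congr rfl fun i _ => ?_
    rw [map_prod]
    refine Finset.prod_congr rfl fun j _ => ?_
    simp [evT_zp]
  have h2 : Am n x = Matrix.diagonal (fun j => Complex.exp ((-((n : ℝ) - 1) / 2 * x j : ℝ) * Complex.I)) *
      Matrix.vandermonde (fun j => Complex.exp (x j * Complex.I)) := by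
    ext j k
    rw [Matrix.diagonal_mul, Matrix.vandermonde_apply, Am, Matrix.of_apply, ch, ← Complex.exp_nat_mul, ← Complex.exp_add]
    congr 1; simp [kap]; ring
  have h3 : ‖(Am n x).det‖ = ‖evT x (Van n)‖ := by
    rw [h2, Matrix.det_mul, norm_mul, Matrix.det_diagonal, norm_prod, h1]
    simp only [Complex.norm_exp_ofReal_mul_I]; simp
  rw [rho, Km, Matrix.det_mul, Matrix.det_conjTranspose, Complex.star_def, Complex.mul_conj', h3, wden]
  norm_cast

lemma ch_integrable (k l : Fin n) : Integrable (fun t => ch n k t * star (ch n l t)) nu := by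
  refine Integrable.of_bound ((ch_cont k).mul (ch_cont l).star).aestronglyMeasurable 1 (Eventually.of_forall fun t => ?_)
  rw [norm_mul, norm_star, ch_norm, ch_norm, one_mul]

lemma rho_last (y : ι → ℝ) :
    Integrable (fun t => rho n (Sum.elim y (fun _ : Unit => t))) nu ∧
    ∫ t, rho n (Sum.elim y (fun _ : Unit => t)) ∂nu = ((n : ℝ) - Fintype.card ι) * rho n y := by
  have hb : ∀ t, (rho n (Sum.elim y (fun _ : Unit => t)) : ℂ) = n * (rho n y : ℂ) -
      ∑ j, ∑ i, ∑ k, ∑ l, (star (Am n y i k) * (Km n y).adjugate i j * Am n y j l) * (ch n k t * star (ch n l t)) := by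
    intro t
    rw [← rho_det, ← rho_det]
    have : Km n (Sum.elim y (fun _ : Unit => t)) = Matrix.fromBlocks (Km n y)
        (Am n y * (Am n (fun _ : Unit => t)).conjTranspose) (Am n (fun _ : Unit => t) * (Am n y).conjTranspose)
        (Km n (fun _ : Unit => t)) := by
      ext (i | i) (j | j) <;> rfl
    rw [this, border, Km_diag]
    congr 1
    simp only [Matrix.mul_apply, Finset.sum_mul, Finset.mul_sum, Matrix.conjTranspose_apply, Am, Matrix.of_apply]
    refine Finset.sum_congr rfl fun j _ => ?_
    rw [Finset.sum_comm]
    refine Finset.sum_congr rfl fun i _ => ?_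
    rw [Finset.sum_comm]
    refine Finset.sum_congr rfl fun k _ => Finset.sum_congr rfl fun l _ => ?_
    ring
  have hi : Integrable (fun t => rho n (Sum.elim y (fun _ : Unit => t))) nu := by
    have : Integrable (fun t => (rho n (Sum.elim y (fun _ : Unit => t)) : ℂ)) nu := by
      simp only [hb]
      refine (integrable_const _).sub ?_
      refine integrable_finsetSum _ fun j _ => integrable_finsetSum _ fun i _ => integrable_finsetSum _ fun k _ =>
        integrable_finsetSum _ fun l _ => (ch_integrable k l).const_mul _
    simpa using this.re
  refine ⟨hi, ?_⟩
  have : ((∫ t, rho n (Sum.elim y (fun _ : Unit => t)) ∂nu : ℝ) : ℂ) = ((((n : ℝ) - Fintype.card ι) * rho n y : ℝ) : ℂ) := by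
    rw [← integral_complex_ofReal]
    simp only [hb]
    have i4 := fun j i k l => (ch_integrable (n := n) k l).const_mul (star (Am n y i k) * (Km n y).adjugate i j * Am n y j l)
    have i3 := fun j i k => integrable_finsetSum Finset.univ fun l _ => i4 j i k l
    have i2 := fun j i => integrable_finsetSum Finset.univ fun k _ => i3 j i k
    have i1 := fun j => integrable_finsetSum Finset.univ fun i _ => i2 j i
    rw [integral_sub (integrable_const _) (integrable_finsetSum _ fun j _ => i1 j)]
    rw [integral_finsetSum _ fun j _ => i1 j]
    simp_rw [integral_finsetSum _ fun i _ => i2 _ i, integral_finsetSum _ fun k _ => i3 _ _ k,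
      integral_finsetSum _ fun l _ => i4 _ _ _ l, integral_const_mul, ch_int]
    have : ∑ j, ∑ i, ∑ k, ∑ l, (star (Am n y i k) * (Km n y).adjugate i j * Am n y j l) * (if k = l then (1:ℂ) else 0)
        = (Km n y * (Km n y).adjugate).trace := by
      simp only [mul_ite, mul_one, mul_zero, Finset.sum_ite_eq, Finset.mem_univ, if_true]
      rw [Matrix.trace]
      refine Finset.sum_congr rfl fun j _ => ?_
      rw [Matrix.diag, Matrix.mul_apply]
      refine Finset.sum_congr rfl fun i _ => ?_
      rw [Km, Matrix.mul_apply, Finset.sum_mul]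
      refine Finset.sum_congr rfl fun k _ => ?_
      rw [Matrix.conjTranspose_apply]; ring
    rw [this, Matrix.mul_adjugate, Matrix.trace_smul, Matrix.trace_one, rho_det]
    simp; ring
  exact_mod_cast this
end rho

end
end CUE

open MeasureTheory Filter Topology Real
open scoped ENNReal

namespace CUE

noncomputable section
variable {n : ℕ}

lemma piN_reindex {ι κ : Type*} [Fintype ι] [Fintype κ] (e : κ ≃ ι) (F : (κ → ℝ) → ℝ≥0∞) :
    ∫⁻ x, F (x ∘ e) ∂piN ι = ∫⁻ y, F y ∂piN κ := by
  have h := measurePreserving_arrowCongr' (fun _ : ι => nu) (fun _ : κ => nu) e.symm (MeasurableEquiv.refl ℝ)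
    (fun _ => MeasurePreserving.id nu)
  rw [← h.lintegral_comp_emb (MeasurableEquiv.measurableEmbedding _)]
  rfl

lemma piN_sum {ι κ : Type*} [Fintype ι] [Fintype κ] (F : (ι ⊕ κ → ℝ) → ℝ≥0∞) (hF : Measurable F) :
    ∫⁻ z, F z ∂piN (ι ⊕ κ) = ∫⁻ y, ∫⁻ w, F (Sum.elim y w) ∂piN κ ∂piN ι := by
  have h := measurePreserving_sumPiEquivProdPi_symm (fun _ : ι ⊕ κ => nu)
  rw [← h.lintegral_comp_emb (MeasurableEquiv.measurableEmbedding _)]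
  rw [lintegral_prod (fun a => F ((MeasurableEquiv.sumPiEquivProdPi fun _ => ℝ).symm a)) (hF.comp (MeasurableEquiv.measurable _)).aemeasurable]
  refine lintegral_congr fun y => lintegral_congr fun w => ?_
  rfl

lemma piN_unit (F : (Unit → ℝ) → ℝ≥0∞) : ∫⁻ w, F w ∂piN Unit = ∫⁻ t, F (fun _ => t) ∂nu := by
  have h := (measurePreserving_piUnique (fun _ : Unit => nu)).symm
  rw [← h.lintegral_comp_emb (MeasurableEquiv.measurableEmbedding _)]
  rfl

lemma rho_meas {ι : Type*} [Fintype ι] [DecidableEq ι] : Measurable (rho n : (ι → ℝ) → ℝ) := rho_cont.measurable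

lemma rho_last_l {ι : Type*} [Fintype ι] [DecidableEq ι] (y : ι → ℝ) (hc : Fintype.card ι ≤ n) :
    ∫⁻ t, ENNReal.ofReal (rho n (Sum.elim y (fun _ : Unit => t))) ∂nu
      = ((n - Fintype.card ι : ℕ) : ℝ≥0∞) * ENNReal.ofReal (rho n y) := by
  rw [← ofReal_integral_eq_lintegral_ofReal (rho_last y).1 (Eventually.of_forall fun t => rho_nonneg _), (rho_last y).2,
    ENNReal.ofReal_mul (by rw [sub_nonneg]; exact_mod_cast hc), ← Nat.cast_sub hc, ENNReal.ofReal_natCast]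

theorem corr (d : ℕ) : ∀ (ι : Type) [Fintype ι] [DecidableEq ι] (φ : ι ↪ Fin n), Fintype.card ι + d = n →
    ∀ F : (ι → ℝ) → ℝ≥0∞, Measurable F → ∫⁻ x, F (x ∘ φ) * ENNReal.ofReal (wden x) ∂piN (Fin n)
      = (d.factorial : ℝ≥0∞) * ∫⁻ y, F y * ENNReal.ofReal (rho n y) ∂piN ι := by
  induction d with
  | zero =>
    intro ι _ _ φ hc F hF
    have hb : Function.Bijective φ := (Fintype.bijective_iff_injective_and_card _).2 ⟨φ.injective, by simpa using hc⟩
    let e := Equiv.ofBijective φ hb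
    rw [← piN_reindex e]
    simp only [Nat.factorial_zero, Nat.cast_one, one_mul]
    refine lintegral_congr fun x => ?_
    rw [rho_reindex, wden_eq]
    rfl
  | succ d ih =>
    intro ι _ _ φ hc F hF
    obtain ⟨j, hj⟩ : ∃ j, j ∉ Set.range φ := by
      by_contra h
      push Not at h
      have := Fintype.card_le_of_surjective φ h
      simp at this; omega
    let ψ : ι ⊕ Unit ↪ Fin n := ⟨Sum.elim φ (fun _ => j), by
      refine φ.injective.sumElim (fun _ _ _ => rfl) ?_
      intro a _ h
      exact hj ⟨a, h⟩⟩
    have hm : Measurable (fun z : ι ⊕ Unit → ℝ => F (z ∘ Sum.inl)) :=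
      hF.comp (by fun_prop)
    have := ih (ι ⊕ Unit) ψ (by simp; omega) (fun z => F (z ∘ Sum.inl)) hm
    have h2 : ∀ x : Fin n → ℝ, (x ∘ ψ) ∘ Sum.inl = x ∘ φ := fun x => rfl
    simp only [h2] at this
    rw [this, piN_sum (fun y => F (y ∘ Sum.inl) * ENNReal.ofReal (rho n y)) (hm.mul rho_meas.ennreal_ofReal)]
    rw [Nat.factorial_succ, Nat.cast_mul, mul_comm ((d+1 : ℕ) : ℝ≥0∞), mul_assoc]
    congr 1
    rw [← lintegral_const_mul ((d+1 : ℕ) : ℝ≥0∞) (f := fun y => F y * ENNReal.ofReal (rho n y)) (hF.mul rho_meas.ennreal_ofReal)]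
    refine lintegral_congr fun y => ?_
    rw [piN_unit]
    have h3 : ∀ w : Unit → ℝ, Sum.elim y w ∘ Sum.inl = y := fun w => rfl
    simp only [h3]
    rw [lintegral_const_mul, rho_last_l y (by omega)]
    · rw [show n - Fintype.card ι = d + 1 by omega]; ring
    · refine (rho_meas.comp ?_).ennreal_ofReal
      refine measurable_pi_iff.2 ?_
      rintro (i | i) <;> simp <;> fun_prop

lemma lint_wden : ∫⁻ x, ENNReal.ofReal (wden x) ∂piN (Fin n) = n.factorial := by
  have := corr (n := n) n Empty ⟨Empty.elim, fun a => a.elim⟩ (by simp) (fun _ => 1) measurable_const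
  simp only [one_mul] at this
  rw [this]
  have : ∀ y : Empty → ℝ, rho n y = 1 := by
    intro y; simp [rho]
  simp [this]

lemma CT_ww : CT (ww n) = n.factorial := by
  rw [← int_evT]
  simp only [evT_ww]
  rw [integral_complex_ofReal, integral_eq_lintegral_of_nonneg_ae, lint_wden]
  · simp
  · exact Eventually.of_forall fun x => by simp only [wden]; positivity
  · exact cont_wden.aestronglyMeasurable

/-- Weyl measure on angles. -/
def W (n : ℕ) : Measure (Fin n → ℝ) := (piN (Fin n)).withDensity (fun x => ENNReal.ofReal (wden x) / n.factorial)

lemma wden_meas : Measurable (fun x : Fin n → ℝ => ENNReal.ofReal (wden x) / n.factorial) := 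
  (cont_wden.measurable.ennreal_ofReal).div_const _

instance : IsProbabilityMeasure (W n) := ⟨by
  rw [W, withDensity_apply _ MeasurableSet.univ, Measure.restrict_univ]
  simp only [div_eq_mul_inv]
  rw [lintegral_mul_const _ cont_wden.measurable.ennreal_ofReal, lint_wden, ENNReal.mul_inv_cancel]
  · exact_mod_cast n.factorial_ne_zero
  · simp⟩

/-- correlation functions of the Weyl measure -/
theorem corrW {ι : Type} [Fintype ι] [DecidableEq ι] (φ : ι ↪ Fin n) (F : (ι → ℝ) → ℝ≥0∞) (hF : Measurable F) :
    (n.descFactorial (Fintype.card ι) : ℝ≥0∞) * ∫⁻ x, F (x ∘ φ) ∂(W n) = ∫⁻ y, F y * ENNReal.ofReal (rho n y) ∂piN ι := by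
  have hc : Fintype.card ι ≤ n := by simpa using Fintype.card_le_of_embedding φ
  have hFφ : Measurable (fun x : Fin n → ℝ => F (x ∘ φ)) := hF.comp (by fun_prop)
  rw [W, lintegral_withDensity_eq_lintegral_mul _ wden_meas hFφ]
  simp only [Pi.mul_apply, div_eq_mul_inv]
  have : ∀ x : Fin n → ℝ, ENNReal.ofReal (wden x) * (n.factorial : ℝ≥0∞)⁻¹ * F (x ∘ φ) = F (x ∘ φ) * ENNReal.ofReal (wden x) * (n.factorial : ℝ≥0∞)⁻¹ := fun x => by ring
  simp only [this]
  rw [lintegral_mul_const _ (f := fun x => F (x ∘ φ) * ENNReal.ofReal (wden x)) (hFφ.mul cont_wden.measurable.ennreal_ofReal), corr (n - Fintype.card ι) ι φ (by omega) F hF]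
  rw [← Nat.factorial_mul_descFactorial hc, Nat.cast_mul]
  have h1 : ((n - Fintype.card ι).factorial : ℝ≥0∞) ≠ 0 := by exact_mod_cast (Nat.factorial_ne_zero _)
  have h2 : (n.descFactorial (Fintype.card ι) : ℝ≥0∞) ≠ 0 := by
    exact_mod_cast (Nat.descFactorial_eq_zero_iff_lt.not.2 (by omega))
  rw [ENNReal.mul_inv (Or.inl h1) (Or.inl (by simp))]
  calc _ = (((n - Fintype.card ι).factorial : ℝ≥0∞) * ((n - Fintype.card ι).factorial : ℝ≥0∞)⁻¹) * ((n.descFactorial (Fintype.card ι) : ℝ≥0∞) * (n.descFactorial (Fintype.card ι) : ℝ≥0∞)⁻¹) * ∫⁻ y, F y * ENNReal.ofReal (rho n y) ∂piN ι := by ring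
    _ = _ := by rw [ENNReal.mul_inv_cancel h1 (by simp), ENNReal.mul_inv_cancel h2 (by simp)]; simp

end
end CUE

open MeasureTheory Filter Topology Real
open scoped ENNReal

namespace CUE

noncomputable section
variable {n : ℕ}

lemma perm_of_ps (z w : Fin n → ℂ) (h : ∀ k : ℕ, ∑ j, z j ^ k = ∑ j, w j ^ k) :
    ∃ σ : Equiv.Perm (Fin n), ∀ j, w (σ j) = z j := by
  classical
  have hp : ∀ p : Polynomial ℂ, ∑ j, p.eval (z j) = ∑ j, p.eval (w j) := by
    intro p
    simp only [Polynomial.eval_eq_sum_range]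
    rw [Finset.sum_comm, Finset.sum_comm (s := Finset.univ)]
    refine Finset.sum_congr rfl fun k _ => ?_
    rw [← Finset.mul_sum, ← Finset.mul_sum, h]
  have hc : ∀ c : ℂ, Fintype.card {j // z j = c} = Fintype.card {j // w j = c} := by
    intro c
    let S : Finset ℂ := (Finset.univ.image z ∪ Finset.univ.image w).erase c
    let p : Polynomial ℂ := ∏ v ∈ S, (Polynomial.X - Polynomial.C v)
    have hpe : ∀ u, p.eval u = ∏ v ∈ S, (u - v) := by
      intro u; simp [p, Polynomial.eval_prod]
    have hpc : p.eval c ≠ 0 := by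
      rw [hpe, Finset.prod_ne_zero_iff]
      intro v hv
      rw [sub_ne_zero]
      exact (Finset.ne_of_mem_erase hv).symm
    have h0 : ∀ u, u ∈ Finset.univ.image z ∪ Finset.univ.image w → p.eval u = if u = c then p.eval c else 0 := by
      intro u hu
      split_ifs with hh
      · rw [hh]
      · rw [hpe]
        exact Finset.prod_eq_zero (Finset.mem_erase.2 ⟨hh, hu⟩) (sub_self u)
    have := hp p
    rw [Finset.sum_congr rfl fun j _ => h0 (z j) (by simp), Finset.sum_congr rfl fun j _ => h0 (w j) (by simp)] at this
    rw [← Finset.sum_filter, ← Finset.sum_filter, Finset.sum_const, Finset.sum_const, nsmul_eq_mul, nsmul_eq_mul] at this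
    have := mul_right_cancel₀ hpc this
    rw [Fintype.card_subtype, Fintype.card_subtype]
    exact_mod_cast this
  refine ⟨Equiv.ofFiberEquiv (f := z) (g := w) fun c => Fintype.equivOfCardEq (hc c), fun j => ?_⟩
  exact Equiv.ofFiberEquiv_map _ j

/-- target space of the trace moments -/
abbrev Yn (n : ℕ) := ℕ → Metric.closedBall (0 : ℂ) n

lemma ps_norm (x : Fin n → ℝ) (k : ℕ) : ‖∑ j, Complex.exp ((k : ℤ) * x j * Complex.I)‖ ≤ n := by
  refine (norm_sum_le _ _).trans ?_
  have : ∀ j, ‖Complex.exp ((k : ℤ) * x j * Complex.I)‖ = 1 := fun j => by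
    rw [← Complex.norm_exp_ofReal_mul_I (k * x j)]; push_cast; rfl
  rw [Finset.sum_congr rfl fun j _ => this j]; simp

/-- moment map -/
def Pm (x : Fin n → ℝ) : Yn n := fun k => ⟨∑ j, Complex.exp (((k + 1 : ℕ) : ℤ) * x j * Complex.I), by
  rw [mem_closedBall_zero_iff]; exact ps_norm x (k + 1)⟩

lemma Pm_cont : Continuous (Pm : (Fin n → ℝ) → Yn n) := by
  refine continuous_pi fun k => Continuous.subtype_mk ?_ _
  fun_prop

/-- coordinates -/
def cY (y : Yn n) (a : ℤ) : ℂ := if a = 0 then n else if 0 < a then (y (a.toNat - 1) : ℂ) else starRingEnd ℂ (y ((-a).toNat - 1) : ℂ)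

lemma cY_neg (y : Yn n) (a : ℤ) : cY y (-a) = starRingEnd ℂ (cY y a) := by
  rcases lt_trichotomy a 0 with h | h | h
  · have h1 : ¬ (0 < a) := by omega
    simp [cY, h.ne, h, h1]
  · simp [cY, h]
  · have h1 : ¬ (a < 0) := by omega
    simp [cY, h.ne', h, h1]

lemma cY_Pm (x : Fin n → ℝ) (a : ℤ) : cY (Pm x) a = evT x (ps n a) := by
  rcases lt_trichotomy a 0 with h | h | h
  · have h1 : ¬ (0 < a) := by omega
    rw [cY, if_neg h.ne, if_neg h1, evT_ps, Pm]
    simp only [map_sum, ← Complex.exp_conj]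
    refine Finset.sum_congr rfl fun j _ => ?_
    congr 1
    simp only [map_mul, Complex.conj_I, Complex.conj_ofReal]
    rw [Nat.sub_add_cancel (by omega), Int.toNat_of_nonneg (by omega)]; simp
  · simp [cY, h, evT_ps]
  · rw [cY, if_neg h.ne', if_pos h, evT_ps, Pm]
    simp only
    rw [Nat.sub_add_cancel (by omega), Int.toNat_of_nonneg (by omega)]

/-- evaluation on the moment space -/
def evY (y : Yn n) : SP →ₐ[ℂ] ℂ := MvPolynomial.aeval (cY y)

lemma evY_X (y : Yn n) (a : ℤ) : evY y (MvPolynomial.X a) = cY y a := by simp [evY]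

lemma evY_crev (y : Yn n) (q : SP) : evY y (crev q) = starRingEnd ℂ (evY y q) := by
  induction q using MvPolynomial.induction_on with
  | C a => rw [crev_C, ← MvPolynomial.algebraMap_eq, AlgHom.commutes, AlgHom.commutes]; rfl
  | add p q hp hq => simp only [map_add, hp, hq]
  | mul_X p a hp => rw [map_mul, map_mul, hp, crev_X, evY_X, cY_neg, map_mul, evY_X, map_mul]

lemma evY_Pm (x : Fin n → ℝ) (q : SP) : evY (Pm x) q = evT x (evR n q) := by
  have : evY (Pm x) = (evT x).comp (evR n) := by
    apply MvPolynomial.algHom_ext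
    intro a
    rw [evY_X, cY_Pm]
    simp [evR]
  rw [this]; rfl

open BoundedContinuousFunction

/-- the separating star algebra -/
def Aal (n : ℕ) : StarSubalgebra ℂ (Yn n →ᵇ ℂ) where
  carrier := {g | ∃ q : SP, ∀ y, g y = evY y q}
  mul_mem' := by
    rintro a b ⟨p, hp⟩ ⟨q, hq⟩
    exact ⟨p * q, fun y => by simp [hp, hq]⟩
  add_mem' := by
    rintro a b ⟨p, hp⟩ ⟨q, hq⟩
    exact ⟨p + q, fun y => by simp [hp, hq]⟩
  algebraMap_mem' := by
    intro r
    exact ⟨algebraMap ℂ SP r, fun y => by rw [AlgHom.commutes]; rfl⟩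
  star_mem' := by
    rintro a ⟨p, hp⟩
    exact ⟨crev p, fun y => by rw [evY_crev, ← hp]; rfl⟩

lemma Aal_sep : ((Aal n).map (toContinuousMapStarₐ ℂ)).SeparatesPoints := by
  intro y y' hne
  obtain ⟨k, hk⟩ := Function.ne_iff.1 hne
  let f : C(Yn n, ℂ) := ⟨fun y => (y k : ℂ), by fun_prop⟩
  refine ⟨f, ⟨f, ⟨mkOfCompact f, ⟨MvPolynomial.X ((k + 1 : ℕ) : ℤ), fun y => ?_⟩, ?_⟩, rfl⟩, ?_⟩
  · rw [evY_X, cY, if_neg (by omega), if_pos (by omega), Int.toNat_natCast]; rfl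
  · rfl
  · exact fun h => hk (Subtype.ext h)

variable (μ : Measure (UG n)) [IsProbabilityMeasure μ] [μ.IsMulLeftInvariant]
  (θ : UG n → Fin n → ℝ) 

lemma Pm_tr (heig : ∀ U : UG n, (Matrix.charpoly (U : MT n)).roots
        = Multiset.map (fun j => Complex.exp ((θ U j : ℂ) * Complex.I)) (Finset.univ : Finset (Fin n)).val) :
    Measurable (fun U => Pm (θ U)) := by
  refine measurable_pi_iff.2 fun k => Measurable.subtype_mk ?_
  have : (fun U => ∑ j, Complex.exp (((k + 1 : ℕ) : ℤ) * θ U j * Complex.I)) = fun U => trU U ((k + 1 : ℕ) : ℤ) := by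
    funext U
    rw [← evU_X, evU_eq U _ (heig U), evR, MvPolynomial.aeval_X, evT_ps]
  rw [this]
  exact (cont_trU _).measurable

lemma int_W (f : LR n) : ∫ x, evT x f ∂(W n) = CT (f * ww n) / n.factorial := by
  rw [W, integral_withDensity_eq_integral_toReal_smul wden_meas
    (Eventually.of_forall fun x => ENNReal.div_lt_top ENNReal.ofReal_ne_top (by exact_mod_cast n.factorial_ne_zero))]
  rw [← int_evT, ← integral_div]
  refine integral_congr_ae (Eventually.of_forall fun x => ?_)
  have : 0 ≤ wden x := by unfold wden; positivity
  simp only [ENNReal.toReal_div, ENNReal.toReal_ofReal this, ENNReal.toReal_natCast, map_mul, evT_ww, Complex.real_smul]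
  push_cast; ring

theorem weyl_law (heig : ∀ U : UG n, (Matrix.charpoly (U : MT n)).roots
        = Multiset.map (fun j => Complex.exp ((θ U j : ℂ) * Complex.I)) (Finset.univ : Finset (Fin n)).val) :
    μ.map (fun U => Pm (θ U)) = (W n).map Pm := by
  have hm := Pm_tr θ heig
  have : IsProbabilityMeasure (μ.map (fun U => Pm (θ U))) := Measure.isProbabilityMeasure_map hm.aemeasurable
  have : IsProbabilityMeasure ((W n).map Pm) := Measure.isProbabilityMeasure_map Pm_cont.measurable.aemeasurable
  refine ext_of_forall_mem_subalgebra_integral_eq_of_polish (𝕜 := ℂ) Aal_sep ?_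
  rintro g ⟨q, hq⟩
  rw [integral_map hm.aemeasurable g.continuous.aestronglyMeasurable,
    integral_map Pm_cont.measurable.aemeasurable g.continuous.aestronglyMeasurable]
  simp only [hq, evY_Pm, int_W, ← evU_eq _ _ (heig _)]
  have := weyl_alg (n := n) (Hf μ) (haar_loop μ) (by simp [Hf]) (fun s hs => by
    simp only [Hf, LinearMap.coe_mk, AddHom.coe_mk]
    simp [evU_eq _ _ (heig _), hs]) q
  rw [this, CT_ww, mul_div_cancel_right₀ _ (by exact_mod_cast n.factorial_ne_zero)]
  rfl

/-- the box -/
def Tb (n : ℕ) : Set (Fin n → ℝ) := Set.univ.pi fun _ => Set.Ico 0 (2 * π)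

lemma Tb_meas : MeasurableSet (Tb n) := MeasurableSet.univ_pi fun _ => measurableSet_Ico

lemma piN_box {ι : Type*} [Fintype ι] : ∀ᵐ x ∂(piN ι), ∀ i, x i ∈ Set.Ico 0 (2 * π) := by
  have hnu : ∀ᵐ t ∂nu, t ∈ Set.Ico 0 (2 * π) :=
    Measure.ae_smul_measure (ae_restrict_mem measurableSet_Ico) _
  rw [ae_all_iff]
  intro i
  exact (Measure.quasiMeasurePreserving_eval (μ := fun _ : ι => nu) i).ae hnu

lemma W_Tb : ∀ᵐ x ∂(W n), x ∈ Tb n := by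
  have : ∀ᵐ x ∂(piN (Fin n)), x ∈ Tb n := piN_box.mono fun x hx i _ => hx i
  exact (withDensity_absolutelyContinuous _ _).ae_le this

lemma Pm_inj {x x' : Fin n → ℝ} (hx : x ∈ Tb n) (hx' : x' ∈ Tb n) (h : Pm x = Pm x') :
    ∃ σ : Equiv.Perm (Fin n), x' ∘ σ = x := by
  obtain ⟨σ, hσ⟩ := perm_of_ps (fun j => Complex.exp (x j * Complex.I)) (fun j => Complex.exp (x' j * Complex.I)) (by
    intro k
    rcases k with _ | k
    · simp
    · have := congrArg Subtype.val (congrFun h k)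
      simp only [Pm] at this
      simp only [← Complex.exp_nat_mul]
      convert this using 3 <;> (push_cast; ring))
  refine ⟨σ, funext fun j => ?_⟩
  have h1 := hx j trivial
  have h2 := hx' (σ j) trivial
  have := hσ j
  rw [Complex.exp_eq_exp_iff_exists_int] at this
  obtain ⟨m, hm⟩ := this
  have h3 : x' (σ j) = x j + m * (2 * π) := by
    have h4 : ((x' (σ j) : ℂ)) = ((x j + m * (2 * π) : ℝ) : ℂ) := by
      apply mul_right_cancel₀ Complex.I_ne_zero
      rw [hm]; push_cast; ring
    exact_mod_cast h4
  have hpi := Real.pi_pos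
  have hm0 : m = 0 := by
    have a1 : (m : ℝ) < 1 := by
      by_contra hc; push Not at hc
      nlinarith [h1.1, h1.2, h2.1, h2.2]
    have a2 : (-1 : ℝ) < m := by
      by_contra hc; push Not at hc
      nlinarith [h1.1, h1.2, h2.1, h2.2]
    have b1 : m < 1 := by exact_mod_cast a1
    have b2 : -1 < m := by exact_mod_cast a2
    omega
  simp [h3, hm0]

theorem weyl_sym (hmem : ∀ U j, θ U j ∈ Set.Ico (0 : ℝ) (2 * π)) (heig : ∀ U : UG n, (Matrix.charpoly (U : MT n)).roots
        = Multiset.map (fun j => Complex.exp ((θ U j : ℂ) * Complex.I)) (Finset.univ : Finset (Fin n)).val)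
    (S : Set (Fin n → ℝ)) (hS : MeasurableSet S) (hsym : ∀ (σ : Equiv.Perm (Fin n)) x, x ∈ S → x ∘ σ ∈ S) :
    μ {U | θ U ∈ S} = W n S := by
  have hA : AnalyticSet (Pm '' (S ∩ Tb n)) := (hS.inter Tb_meas).analyticSet_image Pm_cont.measurable
  have hB : AnalyticSet (Pm '' (Sᶜ ∩ Tb n)) := (hS.compl.inter Tb_meas).analyticSet_image Pm_cont.measurable
  have hd : Disjoint (Pm '' (S ∩ Tb n)) (Pm '' (Sᶜ ∩ Tb n)) := by
    rw [Set.disjoint_left]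
    rintro _ ⟨x, ⟨hx, hxT⟩, rfl⟩ ⟨x', ⟨hx', hxT'⟩, h⟩
    obtain ⟨σ, hσ⟩ := Pm_inj hxT' hxT h
    exact hx' (hσ ▸ hsym σ x hx)
  obtain ⟨C, hAC, hBC, hC⟩ := hA.measurablySeparable hB hd
  have key : ∀ x ∈ Tb n, (x ∈ S ↔ Pm x ∈ C) := by
    intro x hx
    constructor
    · exact fun h => hAC ⟨x, ⟨h, hx⟩, rfl⟩
    · intro h
      by_contra hn
      exact Set.disjoint_left.1 hBC ⟨x, ⟨hn, hx⟩, rfl⟩ h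
  have e1 : {U | θ U ∈ S} = (fun U => Pm (θ U)) ⁻¹' C := by
    ext U
    exact key _ fun j _ => hmem U j
  rw [e1, ← Measure.map_apply (Pm_tr θ heig) hC, weyl_law μ θ heig, Measure.map_apply Pm_cont.measurable hC]
  refine measure_congr ?_
  filter_upwards [W_Tb] with x hx
  exact propext (key x hx).symm
end
end CUE

open MeasureTheory Filter Topology Real
open scoped ENNReal

namespace CUE

noncomputable section
variable {n : ℕ}

section gram
open Matrix
open scoped ComplexOrder
variable {ι : Type*} [Fintype ι] [DecidableEq ι]

lemma det_le_one (M : Matrix ι ι ℂ) (hM : M.PosSemidef) (hd : ∀ i, (M i i).re ≤ 1) : M.det.re ≤ 1 := by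
  have hH := hM.isHermitian
  rw [hH.det_eq_prod_eigenvalues]
  have h1 : ((∏ i, (hH.eigenvalues i : ℂ)) : ℂ) = ((∏ i, hH.eigenvalues i : ℝ) : ℂ) := by push_cast; rfl
  have h1' : (∏ i, ((hH.eigenvalues i : ℝ) : ℂ)).re = ∏ i, hH.eigenvalues i := by rw [h1, Complex.ofReal_re]
  refine (le_of_eq h1').trans ?_
  have h2 : ∑ i, hH.eigenvalues i ≤ Fintype.card ι := by
    have := hH.trace_eq_sum_eigenvalues
    have h3 : M.trace.re = ∑ i, hH.eigenvalues i := by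
      rw [this]; simp
    rw [← h3, Matrix.trace, Complex.re_sum]
    refine (Finset.sum_le_sum fun i _ => hd i).trans ?_
    simp
  calc ∏ i, hH.eigenvalues i ≤ ∏ i, Real.exp (hH.eigenvalues i - 1) := by
        refine Finset.prod_le_prod (fun i _ => hM.eigenvalues_nonneg i) fun i _ => ?_
        have := Real.add_one_le_exp (hH.eigenvalues i - 1)
        linarith
    _ = Real.exp (∑ i, (hH.eigenvalues i - 1)) := (Real.exp_sum _ _).symm
    _ ≤ 1 := by
        rw [Real.exp_le_one_iff]
        simp only [Finset.sum_sub_distrib, Finset.sum_const, Finset.card_univ, nsmul_eq_mul, mul_one]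
        linarith

lemma gram_tr (L : Matrix ι ι ℂ) (B : Matrix ι (Fin n) ℂ) :
    ((L * B) * (L * B)ᴴ).det.re = ‖L.det‖ ^ 2 * (B * Bᴴ).det.re := by
  rw [Matrix.conjTranspose_mul, show L * B * (Bᴴ * Lᴴ) = L * (B * Bᴴ) * Lᴴ by simp only [Matrix.mul_assoc],
    det_mul, det_mul, det_conjTranspose, mul_right_comm, Complex.star_def, Complex.mul_conj']
  rw [← Complex.ofReal_pow, Complex.re_ofReal_mul]

lemma gram_nonneg (B : Matrix ι (Fin n) ℂ) : 0 ≤ (B * Bᴴ).det.re := by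
  have := (posSemidef_self_mul_conjTranspose B).det_nonneg
  rw [Complex.le_def] at this
  exact this.1

lemma gram_le (B : Matrix ι (Fin n) ℂ) (h : ∀ i, ∑ j, ‖B i j‖ ^ 2 ≤ 1) : (B * Bᴴ).det.re ≤ 1 := by
  refine det_le_one _ (posSemidef_self_mul_conjTranspose B) fun i => ?_
  rw [Matrix.mul_apply, Complex.re_sum]
  refine le_trans (le_of_eq ?_) (h i)
  refine Finset.sum_congr rfl fun j _ => ?_
  rw [conjTranspose_apply, Complex.star_def, Complex.mul_conj', ← Complex.ofReal_pow, Complex.ofReal_re]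
end gram

lemma sum_sq_range (c : ℝ) (N : ℕ) : ∑ k ∈ Finset.range N, ((k : ℝ) - c) ^ 2 =
    N * (N - 1) * (2 * N - 1) / 6 - c * N * (N - 1) + N * c ^ 2 := by
  induction N with
  | zero => simp
  | succ N ih => rw [Finset.sum_range_succ, ih]; push_cast; ring

lemma sum_kap_sq : ∑ k, kap n k ^ 2 = n * ((n : ℝ) ^ 2 - 1) / 12 := by
  simp only [kap]
  rw [Fin.sum_univ_eq_sum_range (fun k => ((k : ℝ) - ((n : ℝ) - 1) / 2) ^ 2), sum_sq_range]; ring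

lemma kap_abs (k : Fin n) : |kap n k| ≤ n / 2 := by
  have h1 : (k : ℝ) + 1 ≤ n := by exact_mod_cast k.2
  have h0 : (0 : ℝ) ≤ k := by positivity
  rw [kap, abs_le]; constructor <;> linarith

section pairs
open Matrix
variable {κ : Type} [Fintype κ] [DecidableEq κ]

/-- midpoints -/
def mid (y : κ ⊕ κ → ℝ) (k : κ) : ℝ := (y (.inl k) + y (.inr k)) / 2
/-- differences -/
def del (y : κ ⊕ κ → ℝ) (k : κ) : ℝ := y (.inr k) - y (.inl k)
/-- amplitudes -/
def amp (n : ℕ) (y : κ ⊕ κ → ℝ) : κ ⊕ κ → Fin n → ℝ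
  | .inl k, j => cos (kap n j * (del y k / 2))
  | .inr k, j => √12 / n * (sin (kap n j * (del y k / 2)) / (del y k / 2))
/-- repeated midpoints -/
def mid2 (y : κ ⊕ κ → ℝ) : κ ⊕ κ → ℝ := Sum.elim (mid y) (mid y)
/-- normalised frame -/
def Bh (n : ℕ) (y : κ ⊕ κ → ℝ) : Matrix (κ ⊕ κ) (Fin n) ℂ :=
  Matrix.of fun a j => ((1 / √n * amp n y a j : ℝ) : ℂ) * ch n j (mid2 y a)
/-- scaling constants -/
def cc (n : ℕ) (y : κ ⊕ κ → ℝ) (k : κ) : ℂ := ((√n * (del y k / 2) * (n / √12) : ℝ) : ℂ) * Complex.I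
/-- transformation -/
def Tr (n : ℕ) (y : κ ⊕ κ → ℝ) : Matrix (κ ⊕ κ) (κ ⊕ κ) ℂ :=
  fromBlocks (diagonal fun _ => ((√n : ℝ) : ℂ)) (diagonal fun k => - cc n y k) (diagonal fun _ => ((√n : ℝ) : ℂ)) (diagonal (cc n y))

/-- pair weight -/
def qq (n : ℕ) (d : ℝ) : ℝ := (n : ℝ) ^ 4 * d ^ 2 / 12

lemma det_Tr (y : κ ⊕ κ → ℝ) : ‖(Tr n y).det‖ ^ 2 = ∏ k, qq n (del y k) := by
  have h : Tr n y = fromBlocks 1 0 1 1 * fromBlocks (diagonal fun _ => ((√n : ℝ) : ℂ)) (diagonal fun k => - cc n y k) 0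
      (diagonal fun k => 2 * cc n y k) := by
    rw [Tr, fromBlocks_multiply]
    simp only [Matrix.one_mul, Matrix.zero_mul, Matrix.mul_zero, add_zero, diagonal_add]
    congr 2
    funext k; ring
  rw [h, det_mul, det_fromBlocks_zero₁₂, det_fromBlocks_zero₂₁]
  simp only [det_one, one_mul, det_diagonal, ← Finset.prod_mul_distrib, norm_prod, ← Finset.prod_pow]
  refine Finset.prod_congr rfl fun k _ => ?_
  rw [cc, qq, norm_mul, norm_mul, norm_mul, Complex.norm_I, Complex.norm_real, Complex.norm_real, mul_one]
  simp only [Real.norm_eq_abs, mul_pow, sq_abs, Complex.norm_ofNat]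
  rw [Real.sq_sqrt (by positivity), div_pow (n : ℝ), Real.sq_sqrt (by norm_num)]
  ring

lemma Am_eq (hn : 0 < n) (y : κ ⊕ κ → ℝ) (hy : ∀ k, del y k ≠ 0) : Am n y = Tr n y * Bh n y := by
  have hn' : √(n : ℝ) ≠ 0 := by positivity
  have h12 : √(12 : ℝ) ≠ 0 := by positivity
  have key : ∀ k j, (((√n * (del y k / 2) * (n / √12) : ℝ)) : ℂ) * ((1 / √n * (√12 / n * (sin (kap n j * (del y k / 2)) / (del y k / 2))) : ℝ) : ℂ)
      = ((sin (kap n j * (del y k / 2)) : ℝ) : ℂ) := by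
    intro k j
    rw [← Complex.ofReal_mul]
    congr 1
    have h1 := hy k
    have h2 : (n : ℝ) ≠ 0 := by positivity
    field_simp
  have key2 : ∀ k j, ((√n : ℝ) : ℂ) * ((1 / √n * cos (kap n j * (del y k / 2)) : ℝ) : ℂ) = ((cos (kap n j * (del y k / 2)) : ℝ) : ℂ) := by
    intro k j
    rw [← Complex.ofReal_mul]
    congr 1
    field_simp
  ext (k | k) j
  · have : (Tr n y * Bh n y) (.inl k) j = ((√n : ℝ) : ℂ) * Bh n y (.inl k) j - cc n y k * Bh n y (.inr k) j := by
      simp [Matrix.mul_apply, Tr, diagonal_apply, sub_eq_add_neg]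
    rw [this, Bh, of_apply, of_apply, cc, amp, amp, mid2, Sum.elim_inl, Sum.elim_inr, Am, of_apply, ← mul_assoc, key2]
    rw [show ∀ a b c : ℂ, a * Complex.I * (b * c) = (a * b) * Complex.I * c by intros; ring, key]
    rw [ch, ch, ← sub_mul]
    have e : ((kap n j * y (.inl k) : ℝ) : ℂ) * Complex.I = ((-(kap n j * (del y k / 2)) : ℝ) : ℂ) * Complex.I + ((kap n j * mid y k : ℝ) : ℂ) * Complex.I := by
      rw [← add_mul, ← Complex.ofReal_add]; congr 2; simp only [mid, del]; ring
    rw [e, Complex.exp_add, Complex.exp_mul_I]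
    congr 1
    push_cast
    rw [Complex.cos_neg, Complex.sin_neg]; ring
  · have : (Tr n y * Bh n y) (.inr k) j = ((√n : ℝ) : ℂ) * Bh n y (.inl k) j + cc n y k * Bh n y (.inr k) j := by
      simp [Matrix.mul_apply, Tr, diagonal_apply]
    rw [this, Bh, of_apply, of_apply, cc, amp, amp, mid2, Sum.elim_inl, Sum.elim_inr, Am, of_apply, ← mul_assoc, key2]
    rw [show ∀ a b c : ℂ, a * Complex.I * (b * c) = (a * b) * Complex.I * c by intros; ring, key]
    rw [ch, ch, ← add_mul]
    have e : ((kap n j * y (.inr k) : ℝ) : ℂ) * Complex.I = (((kap n j * (del y k / 2)) : ℝ) : ℂ) * Complex.I + ((kap n j * mid y k : ℝ) : ℂ) * Complex.I := by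
      rw [← add_mul, ← Complex.ofReal_add]; congr 2; simp only [mid, del]; ring
    rw [e, Complex.exp_add, Complex.exp_mul_I]
    congr 1
    push_cast
    ring

lemma rho_pairs (hn : 0 < n) (y : κ ⊕ κ → ℝ) (hy : ∀ k, del y k ≠ 0) :
    rho n y = (∏ k, qq n (del y k)) * (Bh n y * (Bh n y)ᴴ).det.re := by
  rw [rho, Km, Am_eq hn y hy, gram_tr, det_Tr]

lemma amp_sq (hn : 0 < n) (y : κ ⊕ κ → ℝ) (hy : ∀ k, del y k ≠ 0) (a : κ ⊕ κ) : ∑ j, amp n y a j ^ 2 ≤ n := by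
  rcases a with k | k
  · refine (Finset.sum_le_sum fun j _ => (cos_sq_le_one _ : amp n y (.inl k) j ^ 2 ≤ 1)).trans ?_
    simp
  · have h : ∀ j, amp n y (.inr k) j ^ 2 ≤ 12 / (n : ℝ) ^ 2 * kap n j ^ 2 := by
      intro j
      rw [amp, mul_pow, div_pow, Real.sq_sqrt (by norm_num)]
      refine mul_le_mul_of_nonneg_left ?_ (by positivity)
      have h1 : (del y k / 2) ^ 2 > 0 := by have := hy k; positivity
      rw [div_pow, div_le_iff₀ h1, ← mul_pow]
      exact sq_le_sq.2 Real.abs_sin_le_abs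
    refine (Finset.sum_le_sum fun j _ => h j).trans ?_
    rw [← Finset.mul_sum, sum_kap_sq]
    have h2 : (0 : ℝ) < n := by positivity
    rw [show 12 / (n : ℝ) ^ 2 * (n * ((n : ℝ) ^ 2 - 1) / 12) = n - 1 / n by field_simp]
    have : (0 : ℝ) < 1 / n := by positivity
    linarith

lemma Bh_norm (hn : 0 < n) (y : κ ⊕ κ → ℝ) (hy : ∀ k, del y k ≠ 0) (a : κ ⊕ κ) : ∑ j, ‖Bh n y a j‖ ^ 2 ≤ 1 := by
  have : ∀ j, ‖Bh n y a j‖ ^ 2 = 1 / n * amp n y a j ^ 2 := by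
    intro j
    rw [Bh, of_apply, norm_mul, ch_norm, mul_one, Complex.norm_real, Real.norm_eq_abs, sq_abs, mul_pow, div_pow,
      Real.sq_sqrt (by positivity), one_pow]
  simp only [this, ← Finset.mul_sum]
  have h2 : (0 : ℝ) < n := by positivity
  rw [one_div, inv_mul_le_iff₀ h2, mul_one]
  exact amp_sq hn y hy a

lemma qq_nonneg (d : ℝ) : 0 ≤ qq n d := by unfold qq; positivity

lemma rho_pairs_le (hn : 0 < n) (y : κ ⊕ κ → ℝ) (hy : ∀ k, del y k ≠ 0) :
    rho n y ≤ ∏ k, qq n (del y k) := by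
  rw [rho_pairs hn y hy]
  exact mul_le_of_le_one_right (Finset.prod_nonneg fun k _ => qq_nonneg _) (gram_le _ (Bh_norm hn y hy))

end pairs
end
end CUE

open MeasureTheory Filter Topology Real
open scoped ENNReal

namespace CUE

noncomputable section
variable {n : ℕ}

lemma norm_exp_sub (u v : ℝ) : ‖Complex.exp ((u : ℂ) * Complex.I) - Complex.exp ((v : ℂ) * Complex.I)‖ ≤ |u - v| := by
  have : Complex.exp ((u : ℂ) * Complex.I) - Complex.exp ((v : ℂ) * Complex.I) =
      Complex.exp ((v : ℂ) * Complex.I) * (Complex.exp (Complex.I * ((u - v : ℝ) : ℂ)) - 1) := by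
    rw [mul_sub, ← Complex.exp_add, mul_one]
    congr 2; push_cast; ring
  rw [this, norm_mul, Complex.norm_exp_ofReal_mul_I, one_mul]
  exact Real.norm_exp_I_mul_ofReal_sub_one_le

section triple
open Matrix
variable {κ : Type} [Fintype κ] [DecidableEq κ]

lemma rho_triple_le (hn : 0 < n) (y : κ ⊕ κ → ℝ) (hy : ∀ k, del y k ≠ 0) (k0 : κ) (z s : ℝ) (hs : 0 < s)
    (hz : |z - y (.inl k0)| ≤ 2 * s) :
    rho n (Sum.elim y (fun _ : Unit => z)) ≤ (∏ k, qq n (del y k)) * ((n : ℝ) ^ 3 * s ^ 2) := by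
  have hn' : (0 : ℝ) < n := by positivity
  set Dd : ℝ := √((n : ℝ) ^ 3 * s ^ 2) with hD
  have hDp : 0 < Dd := by positivity
  have hD2 : Dd ^ 2 = (n : ℝ) ^ 3 * s ^ 2 := Real.sq_sqrt (by positivity)
  let B' : Matrix ((κ ⊕ κ) ⊕ Unit) (Fin n) ℂ := fromRows (Bh n y) (of fun _ j => (ch n j z - ch n j (y (.inl k0))) / (Dd : ℂ))
  let L : Matrix ((κ ⊕ κ) ⊕ Unit) ((κ ⊕ κ) ⊕ Unit) ℂ := fromBlocks (Tr n y) 0 (of fun _ a => Tr n y (.inl k0) a) (of fun _ _ => (Dd : ℂ))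
  have hA : Am n (Sum.elim y (fun _ : Unit => z)) = L * B' := by
    have h := Am_eq hn y hy
    ext (a | a) j
    · have e : (L * B') (.inl a) j = (Tr n y * Bh n y) a j := by
        simp [L, B', Matrix.mul_apply]
      rw [e, ← h]; rfl
    · have e : (L * B') (.inr a) j = (Tr n y * Bh n y) (.inl k0) j + (Dd : ℂ) * ((ch n j z - ch n j (y (.inl k0))) / (Dd : ℂ)) := by
        simp [L, B', Matrix.mul_apply]
      rw [e, ← h, mul_div_cancel₀ _ (by exact_mod_cast hDp.ne')]
      simp [Am]
  have hdet : ‖L.det‖ ^ 2 = (∏ k, qq n (del y k)) * ((n : ℝ) ^ 3 * s ^ 2) := by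
    rw [det_fromBlocks_zero₁₂, norm_mul, mul_pow, det_Tr, ← hD2]
    simp
  rw [rho, Km, hA, gram_tr, hdet]
  refine mul_le_of_le_one_right (mul_nonneg (Finset.prod_nonneg fun k _ => qq_nonneg _) (by positivity)) (gram_le _ ?_)
  rintro (a | a)
  · exact Bh_norm hn y hy a
  · have : ∀ j, ‖B' (.inr a) j‖ ^ 2 ≤ 4 * s ^ 2 / Dd ^ 2 * kap n j ^ 2 := by
      intro j
      simp only [B', fromRows_apply_inr, of_apply, norm_div, div_pow, Complex.norm_real, Real.norm_eq_abs, sq_abs]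
      rw [div_mul_eq_mul_div]
      gcongr
      have h1 := norm_exp_sub (kap n j * z) (kap n j * y (.inl k0))
      have h2 : |kap n j * z - kap n j * y (.inl k0)| ≤ |kap n j| * (2 * s) := by
        rw [← mul_sub, abs_mul]; gcongr
      calc _ ≤ (|kap n j| * (2 * s)) ^ 2 := by
            refine pow_le_pow_left₀ (norm_nonneg _) (h1.trans h2) 2
        _ = _ := by rw [mul_pow, sq_abs]; ring
    refine (Finset.sum_le_sum fun j _ => this j).trans ?_
    rw [← Finset.mul_sum, sum_kap_sq, hD2]
    rw [div_mul_eq_mul_div, div_le_one (by positivity)]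
    have : 0 < s ^ 2 := by positivity
    nlinarith [mul_pos this hn', mul_pos this (pow_pos hn' 3)]
end triple

lemma abel (z : ℂ) (hz : ‖z‖ = 1) (g : ℕ → ℝ) (A C : ℝ) (n : ℕ) (hA : ∀ j < n, |g j| ≤ A) (hA0 : 0 ≤ A) (hC0 : 0 ≤ C)
    (hC : ∀ j, j + 1 < n → |g (j + 1) - g j| ≤ C / n) : ‖1 - z‖ * ‖∑ j ∈ Finset.range n, z ^ j * (g j : ℂ)‖ ≤ 2 * A + C := by
  have key : ∀ N : ℕ, (1 - z) * ∑ j ∈ Finset.range (N + 1), z ^ j * (g j : ℂ) =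
      g 0 - z ^ (N + 1) * g N + ∑ j ∈ Finset.range N, z ^ (j + 1) * ((g (j + 1) - g j : ℝ) : ℂ) := by
    intro N
    induction N with
    | zero => simp; ring
    | succ N ih =>
      rw [Finset.sum_range_succ, mul_add, ih, Finset.sum_range_succ (fun j => z ^ (j + 1) * ((g (j + 1) - g j : ℝ) : ℂ))]
      push_cast; ring
  rcases n with _ | N
  · simp; positivity
  rw [← norm_mul, key]
  have h1 : ‖(g 0 : ℂ)‖ ≤ A := by rw [Complex.norm_real]; exact hA 0 (by omega)
  have h2 : ‖z ^ (N + 1) * (g N : ℂ)‖ ≤ A := by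
    rw [norm_mul, norm_pow, hz, one_pow, one_mul, Complex.norm_real]; exact hA N (by omega)
  have h3 : ‖∑ j ∈ Finset.range N, z ^ (j + 1) * ((g (j + 1) - g j : ℝ) : ℂ)‖ ≤ C := by
    refine (norm_sum_le _ _).trans ?_
    have : ∀ j ∈ Finset.range N, ‖z ^ (j + 1) * ((g (j + 1) - g j : ℝ) : ℂ)‖ ≤ C / (N + 1 : ℕ) := by
      intro j hj
      rw [norm_mul, norm_pow, hz, one_pow, one_mul, Complex.norm_real]
      exact hC j (by have := Finset.mem_range.1 hj; omega)
    refine (Finset.sum_le_sum this).trans ?_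
    rw [Finset.sum_const, Finset.card_range, nsmul_eq_mul, mul_div_assoc', div_le_iff₀ (by positivity)]
    push_cast; nlinarith
  calc _ ≤ ‖(g 0 : ℂ)‖ + ‖z ^ (N + 1) * (g N : ℂ)‖ + ‖∑ j ∈ Finset.range N, z ^ (j + 1) * ((g (j + 1) - g j : ℝ) : ℂ)‖ :=
        (norm_add_le _ _).trans (add_le_add_left (norm_sub_le _ _) _)
    _ ≤ 2 * A + C := by linarith

section asym
open Matrix
variable {κ : Type} [Fintype κ] [DecidableEq κ]

/-- amplitude as a function of a real frequency -/
def ampR (n : ℕ) (y : κ ⊕ κ → ℝ) : κ ⊕ κ → ℝ → ℝ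
  | .inl k, t => cos (t * (del y k / 2))
  | .inr k, t => √12 / n * (sin (t * (del y k / 2)) / (del y k / 2))

lemma amp_ampR (y : κ ⊕ κ → ℝ) (a : κ ⊕ κ) (j : Fin n) : amp n y a j = ampR n y a (kap n j) := by
  rcases a with k | k <;> rfl

lemma s12 : √(12 : ℝ) ≤ 4 := by rw [Real.sqrt_le_left (by norm_num)]; norm_num

lemma ampR_abs (hn : 0 < n) (y : κ ⊕ κ → ℝ) (hy : ∀ k, 0 < del y k) (a : κ ⊕ κ) (t : ℝ) (ht : |t| ≤ n / 2) : |ampR n y a t| ≤ 2 := by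
  have hn' : (0 : ℝ) < n := by positivity
  rcases a with k | k
  · exact (abs_cos_le_one _).trans (by norm_num)
  · have hd := hy k
    rw [ampR, abs_mul, abs_div, abs_div, abs_of_pos hn', abs_of_pos (by positivity : 0 < del y k / 2), abs_of_nonneg (Real.sqrt_nonneg _)]
    have h1 : |sin (t * (del y k / 2))| / (del y k / 2) ≤ n / 2 := by
      rw [div_le_iff₀ (by positivity)]
      refine Real.abs_sin_le_abs.trans ?_
      rw [abs_mul, abs_of_pos (by positivity : 0 < del y k / 2)]
      gcongr
    calc _ ≤ 4 / (n : ℝ) * (n / 2) := by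
          have := s12
          gcongr
      _ = 2 := by field_simp; norm_num

lemma ampR_lip (hn : 0 < n) (y : κ ⊕ κ → ℝ) (hy : ∀ k, 0 < del y k) (hy2 : ∀ k, n * del y k ≤ 1) (a : κ ⊕ κ) (t u : ℝ) :
    |ampR n y a t - ampR n y a u| ≤ 4 / n * |t - u| := by
  have hn' : (0 : ℝ) < n := by positivity
  rcases a with k | k
  · have hd := hy k
    have h1 : |cos (t * (del y k / 2)) - cos (u * (del y k / 2))| ≤ |t * (del y k / 2) - u * (del y k / 2)| := by
      have := Real.lipschitzWith_cos.dist_le_mul (t * (del y k / 2)) (u * (del y k / 2))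
      simpa [Real.dist_eq] using this
    refine h1.trans ?_
    rw [← sub_mul, abs_mul, abs_of_pos (by positivity : 0 < del y k / 2), mul_comm]
    refine mul_le_mul_of_nonneg_right ?_ (abs_nonneg _)
    rw [div_le_div_iff₀ (by norm_num) hn']
    have := hy2 k; linarith
  · have hd := hy k
    have h1 : |sin (t * (del y k / 2)) - sin (u * (del y k / 2))| ≤ |t * (del y k / 2) - u * (del y k / 2)| := by
      have := Real.lipschitzWith_sin.dist_le_mul (t * (del y k / 2)) (u * (del y k / 2))
      simpa [Real.dist_eq] using this
    rw [ampR, ampR, ← mul_sub, ← sub_div, abs_mul, abs_div, abs_div, abs_of_pos hn', abs_of_pos (by positivity : 0 < del y k / 2), abs_of_nonneg (Real.sqrt_nonneg _)]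
    have := s12
    gcongr
    rw [div_le_iff₀ (by positivity)]
    rw [← sub_mul, abs_mul, abs_of_pos (by positivity : 0 < del y k / 2)] at h1
    exact h1

lemma Gh_apply (hn : 0 < n) (y : κ ⊕ κ → ℝ) (a b : κ ⊕ κ) : (Bh n y * (Bh n y)ᴴ) a b =
    (1 / n : ℂ) * ∑ j, ((ampR n y a (kap n j) * ampR n y b (kap n j) : ℝ) : ℂ) * Complex.exp ((kap n j * (mid2 y a - mid2 y b) : ℝ) * Complex.I) := by
  rw [Matrix.mul_apply, Finset.mul_sum]
  refine Finset.sum_congr rfl fun j _ => ?_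
  rw [conjTranspose_apply, Bh, of_apply, of_apply, amp_ampR, amp_ampR, Complex.star_def, map_mul, Complex.conj_ofReal, ch, ch,
    ← Complex.exp_conj, map_mul, Complex.conj_ofReal, Complex.conj_I]
  rw [show ∀ p q r t : ℂ, p * q * (r * t) = (p * r) * (q * t) by intros; ring, ← Complex.exp_add]
  have h1 : ((1 / √(n : ℝ) * ampR n y a (kap n j) : ℝ) : ℂ) * ((1 / √(n : ℝ) * ampR n y b (kap n j) : ℝ) : ℂ) =
      (1 / n : ℂ) * ((ampR n y a (kap n j) * ampR n y b (kap n j) : ℝ) : ℂ) := by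
    rw [← Complex.ofReal_mul, show (1 / √(n : ℝ) * ampR n y a (kap n j)) * (1 / √(n : ℝ) * ampR n y b (kap n j)) =
      (1 / (√(n : ℝ)) ^ 2) * (ampR n y a (kap n j) * ampR n y b (kap n j)) by ring, Real.sq_sqrt (by positivity)]
    push_cast; ring
  rw [h1, mul_assoc]
  congr 3
  push_cast; ring

lemma Gh_off (hn : 0 < n) (y : κ ⊕ κ → ℝ) (hy : ∀ k, 0 < del y k) (hy2 : ∀ k, n * del y k ≤ 1) (a b : κ ⊕ κ) (R : ℝ) (hR : 0 < R)
    (h : R / n ≤ ‖1 - Complex.exp ((mid2 y a - mid2 y b : ℝ) * Complex.I)‖) : ‖(Bh n y * (Bh n y)ᴴ) a b‖ ≤ 24 / R := by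
  have hn' : (0 : ℝ) < n := by positivity
  set u := mid2 y a - mid2 y b with hu
  set z := Complex.exp ((u : ℝ) * Complex.I) with hzd
  have hz : ‖z‖ = 1 := Complex.norm_exp_ofReal_mul_I _
  let kk : ℕ → ℝ := fun j => (j : ℝ) - ((n : ℝ) - 1) / 2
  let g : ℕ → ℝ := fun j => ampR n y a (kk j) * ampR n y b (kk j)
  have hkk : ∀ j < n, |kk j| ≤ n / 2 := fun j hj => kap_abs ⟨j, hj⟩
  have key : ∑ j : Fin n, ((ampR n y a (kap n j) * ampR n y b (kap n j) : ℝ) : ℂ) * Complex.exp ((kap n j * u : ℝ) * Complex.I)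
      = Complex.exp ((-((n : ℝ) - 1) / 2 * u : ℝ) * Complex.I) * ∑ j ∈ Finset.range n, z ^ j * (g j : ℂ) := by
    rw [← Fin.sum_univ_eq_sum_range (fun j => z ^ j * (g j : ℂ)), Finset.mul_sum]
    refine Finset.sum_congr rfl fun j _ => ?_
    rw [hzd, ← Complex.exp_nat_mul, ← mul_assoc, ← Complex.exp_add, mul_comm]
    congr 1
    congr 1
    simp only [kap]; push_cast; ring
  have hab := abel z hz g 4 16 n (fun j hj => by
      rw [abs_mul]
      have h1 := ampR_abs hn y hy a _ (hkk j hj)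
      have h2 := ampR_abs hn y hy b _ (hkk j hj)
      nlinarith [abs_nonneg (ampR n y a (kk j)), abs_nonneg (ampR n y b (kk j))]) (by norm_num) (by norm_num) (fun j hj => by
      have h1 := ampR_abs hn y hy a _ (hkk (j + 1) hj)
      have h2 := ampR_abs hn y hy b _ (hkk j (by omega))
      have h3 := ampR_lip hn y hy hy2 a (kk (j + 1)) (kk j)
      have h4 := ampR_lip hn y hy hy2 b (kk (j + 1)) (kk j)
      have h5 : kk (j + 1) - kk j = 1 := by simp only [kk]; push_cast; ring
      rw [h5, abs_one, mul_one] at h3 h4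
      have : g (j + 1) - g j = ampR n y a (kk (j + 1)) * (ampR n y b (kk (j + 1)) - ampR n y b (kk j)) +
        (ampR n y a (kk (j + 1)) - ampR n y a (kk j)) * ampR n y b (kk j) := by simp only [g]; ring
      rw [this]
      refine (abs_add_le _ _).trans ?_
      rw [abs_mul, abs_mul]
      have e : (16 : ℝ) / n = 2 * (4 / n) + (4 / n) * 2 := by ring
      rw [e]
      have : (0 : ℝ) ≤ 4 / n := by positivity
      gcongr)
  rw [Gh_apply hn, key, norm_mul, norm_mul, Complex.norm_exp_ofReal_mul_I, one_mul]
  have h6 : R / n * ‖∑ j ∈ Finset.range n, z ^ j * (g j : ℂ)‖ ≤ 24 :=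
    (mul_le_mul_of_nonneg_right h (norm_nonneg _)).trans (hab.trans (by norm_num))
  rw [show ‖(1 / n : ℂ)‖ = 1 / n by simp, le_div_iff₀ hR]
  calc _ = R / n * ‖∑ j ∈ Finset.range n, z ^ j * (g j : ℂ)‖ := by ring
    _ ≤ 24 := h6

end asym
end
end CUE

open MeasureTheory Filter Topology Real
open scoped ENNReal

namespace CUE

noncomputable section
variable {n : ℕ}

lemma sin_sq_lower (t : ℝ) (ht : |t| ≤ 1) : t ^ 2 * (1 - t ^ 2) ≤ sin t ^ 2 := by
  have key : ∀ t : ℝ, 0 < t → t ≤ 1 → t ^ 2 * (1 - t ^ 2) ≤ sin t ^ 2 := by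
    intro t h0 h1
    have h := Real.sin_gt_sub_cube h0
    have h2 : 0 ≤ t - t ^ 3 / 6 := by nlinarith [pow_pos h0 2, pow_pos h0 3]
    have h3 : (t - t ^ 3 / 6) ^ 2 ≤ sin t ^ 2 := pow_le_pow_left₀ h2 h.le 2
    nlinarith [pow_pos h0 4, pow_pos h0 6]
  rcases lt_trichotomy t 0 with h | h | h
  · have := key (-t) (by linarith) (by rw [abs_of_neg h] at ht; exact ht)
    simpa [Real.sin_neg] using this
  · subst h; simp
  · exact key t h (by rw [abs_of_pos h] at ht; exact ht)

section asym
open Matrix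
variable {κ : Type} [Fintype κ] [DecidableEq κ]

lemma amp_sq_lower (hn : 0 < n) (y : κ ⊕ κ → ℝ) (hy : ∀ k, 0 < del y k) (e : ℝ) (he : e ≤ 1) (hy2 : ∀ k, n * del y k ≤ e) (a : κ ⊕ κ) :
    n * (1 - 1 / (n : ℝ) ^ 2 - e ^ 2) ≤ ∑ j, amp n y a j ^ 2 := by
  have hn' : (0 : ℝ) < n := by positivity
  have ht : ∀ k j, |kap n j * (del y k / 2)| ≤ e := by
    intro k j
    have := hy k
    rw [abs_mul, abs_of_pos (by positivity : 0 < del y k / 2)]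
    have h1 := kap_abs j
    have h2 := hy2 k
    calc _ ≤ (n : ℝ) / 2 * (del y k / 2) := by gcongr
      _ ≤ e := by nlinarith [mul_pos hn' this]
  have ht2 : ∀ k j, (kap n j * (del y k / 2)) ^ 2 ≤ e ^ 2 := fun k j => by
    rw [← sq_abs]; exact pow_le_pow_left₀ (abs_nonneg _) (ht k j) 2
  rcases a with k | k
  · have : ∀ j ∈ Finset.univ, 1 - e ^ 2 ≤ amp n y (.inl k) j ^ 2 := by
      intro j _
      rw [amp, cos_sq']
      have h1 := ht2 k j
      have h2 : sin (kap n j * (del y k / 2)) ^ 2 ≤ (kap n j * (del y k / 2)) ^ 2 := sq_le_sq.2 Real.abs_sin_le_abs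
      linarith
    refine le_trans ?_ (Finset.sum_le_sum this)
    simp only [Finset.sum_const, Finset.card_univ, Fintype.card_fin, nsmul_eq_mul]
    have : (0 : ℝ) < 1 / (n : ℝ) ^ 2 := by positivity
    gcongr; linarith
  · have : ∀ j ∈ Finset.univ, 12 / (n : ℝ) ^ 2 * (1 - e ^ 2) * kap n j ^ 2 ≤ amp n y (.inr k) j ^ 2 := by
      intro j _
      rw [amp, mul_pow, div_pow, Real.sq_sqrt (by norm_num), mul_assoc]
      refine mul_le_mul_of_nonneg_left ?_ (by positivity)
      have h1 : (del y k / 2) ^ 2 > 0 := by have := hy k; positivity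
      rw [div_pow, le_div_iff₀ h1]
      refine le_trans ?_ (sin_sq_lower _ ((ht k j).trans he))
      rw [show (1 - e ^ 2) * kap n j ^ 2 * (del y k / 2) ^ 2 = (kap n j * (del y k / 2)) ^ 2 * (1 - e ^ 2) by ring]
      have := ht2 k j
      gcongr
    refine le_trans ?_ (Finset.sum_le_sum this)
    rw [← Finset.mul_sum, sum_kap_sq]
    rw [show 12 / (n : ℝ) ^ 2 * (1 - e ^ 2) * (n * ((n : ℝ) ^ 2 - 1) / 12) = n * ((1 - 1 / (n : ℝ) ^ 2) * (1 - e ^ 2)) by field_simp]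
    have : (0 : ℝ) < 1 / (n : ℝ) ^ 2 := by positivity
    gcongr
    nlinarith [sq_nonneg e]

lemma kap_rev (j : Fin n) : kap n (Fin.rev j) = - kap n j := by
  have : ((Fin.rev j : ℕ) : ℝ) = n - (j + 1) := by
    rw [Fin.val_rev, Nat.cast_sub (by omega)]; push_cast; ring
  rw [kap, kap, this]; ring

lemma Gh_cross (hn : 0 < n) (y : κ ⊕ κ → ℝ) (k : κ) : ∑ j, amp n y (.inl k) j * amp n y (.inr k) j = 0 := by
  have h : ∑ j, amp n y (.inl k) j * amp n y (.inr k) j = - ∑ j, amp n y (.inl k) j * amp n y (.inr k) j := by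
    conv_lhs => rw [← Equiv.sum_comp Fin.revPerm]
    rw [← Finset.sum_neg_distrib]
    refine Finset.sum_congr rfl fun j _ => ?_
    simp only [Fin.revPerm_apply, amp, kap_rev, neg_mul, cos_neg, sin_neg]
    ring
  linarith

lemma Gh_same (hn : 0 < n) (y : κ ⊕ κ → ℝ) (a b : κ ⊕ κ) (h : mid2 y a = mid2 y b) :
    (Bh n y * (Bh n y)ᴴ) a b = (((1 / n : ℝ) * ∑ j, amp n y a j * amp n y b j : ℝ) : ℂ) := by
  rw [Gh_apply hn, h, sub_self]
  simp [amp_ampR]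

lemma Gh_near (hn : 0 < n) (y : κ ⊕ κ → ℝ) (hy : ∀ k, 0 < del y k) (e : ℝ) (he : e ≤ 1) (hy2 : ∀ k, n * del y k ≤ e) (R : ℝ) (hR : 0 < R)
    (hsep : ∀ k k', k ≠ k' → R / n ≤ ‖1 - Complex.exp ((mid y k - mid y k' : ℝ) * Complex.I)‖) (a b : κ ⊕ κ) :
    ‖(Bh n y * (Bh n y)ᴴ) a b - (1 : Matrix (κ ⊕ κ) (κ ⊕ κ) ℂ) a b‖ ≤ 1 / (n : ℝ) ^ 2 + e ^ 2 + 24 / R := by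
  have hn' : (0 : ℝ) < n := by positivity
  have hp1 : (0 : ℝ) < 1 / (n : ℝ) ^ 2 := by positivity
  have hp2 : (0 : ℝ) < 24 / R := by positivity
  have hoff : mid2 y a ≠ mid2 y a ∨ R / n ≤ ‖1 - Complex.exp ((mid2 y a - mid2 y b : ℝ) * Complex.I)‖ → a ≠ b →
      ‖(Bh n y * (Bh n y)ᴴ) a b - (1 : Matrix (κ ⊕ κ) (κ ⊕ κ) ℂ) a b‖ ≤ 1 / (n : ℝ) ^ 2 + e ^ 2 + 24 / R := by
    intro h hab
    rcases h with h | h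
    · exact absurd rfl h
    rw [one_apply_ne hab, sub_zero]
    have := Gh_off hn y hy (fun k => (hy2 k).trans he) a b R hR h
    nlinarith [sq_nonneg e]
  have hdiag : a = b → ‖(Bh n y * (Bh n y)ᴴ) a b - (1 : Matrix (κ ⊕ κ) (κ ⊕ κ) ℂ) a b‖ ≤ 1 / (n : ℝ) ^ 2 + e ^ 2 + 24 / R := by
    rintro rfl
    rw [Gh_same hn y a a rfl, one_apply_eq, ← Complex.ofReal_one, ← Complex.ofReal_sub, Complex.norm_real, Real.norm_eq_abs]
    have h1 := amp_sq hn y (fun k => (hy k).ne') a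
    have h2 := amp_sq_lower hn y hy e he hy2 a
    simp only [← pow_two]
    set S := ∑ j, amp n y a j ^ 2
    have h3 : 1 / (n : ℝ) * S ≤ 1 := by rw [one_div, inv_mul_le_iff₀ hn', mul_one]; exact h1
    have h4 : 1 - 1 / (n : ℝ) ^ 2 - e ^ 2 ≤ 1 / (n : ℝ) * S := by rw [one_div (n : ℝ), ← div_eq_inv_mul, le_div_iff₀ hn', mul_comm]; exact h2
    rw [abs_le]; constructor <;> nlinarith [sq_nonneg e]
  have hcr : ∀ k, ∑ j, amp n y (.inr k) j * amp n y (.inl k) j = 0 := fun k => by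
    rw [← Gh_cross hn y k]; exact Finset.sum_congr rfl fun j _ => mul_comm _ _
  by_cases hk : a = b
  · exact hdiag hk
  rcases a with k | k <;> rcases b with k' | k'
  · exact hoff (.inr (hsep k k' (fun h => hk (by rw [h])))) hk
  · by_cases h : k = k'
    · subst h
      rw [Gh_same hn y (.inl k) (.inr k) rfl, Gh_cross hn, one_apply_ne hk]
      simp; positivity
    · exact hoff (.inr (hsep k k' h)) hk
  · by_cases h : k = k'
    · subst h
      rw [Gh_same hn y (.inr k) (.inl k) rfl, hcr, one_apply_ne hk]
      simp; positivity
    · exact hoff (.inr (hsep k k' h)) hk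
  · exact hoff (.inr (hsep k k' (fun h => hk (by rw [h])))) hk

lemma det_near (ι : Type) [Fintype ι] [DecidableEq ι] (ε : ℝ) (hε : 0 < ε) : ∃ δ > 0, ∀ M : Matrix ι ι ℂ,
    (∀ a b, ‖M a b - (1 : Matrix ι ι ℂ) a b‖ < δ) → 1 - ε ≤ M.det.re := by
  have hc : Continuous (fun M : ι → ι → ℂ => (Matrix.det (Matrix.of M)).re) := by
    refine Complex.continuous_re.comp ?_
    exact Continuous.matrix_det continuous_id
  have := Metric.continuous_iff.1 hc (fun a b => (1 : Matrix ι ι ℂ) a b) ε hε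
  obtain ⟨δ, hδ, h⟩ := this
  refine ⟨δ, hδ, fun M hM => ?_⟩
  have := h (fun a b => M a b) (by
    rw [dist_pi_lt_iff hδ]; intro a
    rw [dist_pi_lt_iff hδ]; intro b
    rw [dist_eq_norm]; exact hM a b)
  have e : (Matrix.of (fun a b => (1 : Matrix ι ι ℂ) a b)) = 1 := rfl
  rw [e, det_one, Complex.one_re, Real.dist_eq, abs_lt] at this
  have := this.1
  have e2 : (Matrix.of (fun a b => M a b)) = M := rfl
  rw [e2] at this
  linarith

/-- lower bound for the correlation function of separated pairs -/
lemma rho_lower (ε : ℝ) (hε : 0 < ε) : ∃ R > 0, ∃ η > 0, ∃ N0 : ℕ, ∀ n ≥ N0, ∀ s : ℝ, n * s ≤ η → ∀ y : κ ⊕ κ → ℝ,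
    (∀ k, 0 < del y k ∧ del y k ≤ s) → (∀ k k', k ≠ k' → R / n ≤ ‖1 - Complex.exp ((mid y k - mid y k' : ℝ) * Complex.I)‖) →
    (1 - ε) * ∏ k, qq n (del y k) ≤ rho n y := by
  obtain ⟨δ, hδ, h⟩ := det_near (κ ⊕ κ) ε hε
  obtain ⟨N, hN⟩ := exists_nat_gt (4 / δ)
  refine ⟨24 * (4 / δ), by positivity, min 1 (δ / 4), by positivity, N + 1, ?_⟩
  intro n hn s hs y hy hsep
  have hn0 : 0 < n := by omega
  have hn' : (0 : ℝ) < n := by positivity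
  rw [rho_pairs hn0 y (fun k => (hy k).1.ne'), mul_comm]
  refine mul_le_mul_of_nonneg_left (h _ ?_) (Finset.prod_nonneg fun k _ => qq_nonneg _)
  intro a b
  refine (Gh_near hn0 y (fun k => (hy k).1) (min 1 (δ / 4)) (min_le_left _ _) (fun k => le_trans (by have := (hy k).2; gcongr) hs) _ (by positivity) hsep a b).trans_lt ?_
  have h1 : 1 / (n : ℝ) ^ 2 ≤ δ / 4 := by
    have hnN : (N : ℝ) + 1 ≤ n := by exact_mod_cast hn
    have h1n : (1 : ℝ) ≤ n := by exact_mod_cast hn0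
    have h3 : 4 / δ ≤ (n : ℝ) ^ 2 := by nlinarith
    rw [div_le_iff₀ hδ] at h3
    rw [div_le_div_iff₀ (by positivity) (by norm_num)]; linarith
  have h2 : (min 1 (δ / 4)) ^ 2 ≤ δ / 4 := by
    have : 0 < min 1 (δ / 4) := by positivity
    calc _ = min 1 (δ / 4) * min 1 (δ / 4) := sq _
      _ ≤ 1 * (δ / 4) := by gcongr; exact min_le_left _ _; exact min_le_right _ _
      _ = _ := one_mul _
  have h3 : 24 / (24 * (4 / δ)) = δ / 4 := by field_simp
  rw [h3]; linarith

end asym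
end
end CUE

open MeasureTheory Filter Topology Real
open scoped ENNReal

namespace CUE

noncomputable section
variable {n : ℕ}

lemma bonf (N r : ℕ) : |(if N = 0 then 1 else 0 : ℝ) - ∑ k ∈ Finset.range (r + 1), (-1) ^ k * (N.choose k : ℝ)| ≤ N.choose (r + 1) := by
  rcases N with _ | N
  · rw [Finset.sum_range_succ']
    simp
  · have h := @Int.alternating_sum_range_choose_eq_choose N r
    have h' : (∑ k ∈ Finset.range (r + 1), (-1) ^ k * ((N + 1).choose k : ℝ)) = (-1) ^ r * (N.choose r : ℝ) := by exact_mod_cast h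
    rw [h', if_neg (by omega), zero_sub, abs_neg, abs_mul, abs_pow, abs_neg, abs_one, one_pow, one_mul, Nat.abs_cast]
    rw [Nat.choose_succ_succ]
    push_cast
    have : (0 : ℝ) ≤ (N.choose (r + 1) : ℝ) := by positivity
    linarith

theorem poisson_lim {Ω : ℕ → Type} [∀ n, MeasurableSpace (Ω n)] (μ : ∀ n, Measure (Ω n)) [∀ n, IsProbabilityMeasure (μ n)]
    (X : ∀ n, Ω n → ℕ) (hX : ∀ n, Measurable (X n)) (hB : ∀ n, ∃ B, ∀ ω, X n ω ≤ B) (l : ℝ)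
    (h : ∀ m : ℕ, Tendsto (fun n => ∫ ω, ((X n ω).descFactorial m : ℝ) ∂μ n) atTop (𝓝 (l ^ m))) :
    Tendsto (fun n => (μ n).real {ω | X n ω = 0}) atTop (𝓝 (exp (-l))) := by
  have hintg : ∀ n m, Integrable (fun ω => ((X n ω).choose m : ℝ)) (μ n) := by
    intro n m
    obtain ⟨B, hB⟩ := hB n
    refine Integrable.of_bound (C := ((B.choose m : ℕ) : ℝ)) ?_ ?_
    · exact (Measurable.comp (measurable_of_countable (fun k : ℕ => ((k.choose m : ℕ) : ℝ))) (hX n)).aestronglyMeasurable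
    · refine Eventually.of_forall fun ω => ?_
      rw [Real.norm_natCast]
      exact_mod_cast Nat.choose_le_choose m (hB ω)
  have hF : ∀ m, Tendsto (fun n => ∫ ω, ((X n ω).choose m : ℝ) ∂μ n) atTop (𝓝 (l ^ m / m.factorial)) := by
    intro m
    have h1 := (h m).div_const (m.factorial : ℝ)
    refine h1.congr fun n => ?_
    rw [← integral_div]
    refine integral_congr_ae (Eventually.of_forall fun ω => ?_)
    simp only [Nat.descFactorial_eq_factorial_mul_choose]
    push_cast
    field_simp
  have hb : ∀ n r, |(μ n).real {ω | X n ω = 0} - ∑ k ∈ Finset.range (r + 1), (-1) ^ k * ∫ ω, ((X n ω).choose k : ℝ) ∂μ n|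
      ≤ ∫ ω, ((X n ω).choose (r + 1) : ℝ) ∂μ n := by
    intro n r
    have hms : MeasurableSet {ω | X n ω = 0} := hX n (measurableSet_singleton 0)
    have e1 : (μ n).real {ω | X n ω = 0} = ∫ ω, (if X n ω = 0 then 1 else 0 : ℝ) ∂μ n := by
      rw [← integral_indicator_one hms]
      refine integral_congr_ae (Eventually.of_forall fun ω => ?_)
      by_cases hx : X n ω = 0 <;> simp [hx]
    have i1 : Integrable (fun ω => (if X n ω = 0 then 1 else 0 : ℝ)) (μ n) := by
      have := (integrable_const (1 : ℝ) (μ := μ n)).indicator hms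
      refine this.congr (Eventually.of_forall fun ω => ?_)
      by_cases hx : X n ω = 0 <;> simp [hx]
    have i2 : Integrable (fun ω => ∑ k ∈ Finset.range (r + 1), (-1) ^ k * ((X n ω).choose k : ℝ)) (μ n) :=
      integrable_finsetSum _ fun k _ => (hintg n k).const_mul _
    have e2 : ∑ k ∈ Finset.range (r + 1), (-1) ^ k * ∫ ω, ((X n ω).choose k : ℝ) ∂μ n =
        ∫ ω, ∑ k ∈ Finset.range (r + 1), (-1) ^ k * ((X n ω).choose k : ℝ) ∂μ n := by
      rw [integral_finsetSum _ fun k _ => (hintg n k).const_mul _]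
      exact Finset.sum_congr rfl fun k _ => (integral_const_mul _ _).symm
    rw [e1, e2, ← integral_sub i1 i2]
    refine (abs_integral_le_integral_abs).trans (integral_mono (i1.sub i2).abs (hintg n _) fun ω => bonf _ _)
  rw [Metric.tendsto_atTop]
  intro ε hε
  have hs : HasSum (fun k : ℕ => (-l) ^ k / k.factorial) (exp (-l)) := by
    rw [Real.exp_eq_exp_ℝ]; exact NormedSpace.expSeries_div_hasSum_exp (-l)
  have hs1 := hs.tendsto_sum_nat
  have hs2 : Tendsto (fun k : ℕ => l ^ k / k.factorial) atTop (𝓝 0) := FloorSemiring.tendsto_pow_div_factorial_atTop l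
  obtain ⟨r, hr1, hr2⟩ : ∃ r : ℕ, |∑ k ∈ Finset.range (r + 1), (-l) ^ k / k.factorial - exp (-l)| < ε / 4 ∧ l ^ (r + 1) / (r + 1).factorial < ε / 4 := by
    have h1 := (Metric.tendsto_nhds.1 hs1 (ε / 4) (by positivity))
    have h2 := hs2.eventually (gt_mem_nhds (show (0 : ℝ) < ε / 4 by positivity))
    obtain ⟨r, h3, h4⟩ := ((tendsto_add_atTop_nat 1).eventually (h1.and h2)).exists
    exact ⟨r, by simpa [Real.dist_eq] using h3, h4⟩
  have h1 : Tendsto (fun n => ∑ k ∈ Finset.range (r + 1), (-1) ^ k * ∫ ω, ((X n ω).choose k : ℝ) ∂μ n) atTop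
      (𝓝 (∑ k ∈ Finset.range (r + 1), (-l) ^ k / k.factorial)) := by
    refine tendsto_finsetSum _ fun k _ => ?_
    have := (hF k).const_mul ((-1) ^ k)
    rwa [show (-1) ^ k * (l ^ k / k.factorial) = (-l) ^ k / k.factorial by rw [neg_pow l]; ring] at this
  have h2 := (hF (r + 1)).eventually (gt_mem_nhds hr2)
  have h3 := Metric.tendsto_nhds.1 h1 (ε / 4) (by positivity)
  obtain ⟨N, hN⟩ := eventually_atTop.1 (h2.and h3)
  refine ⟨N, fun n hn => ?_⟩
  obtain ⟨h4, h5⟩ := hN n hn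
  rw [Real.dist_eq] at h5 ⊢
  have h6 := hb n r
  rw [abs_lt] at *
  rw [abs_le] at h6
  constructor <;> linarith [h5.1, h5.2, h6.1, h6.2, hr1.1, hr1.2]

section comb
/-- admissible pair relation -/
def rr (a b s u v : ℝ) : Prop := 0 < v - u ∧ v - u ≤ s ∧ a ≤ (u + v) / 2 ∧ (u + v) / 2 < b

/-- isolated edges -/
def iso (a b s : ℝ) (x : Fin n → ℝ) (p : Fin n × Fin n) : Prop :=
  rr a b s (x p.1) (x p.2) ∧ ∀ l, l ≠ p.1 → l ≠ p.2 → s < |x l - x p.1| ∧ s < |x l - x p.2|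

open Classical in
/-- number of isolated edges -/
def Nh (a b s : ℝ) (x : Fin n → ℝ) : ℕ := (Finset.univ.filter (iso a b s x)).card

variable {a b s : ℝ}

lemma iso_share {x : Fin n → ℝ} {p q : Fin n × Fin n} (hp : iso a b s x p) (hq : iso a b s x q)
    (h : p.1 = q.1 ∨ p.1 = q.2 ∨ p.2 = q.1 ∨ p.2 = q.2) : p = q := by
  obtain ⟨⟨p1, p2, -, -⟩, -⟩ := hp
  obtain ⟨⟨q1, q2, -, -⟩, q3⟩ := hq
  obtain ⟨i, j⟩ := p
  obtain ⟨i', j'⟩ := q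
  simp only at *
  have hd1 : |x j - x i| ≤ s := by rw [abs_of_pos p1]; exact p2
  have hd2 : |x i - x j| ≤ s := by rw [abs_sub_comm]; exact hd1
  have hij : i ≠ j := by rintro rfl; simp at p1
  by_cases hi1 : i = i'
  · subst hi1
    by_cases hj : j = j'
    · rw [hj]
    · exact absurd (q3 j (Ne.symm hij) hj).1 (not_lt.2 hd1)
  · by_cases hi2 : i = j'
    · subst hi2
      by_cases hj : j = i'
      · subst hj; linarith
      · exact absurd (q3 j hj (Ne.symm hij)).2 (not_lt.2 hd1)
    · by_cases hj1 : j = i'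
      · subst hj1
        exact absurd (q3 i hij hi2).1 (not_lt.2 hd2)
      · by_cases hj2 : j = j'
        · subst hj2
          exact absurd (q3 i hi1 hij).2 (not_lt.2 hd2)
        · tauto

open Classical in
lemma Nh_desc (x : Fin n → ℝ) (m : ℕ) : (Nh a b s x).descFactorial m =
    (Finset.univ.filter (fun Φ : Fin m ⊕ Fin m ↪ Fin n => ∀ k, iso a b s x (Φ (.inl k), Φ (.inr k)))).card := by
  have h1 : (Nh a b s x).descFactorial m = Fintype.card (Fin m ↪ {p // iso a b s x p}) := by
    rw [Fintype.card_embedding_eq, Fintype.card_fin, Fintype.card_subtype, Nh]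
  rw [h1, ← Fintype.card_subtype]
  refine Fintype.card_congr ⟨fun f => ⟨⟨Sum.elim (fun k => (f k).1.1) (fun k => (f k).1.2), ?_⟩, ?_⟩,
    fun Φ => ⟨fun k => ⟨(Φ.1 (.inl k), Φ.1 (.inr k)), Φ.2 k⟩, ?_⟩, ?_, ?_⟩
  · have hne : ∀ k, (f k).1.1 ≠ (f k).1.2 := fun k h => by
      have := (f k).2.1.1
      rw [h] at this; simp at this
    have hsh : ∀ k k', ((f k).1.1 = (f k').1.1 ∨ (f k).1.1 = (f k').1.2 ∨ (f k).1.2 = (f k').1.1 ∨ (f k).1.2 = (f k').1.2) → k = k' :=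
      fun k k' h => f.injective (Subtype.ext (iso_share (f k).2 (f k').2 h))
    rintro (k | k) (k' | k') h
    · exact congrArg _ (hsh k k' (.inl h))
    · have := hsh k k' (.inr (.inl h)); subst this; exact absurd h (hne k)
    · have := hsh k k' (.inr (.inr (.inl h))); subst this; exact absurd h.symm (hne k)
    · exact congrArg _ (hsh k k' (.inr (.inr (.inr h))))
  · intro k; exact (f k).2
  · intro k k' h
    simp only [Subtype.mk.injEq, Prod.mk.injEq] at h
    have := Φ.1.injective h.1
    simpa using this
  · intro f; ext k <;> rfl
  · intro Φ
    ext (k | k) <;> rfl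

lemma Nh_le (x : Fin n → ℝ) : Nh a b s x ≤ n * n := by
  classical
  refine (Finset.card_le_univ _).trans ?_
  simp

end comb
end
end CUE

open MeasureTheory Filter Topology Real
open scoped ENNReal

namespace CUE

noncomputable section
variable {n : ℕ}
variable {a b s : ℝ}

lemma rr_meas {α : Type*} [MeasurableSpace α] {f g : α → ℝ} (hf : Measurable f) (hg : Measurable g) :
    MeasurableSet {x | rr a b s (f x) (g x)} :=
  (measurableSet_lt measurable_const (hg.sub hf)).inter
    ((measurableSet_le (hg.sub hf) measurable_const).inter
      ((measurableSet_le measurable_const ((hf.add hg).div_const 2)).inter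
        (measurableSet_lt ((hf.add hg).div_const 2) measurable_const)))

lemma absd_meas {ι : Type*} (i j : ι) : Measurable (fun x : ι → ℝ => |x i - x j|) := by
  have := (measurable_pi_apply i : Measurable (fun x : ι → ℝ => x i)).sub (measurable_pi_apply j)
  exact _root_.measurable_abs.comp this

lemma iso_meas (p : Fin n × Fin n) : MeasurableSet {x : Fin n → ℝ | iso a b s x p} := by
  refine (rr_meas (measurable_pi_apply _) (measurable_pi_apply _)).inter ?_
  have : {x : Fin n → ℝ | ∀ l, l ≠ p.1 → l ≠ p.2 → s < |x l - x p.1| ∧ s < |x l - x p.2|} =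
      ⋂ l, ⋂ (_ : l ≠ p.1), ⋂ (_ : l ≠ p.2), {x : Fin n → ℝ | s < |x l - x p.1| ∧ s < |x l - x p.2|} := by
    ext x; simp
  change MeasurableSet {x : Fin n → ℝ | ∀ l, l ≠ p.1 → l ≠ p.2 → s < |x l - x p.1| ∧ s < |x l - x p.2|}
  rw [this]
  refine MeasurableSet.iInter fun l => MeasurableSet.iInter fun _ => MeasurableSet.iInter fun _ => ?_
  exact (measurableSet_lt measurable_const (absd_meas _ _)).inter (measurableSet_lt measurable_const (absd_meas _ _))

lemma Nh_meas : Measurable (fun x : Fin n → ℝ => Nh a b s x) := by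
  classical
  have : (fun x : Fin n → ℝ => Nh a b s x) = fun x => ∑ p : Fin n × Fin n, if iso a b s x p then 1 else 0 := by
    funext x
    rw [Nh, Finset.card_filter]
  rw [this]
  exact Finset.measurable_sum _ fun p _ => Measurable.ite (iso_meas p) measurable_const measurable_const

section
variable {κ : Type} [Fintype κ] [DecidableEq κ]

/-- all pairs admissible -/
def RR (a b s : ℝ) : Set (κ ⊕ κ → ℝ) := {y | ∀ k, rr a b s (y (.inl k)) (y (.inr k))}

/-- separated left points -/
def SepR (r : ℝ) : Set (κ ⊕ κ → ℝ) := {y | ∀ k k', k ≠ k' → r ≤ |y (.inl k) - y (.inl k')| ∧ |y (.inl k) - y (.inl k')| ≤ 2 * π - r}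

/-- triple sets -/
def Tri (a b s : ℝ) (k : κ) : Set ((κ ⊕ κ) ⊕ Unit → ℝ) := {y | y ∘ Sum.inl ∈ RR a b s ∧ |y (.inr ()) - y (.inl (.inl k))| ≤ 2 * s}

lemma RR_meas : MeasurableSet (RR a b s : Set (κ ⊕ κ → ℝ)) := by
  have : (RR a b s : Set (κ ⊕ κ → ℝ)) = ⋂ k, {y | rr a b s (y (.inl k)) (y (.inr k))} := by ext; simp [RR]
  rw [this]
  exact MeasurableSet.iInter fun k => rr_meas (measurable_pi_apply _) (measurable_pi_apply _)

lemma SepR_meas (r : ℝ) : MeasurableSet (SepR r : Set (κ ⊕ κ → ℝ)) := by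
  have : (SepR r : Set (κ ⊕ κ → ℝ)) = ⋂ k, ⋂ k', ⋂ (_ : k ≠ k'), {y | r ≤ |y (.inl k) - y (.inl k')| ∧ |y (.inl k) - y (.inl k')| ≤ 2 * π - r} := by
    ext; simp [SepR]
  rw [this]
  refine MeasurableSet.iInter fun k => MeasurableSet.iInter fun k' => MeasurableSet.iInter fun _ => ?_
  exact (measurableSet_le measurable_const (absd_meas _ _)).inter (measurableSet_le (absd_meas _ _) measurable_const)

lemma Tri_meas (k : κ) : MeasurableSet (Tri a b s k) := by
  refine MeasurableSet.inter ?_ (measurableSet_le (absd_meas _ _) measurable_const)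
  have : Measurable (fun y : (κ ⊕ κ) ⊕ Unit → ℝ => y ∘ Sum.inl) := measurable_pi_lambda _ fun i => measurable_pi_apply _
  exact this RR_meas
end

lemma sum_corr {ι : Type} [Fintype ι] [DecidableEq ι] (hc : Fintype.card ι ≤ n) (F : (ι → ℝ) → ℝ≥0∞) (hF : Measurable F) :
    ∑ Φ : ι ↪ Fin n, ∫⁻ x, F (x ∘ Φ) ∂(W n) = ∫⁻ y, F y * ENNReal.ofReal (rho n y) ∂piN ι := by
  have hD : ((n.descFactorial (Fintype.card ι) : ℕ) : ℝ≥0∞) ≠ 0 := by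
    simp only [ne_eq, Nat.cast_eq_zero, Nat.descFactorial_eq_zero_iff_lt]; omega
  have hD' : ((n.descFactorial (Fintype.card ι) : ℕ) : ℝ≥0∞) ≠ ⊤ := ENNReal.natCast_ne_top _
  have : ∀ Φ : ι ↪ Fin n, ∫⁻ x, F (x ∘ Φ) ∂(W n) =
      ((n.descFactorial (Fintype.card ι) : ℕ) : ℝ≥0∞)⁻¹ * ∫⁻ y, F y * ENNReal.ofReal (rho n y) ∂piN ι := by
    intro Φ
    rw [← corrW Φ F hF, ← mul_assoc, ENNReal.inv_mul_cancel hD hD', one_mul]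
  simp only [this, Finset.sum_const, Finset.card_univ, Fintype.card_embedding_eq, Fintype.card_fin, nsmul_eq_mul]
  rw [← mul_assoc, ENNReal.mul_inv_cancel hD hD', one_mul]

/-- indicator -/
abbrev ind {α : Type*} (S : Set α) : α → ℝ≥0∞ := S.indicator 1

lemma ind_meas {α : Type*} [MeasurableSpace α] {S : Set α} (hS : MeasurableSet S) : Measurable (ind S) :=
  measurable_one.indicator hS

lemma comp_meas {ι : Type*} (f : ι → Fin n) : Measurable (fun x : Fin n → ℝ => x ∘ f) :=
  measurable_pi_lambda _ fun i => measurable_pi_apply _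

lemma mom_eq (m : ℕ) : ∫⁻ x, ((Nh a b s x).descFactorial m : ℝ≥0∞) ∂(W n) =
    ∑ Φ : Fin m ⊕ Fin m ↪ Fin n, ∫⁻ x, ind {x | ∀ k, iso a b s x (Φ (.inl k), Φ (.inr k))} x ∂(W n) := by
  classical
  rw [← lintegral_finsetSum]
  · refine lintegral_congr fun x => ?_
    rw [Nh_desc, Finset.card_filter]
    push_cast
    refine Finset.sum_congr rfl fun Φ _ => ?_
    by_cases h : ∀ k, iso a b s x (Φ (.inl k), Φ (.inr k)) <;> simp [h, Set.indicator]
  · intro Φ _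
    refine ind_meas ?_
    have : {x : Fin n → ℝ | ∀ k, iso a b s x (Φ (.inl k), Φ (.inr k))} = ⋂ k, {x | iso a b s x (Φ (.inl k), Φ (.inr k))} := by
      ext; simp
    rw [this]
    exact MeasurableSet.iInter fun k => iso_meas _

lemma mom_upper (m : ℕ) (hm : m + m ≤ n) : ∫⁻ x, ((Nh a b s x).descFactorial m : ℝ≥0∞) ∂(W n) ≤
    ∫⁻ y, ind (RR a b s) y * ENNReal.ofReal (rho n y) ∂piN (Fin m ⊕ Fin m) := by
  rw [mom_eq, ← sum_corr (by simpa using hm) _ (ind_meas RR_meas)]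
  refine Finset.sum_le_sum fun Φ _ => lintegral_mono fun x => ?_
  by_cases h : ∀ k, iso a b s x (Φ (.inl k), Φ (.inr k))
  · have h1 : x ∘ Φ ∈ RR a b s := fun k => (h k).1
    have h2 : x ∈ {x | ∀ k, iso a b s x (Φ (.inl k), Φ (.inr k))} := h
    simp only [ind]
    rw [Set.indicator_of_mem h1, Set.indicator_of_mem h2]
    simp
  · simp [h]

lemma mom_lower (m : ℕ) (hm : m + m + 1 ≤ n) (r : ℝ) (hr : 2 * s < r) (hs : 0 ≤ s) :
    ∫⁻ y, ind (RR a b s ∩ SepR r) y * ENNReal.ofReal (rho n y) ∂piN (Fin m ⊕ Fin m) ≤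
    ∫⁻ x, ((Nh a b s x).descFactorial m : ℝ≥0∞) ∂(W n) +
      ∑ k : Fin m, ∫⁻ y, ind (Tri a b s k) y * ENNReal.ofReal (rho n y) ∂piN ((Fin m ⊕ Fin m) ⊕ Unit) := by
  classical
  rw [mom_eq, ← sum_corr (by simp; omega) _ (ind_meas (RR_meas.inter (SepR_meas r)))]
  have e : ∀ k : Fin m, ∫⁻ y, ind (Tri a b s k) y * ENNReal.ofReal (rho n y) ∂piN ((Fin m ⊕ Fin m) ⊕ Unit) =
      ∑ Φ : Fin m ⊕ Fin m ↪ Fin n, ∑ Ψ : (Fin m ⊕ Fin m) ⊕ Unit ↪ Fin n with Function.Embedding.inl.trans Ψ = Φ,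
        ∫⁻ x, ind (Tri a b s k) (x ∘ Ψ) ∂(W n) := by
    intro k
    rw [← sum_corr (by simpa using hm) _ (ind_meas (Tri_meas k)), Finset.sum_fiberwise]
  simp only [e]
  rw [Finset.sum_comm, ← Finset.sum_add_distrib]
  refine Finset.sum_le_sum fun Φ _ => ?_
  have hmT : ∀ k, ∀ Ψ : (Fin m ⊕ Fin m) ⊕ Unit ↪ Fin n, Measurable fun x : Fin n → ℝ => ind (Tri a b s k) (x ∘ Ψ) :=
    fun k Ψ => (ind_meas (Tri_meas k)).comp (comp_meas _)
  simp only [← lintegral_finsetSum _ fun Ψ _ => hmT _ Ψ]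
  rw [← lintegral_finsetSum _ fun k _ => Finset.measurable_sum _ fun Ψ _ => hmT k Ψ, ← lintegral_add_right _
    (Finset.measurable_sum _ fun k _ => Finset.measurable_sum _ fun Ψ _ => hmT k Ψ)]
  refine lintegral_mono fun x => ?_
  by_cases h1 : (x ∘ Φ) ∈ RR a b s ∩ SepR r
  swap
  · simp [h1]
  by_cases h2 : ∀ k, iso a b s x (Φ (.inl k), Φ (.inr k))
  · refine le_trans ?_ le_self_add
    have h2' : x ∈ {x | ∀ k, iso a b s x (Φ (.inl k), Φ (.inr k))} := h2
    rw [ind, ind, Set.indicator_of_mem h1, Set.indicator_of_mem h2']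
    simp
  · push Not at h2
    obtain ⟨k, hk⟩ := h2
    have hrk : ∀ k, rr a b s (x (Φ (.inl k))) (x (Φ (.inr k))) := h1.1
    obtain ⟨l, hl1, hl2, hl3⟩ : ∃ l, l ≠ Φ (.inl k) ∧ l ≠ Φ (.inr k) ∧ (|x l - x (Φ (.inl k))| ≤ s ∨ |x l - x (Φ (.inr k))| ≤ s) := by
      by_contra hcon
      push Not at hcon
      exact hk ⟨hrk k, hcon⟩
    have habs : ∀ k, |x (Φ (.inr k)) - x (Φ (.inl k))| ≤ s := fun k => by
      rw [abs_of_pos (hrk k).1]; exact (hrk k).2.1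
    have hl4 : |x l - x (Φ (.inl k))| ≤ 2 * s := by
      rcases hl3 with h | h
      · linarith
      · have := abs_sub_le (x l) (x (Φ (.inr k))) (x (Φ (.inl k)))
        linarith [habs k]
    have hl5 : ∀ i, l ≠ Φ i := by
      have hsp : ∀ k', k ≠ k' → r ≤ |x (Φ (.inl k)) - x (Φ (.inl k'))| := fun k' h => (h1.2 k k' h).1
      have key : ∀ k' : Fin m, k ≠ k' → s < x (Φ (.inl k')) - x (Φ (.inr k)) ∨ s < x (Φ (.inl k)) - x (Φ (.inr k')) := by
        intro k' h
        have h3 := hsp k' h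
        have h4 := habs k
        have h5 := habs k'
        rw [abs_le] at h4 h5
        rcases le_abs.1 h3 with h6 | h6
        · right; linarith [h4.1, h5.2]
        · left; linarith [h4.2, h5.1]
      rintro (k' | k') rfl
      · by_cases hkk : k = k'
        · subst hkk; exact hl1 rfl
        have h5 := (hrk k).1
        have h6 := (hrk k').1
        have h7 := (hrk k).2.1
        have h8 := (hrk k').2.1
        rcases key k' hkk with h | h <;> rcases hl3 with h' | h' <;> rw [abs_le] at h' <;> linarith [h'.1, h'.2]
      · by_cases hkk : k = k'
        · subst hkk; exact hl2 rfl
        have h5 := (hrk k).1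
        have h6 := (hrk k').1
        have h7 := (hrk k).2.1
        have h8 := (hrk k').2.1
        rcases key k' hkk with h | h <;> rcases hl3 with h' | h' <;> rw [abs_le] at h' <;> linarith [h'.1, h'.2]
    let Ψ : (Fin m ⊕ Fin m) ⊕ Unit ↪ Fin n := ⟨Sum.elim Φ (fun _ => l), by
      refine Φ.injective.sumElim (fun _ _ _ => rfl) ?_
      intro a _ h
      exact hl5 a h.symm⟩
    have hΨ : Function.Embedding.inl.trans Ψ = Φ := by ext i; rfl
    have hT : x ∘ Ψ ∈ Tri a b s k := ⟨h1.1, hl4⟩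
    refine le_trans ?_ le_add_self
    refine le_trans ?_ (Finset.single_le_sum (f := fun k => ∑ Ψ : (Fin m ⊕ Fin m) ⊕ Unit ↪ Fin n with Function.Embedding.inl.trans Ψ = Φ, ind (Tri a b s k) (x ∘ Ψ)) (fun _ _ => zero_le) (Finset.mem_univ k))
    refine le_trans ?_ (Finset.single_le_sum (f := fun Ψ : (Fin m ⊕ Fin m) ⊕ Unit ↪ Fin n => ind (Tri a b s k) (x ∘ Ψ)) (fun _ _ => zero_le) (Finset.mem_filter.2 ⟨Finset.mem_univ Ψ, hΨ⟩))
    simp only [ind]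
    rw [Set.indicator_of_mem h1, Set.indicator_of_mem hT]
    simp

end
end CUE

open MeasureTheory Filter Topology Real
open scoped ENNReal

namespace CUE

noncomputable section
variable {n : ℕ}
variable {a b s : ℝ}

lemma pi_succ {m : ℕ} (i : Fin (m + 1)) (F : (Fin (m + 1) → ℝ) → ℝ≥0∞) (hF : Measurable F) :
    ∫⁻ x, F x ∂piN (Fin (m + 1)) = ∫⁻ w, ∫⁻ t, F (i.insertNth t w) ∂nu ∂piN (Fin m) := by
  have h := (measurePreserving_piFinSuccAbove (fun _ : Fin (m + 1) => nu) i).symm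
  rw [← h.lintegral_comp_emb (MeasurableEquiv.measurableEmbedding _)]
  rw [lintegral_prod_symm (fun a => F ((MeasurableEquiv.piFinSuccAbove (fun _ => ℝ) i).symm a)) (hF.comp (MeasurableEquiv.measurable _)).aemeasurable]
  rfl

lemma pi_prod : ∀ (m : ℕ) (g : Fin m → ℝ → ℝ≥0∞) (_ : ∀ k, Measurable (g k)),
    ∫⁻ w, ∏ k, g k (w k) ∂piN (Fin m) = ∏ k, ∫⁻ t, g k t ∂nu := by
  intro m
  induction m with
  | zero => intro g hg; simp
  | succ m ih =>
    intro g hg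
    rw [pi_succ 0 _ (by
      refine Finset.measurable_fun_prod _ fun k _ => (hg k).comp (measurable_pi_apply k))]
    simp only [Fin.prod_univ_succAbove _ (0 : Fin (m + 1)), Fin.insertNth_apply_same, Fin.insertNth_apply_succAbove]
    have : ∀ w : Fin m → ℝ, ∫⁻ t, g 0 t * ∏ k : Fin m, g ((0 : Fin (m + 1)).succAbove k) (w k) ∂nu = (∫⁻ t, g 0 t ∂nu) * ∏ k : Fin m, g ((0 : Fin (m + 1)).succAbove k) (w k) :=
      fun w => lintegral_mul_const _ (hg 0)
    simp only [this]
    rw [lintegral_const_mul (f := fun w : Fin m → ℝ => ∏ k : Fin m, g ((0 : Fin (m + 1)).succAbove k) (w k)) _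
      (Finset.measurable_fun_prod _ fun k _ => (hg _).comp (measurable_pi_apply k)), ih _ fun k => hg _]

/-- weighted pair kernel -/
def fk (n : ℕ) (a b s : ℝ) (u v : ℝ) : ℝ≥0∞ := ind {p : ℝ × ℝ | rr a b s p.1 p.2} (u, v) * ENNReal.ofReal (qq n (v - u))

lemma qq_meas : Measurable (qq n) := by unfold qq; fun_prop

lemma fk_meas {α : Type*} [MeasurableSpace α] {f g : α → ℝ} (hf : Measurable f) (hg : Measurable g) :
    Measurable (fun x => fk n a b s (f x) (g x)) := by
  unfold fk
  refine Measurable.mul ?_ ?_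
  · exact (ind_meas (rr_meas measurable_fst measurable_snd)).comp (hf.prodMk hg)
  · exact (qq_meas.comp (hg.sub hf)).ennreal_ofReal

/-- one-point marginal -/
def phi (n : ℕ) (a b s : ℝ) (u : ℝ) : ℝ≥0∞ := ∫⁻ v, fk n a b s u v ∂nu

lemma phi_meas : Measurable (phi n a b s) := by
  unfold phi
  exact Measurable.lintegral_prod_right' (f := fun p : ℝ × ℝ => fk n a b s p.1 p.2) (fk_meas measurable_fst measurable_snd)

/-- total mass -/
def LamP (n : ℕ) (a b s : ℝ) : ℝ≥0∞ := ∫⁻ u, phi n a b s u ∂nu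

/-- product of kernels -/
def PK (n : ℕ) (a b s : ℝ) {m : ℕ} (y : Fin m ⊕ Fin m → ℝ) : ℝ≥0∞ := ∏ k, fk n a b s (y (.inl k)) (y (.inr k))

lemma PK_meas {m : ℕ} : Measurable (PK n a b s : (Fin m ⊕ Fin m → ℝ) → ℝ≥0∞) :=
  Finset.measurable_fun_prod _ fun k _ => fk_meas (measurable_pi_apply _) (measurable_pi_apply _)

lemma PK_eq {m : ℕ} (y : Fin m ⊕ Fin m → ℝ) : PK n a b s y = ind (RR a b s) y * ENNReal.ofReal (∏ k, qq n (del y k)) := by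
  by_cases h : y ∈ RR a b s
  · rw [ind, Set.indicator_of_mem h, Pi.one_apply, one_mul, ENNReal.ofReal_prod_of_nonneg fun k _ => qq_nonneg _]
    refine Finset.prod_congr rfl fun k _ => ?_
    have hk : ((y (.inl k)), (y (.inr k))) ∈ {p : ℝ × ℝ | rr a b s p.1 p.2} := h k
    rw [fk, ind, Set.indicator_of_mem hk, Pi.one_apply, one_mul]
    rfl
  · rw [ind, Set.indicator_of_notMem h, zero_mul]
    have : ∃ k, ¬ rr a b s (y (.inl k)) (y (.inr k)) := by
      by_contra hc; push Not at hc; exact h hc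
    obtain ⟨k, hk⟩ := this
    refine Finset.prod_eq_zero (Finset.mem_univ k) ?_
    have hk' : ((y (.inl k)), (y (.inr k))) ∉ {p : ℝ × ℝ | rr a b s p.1 p.2} := hk
    rw [fk, ind, Set.indicator_of_notMem hk', zero_mul]

lemma int_PK {m : ℕ} (G : (Fin m → ℝ) → ℝ≥0∞) (hG : Measurable G) :
    ∫⁻ y, G (y ∘ Sum.inl) * PK n a b s y ∂piN (Fin m ⊕ Fin m) = ∫⁻ u, G u * ∏ k, phi n a b s (u k) ∂piN (Fin m) := by
  have hm : Measurable (fun y : Fin m ⊕ Fin m → ℝ => y ∘ Sum.inl) := measurable_pi_lambda _ fun i => measurable_pi_apply _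
  rw [piN_sum (fun y => G (y ∘ Sum.inl) * PK n a b s y) ((hG.comp hm).mul PK_meas)]
  refine lintegral_congr fun u => ?_
  have e : ∀ w : Fin m → ℝ, G ((Sum.elim u w) ∘ Sum.inl) * PK n a b s (Sum.elim u w) = G u * ∏ k, fk n a b s (u k) (w k) := by
    intro w; simp [PK]
  simp only [e]
  rw [lintegral_const_mul _ (Finset.measurable_fun_prod _ fun k _ => fk_meas measurable_const (measurable_pi_apply _)),
    pi_prod m (fun k t => fk n a b s (u k) t) fun k => fk_meas measurable_const measurable_id]
  rfl

lemma int_PK_one {m : ℕ} : ∫⁻ y, PK n a b s y ∂piN (Fin m ⊕ Fin m) = LamP n a b s ^ m := by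
  have := int_PK (n := n) (a := a) (b := b) (s := s) (m := m) (fun _ => 1) measurable_const
  simp only [one_mul] at this
  rw [this, pi_prod m (fun _ => phi n a b s) fun _ => phi_meas]
  simp [LamP]

lemma rho_le_PK (hn : 0 < n) {m : ℕ} (y : Fin m ⊕ Fin m → ℝ) : ind (RR a b s) y * ENNReal.ofReal (rho n y) ≤ PK n a b s y := by
  rw [PK_eq]
  by_cases h : y ∈ RR a b s
  · gcongr
    exact rho_pairs_le hn y fun k => (h k).1.ne'
  · simp [h]

lemma up_int (hn : 0 < n) (m : ℕ) : ∫⁻ y, ind (RR a b s) y * ENNReal.ofReal (rho n y) ∂piN (Fin m ⊕ Fin m) ≤ LamP n a b s ^ m := by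
  rw [← int_PK_one]
  exact lintegral_mono fun y => rho_le_PK hn y

lemma nu_Icc (c d : ℝ) : nu (Set.Icc c d) ≤ ENNReal.ofReal ((d - c) / (2 * π)) := by
  rw [nu, Measure.smul_apply, smul_eq_mul]
  refine (mul_le_mul_right (Measure.restrict_apply_le _ _) _).trans ?_
  rw [Real.volume_Icc, mul_comm, ← ENNReal.ofReal_inv_of_pos (by positivity), div_eq_mul_inv, ENNReal.ofReal_mul' (by positivity)]

lemma tri_int (hn : 0 < n) (hs : 0 < s) {m : ℕ} (k : Fin m) :
    ∫⁻ y, ind (Tri a b s k) y * ENNReal.ofReal (rho n y) ∂piN ((Fin m ⊕ Fin m) ⊕ Unit) ≤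
      LamP n a b s ^ m * ENNReal.ofReal (((n : ℝ) * s) ^ 3) := by
  rw [piN_sum (fun y => ind (Tri a b s k) y * ENNReal.ofReal (rho n y)) ((ind_meas (Tri_meas k)).mul rho_meas.ennreal_ofReal), ← int_PK_one, ← lintegral_mul_const _ PK_meas]
  refine lintegral_mono fun y => ?_
  rw [piN_unit (fun w => ind (Tri a b s k) (Sum.elim y w) * ENNReal.ofReal (rho n (Sum.elim y w)))]
  have h1 : ∀ t, ind (Tri a b s k) (Sum.elim y (fun _ : Unit => t)) * ENNReal.ofReal (rho n (Sum.elim y (fun _ : Unit => t))) ≤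
      (PK n a b s y * ENNReal.ofReal ((n : ℝ) ^ 3 * s ^ 2)) * ind (Set.Icc (y (.inl k) - 2 * s) (y (.inl k) + 2 * s)) t := by
    intro t
    by_cases h : Sum.elim y (fun _ : Unit => t) ∈ Tri a b s k
    · have hR : y ∈ RR a b s := h.1
      have ht : |t - y (.inl k)| ≤ 2 * s := h.2
      have ht' : t ∈ Set.Icc (y (.inl k) - 2 * s) (y (.inl k) + 2 * s) := by
        rw [abs_le] at ht; constructor <;> linarith [ht.1, ht.2]
      rw [PK_eq, ind, ind, ind, Set.indicator_of_mem h, Set.indicator_of_mem hR, Set.indicator_of_mem ht']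
      simp only [Pi.one_apply, one_mul, mul_one]
      rw [← ENNReal.ofReal_mul (Finset.prod_nonneg fun k _ => qq_nonneg _)]
      exact ENNReal.ofReal_le_ofReal (rho_triple_le hn y (fun k => (hR k).1.ne') k t s hs ht)
    · simp [h]
  refine (lintegral_mono h1).trans ?_
  rw [lintegral_const_mul _ (ind_meas measurableSet_Icc), lintegral_indicator_one measurableSet_Icc, mul_assoc]
  gcongr
  refine (mul_le_mul_right (nu_Icc _ _) _).trans ?_
  rw [← ENNReal.ofReal_mul (by positivity)]
  refine ENNReal.ofReal_le_ofReal ?_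
  have hp : 2 ≤ π := Real.two_le_pi
  have : (y (.inl k) + 2 * s - (y (.inl k) - 2 * s)) / (2 * π) ≤ s := by
    rw [div_le_iff₀ (by positivity)]; nlinarith
  calc _ ≤ (n : ℝ) ^ 3 * s ^ 2 * s := by gcongr
    _ = _ := by ring

/-- bad set -/
def Bs (r v : ℝ) : Set ℝ := Set.Icc (v - r) (v + r) ∪ (Set.Icc 0 r ∪ Set.Icc (2 * π - r) (2 * π))

lemma Bs_nu (r v : ℝ) (hr : 0 ≤ r) : nu (Bs r v) ≤ ENNReal.ofReal r := by
  have hp : 2 ≤ π := Real.two_le_pi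
  refine (measure_union_le _ _).trans ((add_le_add le_rfl (measure_union_le _ _)).trans ?_)
  refine (add_le_add (nu_Icc _ _) (add_le_add (nu_Icc _ _) (nu_Icc _ _))).trans ?_
  have e1 : (v + r - (v - r)) / (2 * π) = 2 * r / (2 * π) := by ring
  have e2 : (2 * π - (2 * π - r)) / (2 * π) = r / (2 * π) := by ring
  rw [e1, e2, sub_zero, ← ENNReal.ofReal_add (by positivity) (by positivity), ← ENNReal.ofReal_add (by positivity) (by positivity)]
  refine ENNReal.ofReal_le_ofReal ?_
  rw [← add_div, ← add_div, div_le_iff₀ (by positivity)]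
  nlinarith

lemma Bs_meas (r : ℝ) : MeasurableSet {p : ℝ × ℝ | p.2 ∈ Bs r p.1} := by
  have e : {p : ℝ × ℝ | p.2 ∈ Bs r p.1} = ({p | p.1 - r ≤ p.2} ∩ {p | p.2 ≤ p.1 + r}) ∪ (Prod.snd ⁻¹' (Set.Icc 0 r ∪ Set.Icc (2 * π - r) (2 * π))) := by
    ext p; simp [Bs]
  rw [e]
  refine MeasurableSet.union (MeasurableSet.inter ?_ ?_) (measurable_snd (measurableSet_Icc.union measurableSet_Icc))
  · exact measurableSet_le (measurable_fst.sub_const r) measurable_snd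
  · exact measurableSet_le measurable_snd (measurable_fst.add_const r)

lemma bad_int {m : ℕ} (M : ℝ) (hM : ∀ u, phi n a b s u ≤ ENNReal.ofReal M) (hM0 : 0 ≤ M) (r : ℝ) (hr : 0 ≤ r) (k k' : Fin m) (hk : k ≠ k') :
    ∫⁻ y, ind {p : ℝ × ℝ | p.2 ∈ Bs r p.1} (y (.inl k), y (.inl k')) * PK n a b s y ∂piN (Fin m ⊕ Fin m) ≤
      LamP n a b s ^ (m - 1) * ENNReal.ofReal (M * r) := by
  have hm : Measurable (fun u : Fin m → ℝ => ind {p : ℝ × ℝ | p.2 ∈ Bs r p.1} (u k, u k')) :=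
    (ind_meas (Bs_meas r)).comp ((measurable_pi_apply k).prodMk (measurable_pi_apply k'))
  have := int_PK (n := n) (a := a) (b := b) (s := s) (fun u : Fin m → ℝ => ind {p : ℝ × ℝ | p.2 ∈ Bs r p.1} (u k, u k')) hm
  simp only [Function.comp_apply] at this
  rw [this]
  rcases m with _ | m
  · exact k.elim0
  have hmm : Measurable (fun u : Fin (m + 1) → ℝ => ∏ k, phi n a b s (u k)) := 
    Finset.measurable_fun_prod _ fun k _ => phi_meas.comp (measurable_pi_apply k)
  rw [pi_succ k' (fun u => ind {p : ℝ × ℝ | p.2 ∈ Bs r p.1} (u k, u k') * ∏ k, phi n a b s (u k)) (hm.mul hmm)]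
  obtain ⟨i, rfl⟩ := Fin.exists_succAbove_eq hk
  simp only [Fin.insertNth_apply_same, Fin.insertNth_apply_succAbove, Fin.prod_univ_succAbove _ k', Nat.add_sub_cancel]
  have e : LamP n a b s ^ m = ∫⁻ w, ∏ k, phi n a b s (w k) ∂piN (Fin m) := by
    rw [pi_prod m (fun _ => phi n a b s) fun _ => phi_meas]
    simp [LamP]
  rw [e, ← lintegral_mul_const (f := fun w : Fin m → ℝ => ∏ k, phi n a b s (w k)) _ (Finset.measurable_fun_prod _ fun k _ => phi_meas.comp (measurable_pi_apply k))]
  refine lintegral_mono fun w => ?_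
  have hB : MeasurableSet (Bs r (w i)) := (measurable_prodMk_left (Bs_meas r) : MeasurableSet (Prod.mk (w i) ⁻¹' _))
  calc ∫⁻ t, ind {p : ℝ × ℝ | p.2 ∈ Bs r p.1} (w i, t) * (phi n a b s t * ∏ j, phi n a b s (w j)) ∂nu 
      ≤ ∫⁻ t, (ENNReal.ofReal M * ∏ j, phi n a b s (w j)) * ind (Bs r (w i)) t ∂nu := by
        refine lintegral_mono fun t => ?_
        by_cases h : t ∈ Bs r (w i)
        · have h' : (w i, t) ∈ {p : ℝ × ℝ | p.2 ∈ Bs r p.1} := h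
          rw [ind, ind, Set.indicator_of_mem h, Set.indicator_of_mem h']
          simp only [Pi.one_apply, one_mul, mul_one]
          gcongr
          exact hM t
        · have h' : (w i, t) ∉ {p : ℝ × ℝ | p.2 ∈ Bs r p.1} := h
          simp [h']
    _ = (ENNReal.ofReal M * ∏ j, phi n a b s (w j)) * nu (Bs r (w i)) := by
        rw [lintegral_const_mul _ (ind_meas hB), lintegral_indicator_one hB]
    _ ≤ _ := by
        rw [mul_comm (ENNReal.ofReal M), mul_assoc, ENNReal.ofReal_mul hM0]
        gcongr
        exact Bs_nu r _ hr

end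
end CUE

open MeasureTheory Filter Topology Real
open scoped ENNReal

namespace CUE

noncomputable section
variable {n : ℕ}
variable {a b s : ℝ}

lemma exp_sep (u w : ℝ) (hw : 0 ≤ w) (h1 : w ≤ |u|) (h2 : |u| ≤ 2 * π - w) : 2 * w / π ≤ ‖1 - Complex.exp ((u : ℝ) * Complex.I)‖ := by
  have key : ‖1 - Complex.exp ((u : ℝ) * Complex.I)‖ = 2 * |sin (|u| / 2)| := by
    rw [norm_sub_rev, mul_comm, Complex.norm_exp_I_mul_ofReal_sub_one, norm_mul, Real.norm_eq_abs, Real.norm_eq_abs, abs_two]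
    rcases abs_choice u with h | h
    · rw [h]
    · rw [h, neg_div, sin_neg, abs_neg]
  rw [key]
  have hp := Real.pi_pos
  have : 2 / π * (w / 2) ≤ sin (|u| / 2) := by
    rcases le_total (|u| / 2) (π / 2) with h | h
    · refine le_trans ?_ (Real.mul_le_sin (by positivity) h)
      gcongr
    · rw [← Real.sin_pi_sub]
      refine le_trans ?_ (Real.mul_le_sin (by linarith) (by linarith))
      refine mul_le_mul_of_nonneg_left ?_ (by positivity)
      linarith
  have h3 := le_abs_self (sin (|u| / 2))
  calc 2 * w / π = 2 * (2 / π * (w / 2)) := by ring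
    _ ≤ _ := by linarith

lemma low_int (m : ℕ) (ε : ℝ) (hε : 0 < ε) (hε1 : ε < 1) : ∃ R > 0, ∃ η > 0, ∃ N0 : ℕ, ∀ n ≥ N0, ∀ a b s M : ℝ, 0 < s → n * s ≤ η →
    (∀ u, phi n a b s u ≤ ENNReal.ofReal M) → 0 ≤ M →
    2 * s < 4 * R / n ∧ 
    ENNReal.ofReal (1 - ε) * LamP n a b s ^ m ≤
      ∫⁻ y, ind (RR a b s ∩ SepR (4 * R / n)) y * ENNReal.ofReal (rho n y) ∂piN (Fin m ⊕ Fin m) +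
      (m * m : ℕ) * (LamP n a b s ^ (m - 1) * ENNReal.ofReal (M * (4 * R / n))) := by
  obtain ⟨R, hR, η, hη, N0, h⟩ := rho_lower (κ := Fin m) ε hε
  refine ⟨R, hR, min η R, by positivity, N0 + 1, ?_⟩
  intro n hn a b s M hs hns hM hM0
  have hn0 : (0 : ℝ) < n := by exact_mod_cast (by omega : 0 < n)
  set r := 4 * R / n with hrd
  have hr : 0 < r := by positivity
  have hsr : 2 * s < r := by
    rw [hrd, lt_div_iff₀ hn0]
    have := hns.trans (min_le_right _ _)
    nlinarith
  refine ⟨hsr, ?_⟩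
  have hbm : ∀ k k' : Fin m, Measurable fun y : Fin m ⊕ Fin m → ℝ => ind {p : ℝ × ℝ | p.2 ∈ Bs r p.1} (y (.inl k), y (.inl k')) * PK n a b s y :=
    fun k k' => ((ind_meas (Bs_meas r)).comp ((measurable_pi_apply _).prodMk (measurable_pi_apply _))).mul PK_meas
  have hae : ∀ᵐ y ∂piN (Fin m ⊕ Fin m), ENNReal.ofReal (1 - ε) * PK n a b s y ≤
      ind (RR a b s ∩ SepR r) y * ENNReal.ofReal (rho n y) + 
        ∑ p ∈ (Finset.univ : Finset (Fin m × Fin m)).filter (fun p => p.1 ≠ p.2), ind {p : ℝ × ℝ | p.2 ∈ Bs r p.1} (y (.inl p.1), y (.inl p.2)) * PK n a b s y := by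
    filter_upwards [piN_box (ι := Fin m ⊕ Fin m)] with y hy
    by_cases hRR : y ∈ RR a b s
    swap
    · rw [PK_eq]; simp [hRR]
    by_cases hS : y ∈ SepR r
    · refine le_trans ?_ le_self_add
      have hRS : y ∈ RR a b s ∩ SepR r := ⟨hRR, hS⟩
      rw [PK_eq, ind, ind, Set.indicator_of_mem hRS, Set.indicator_of_mem hRR]
      simp only [Pi.one_apply, one_mul]
      rw [← ENNReal.ofReal_mul (by linarith)]
      refine ENNReal.ofReal_le_ofReal ?_
      refine h n (by omega) s (hns.trans (min_le_left _ _)) y (fun k => ⟨(hRR k).1, (hRR k).2.1⟩) fun k k' hk => ?_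
      obtain ⟨h1, h2⟩ := hS k k' hk
      have e1 : |(mid y k - mid y k') - (y (.inl k) - y (.inl k'))| ≤ s / 2 := by
        have := hRR k; have h' := hRR k'
        obtain ⟨q1, q2, -, -⟩ := hRR k
        obtain ⟨q3, q4, -, -⟩ := hRR k'
        rw [abs_le, mid, mid]; constructor <;> linarith
      have h3 : r / 2 ≤ |mid y k - mid y k'| := by
        have := abs_sub_abs_le_abs_sub (y (.inl k) - y (.inl k')) (mid y k - mid y k')
        have h5 := abs_sub_comm (y (.inl k) - y (.inl k')) (mid y k - mid y k')
        linarith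
      have h4 : |mid y k - mid y k'| ≤ 2 * π - r / 2 := by
        have := abs_sub_abs_le_abs_sub (mid y k - mid y k') (y (.inl k) - y (.inl k'))
        linarith
      refine le_trans ?_ (exp_sep _ _ (by positivity) h3 h4)
      rw [le_div_iff₀ Real.pi_pos, hrd]
      have hp4 := Real.pi_le_four
      calc R / n * π ≤ R / n * 4 := by gcongr
        _ = _ := by ring
    · refine le_trans ?_ le_add_self
      obtain ⟨k, k', hkk, hbad⟩ : ∃ k k' : Fin m, k ≠ k' ∧ y (.inl k') ∈ Bs r (y (.inl k)) := by
        by_contra hc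
        push Not at hc
        refine hS fun k k' hk => ?_
        have h1 := hc k k' hk
        have b1 := hy (.inl k)
        have b2 := hy (.inl k')
        simp only [Bs, Set.mem_union, Set.mem_Icc, not_or, not_and, not_le] at h1
        obtain ⟨h2, h3, h4⟩ := h1
        have h3' := h3 b2.1
        constructor
        · by_contra hcon
          push Not at hcon
          rw [abs_lt] at hcon
          have := h2 (by linarith [hcon.1, hcon.2])
          linarith [hcon.1, hcon.2]
        · by_contra hcon
          push Not at hcon
          have h4' : y (.inl k') < 2 * π - r := by
            by_contra hh; push Not at hh
            have := h4 hh; linarith [b2.2]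
          rcases lt_abs.1 hcon with h5 | h5 <;> linarith [b1.1, b1.2, b2.1, b2.2]
      refine le_trans ?_ (Finset.single_le_sum (f := fun p : Fin m × Fin m => ind {p : ℝ × ℝ | p.2 ∈ Bs r p.1} (y (.inl p.1), y (.inl p.2)) * PK n a b s y)
        (fun _ _ => zero_le) (Finset.mem_filter.2 ⟨Finset.mem_univ (k, k'), hkk⟩))
      have hm : (y (.inl k), y (.inl k')) ∈ {p : ℝ × ℝ | p.2 ∈ Bs r p.1} := hbad
      simp only [ind]
      rw [Set.indicator_of_mem hm, Pi.one_apply]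
      gcongr
      rw [ENNReal.ofReal_le_one]; linarith
  have h1 := lintegral_mono_ae hae
  rw [lintegral_const_mul _ PK_meas, int_PK_one, lintegral_add_right _ (Finset.measurable_sum _ fun p _ => hbm p.1 p.2),
    lintegral_finsetSum _ fun p _ => hbm p.1 p.2] at h1
  refine h1.trans ?_
  gcongr
  refine (Finset.sum_le_sum fun p hp => bad_int M hM hM0 r hr.le p.1 p.2 (Finset.mem_filter.1 hp).2).trans ?_
  rw [Finset.sum_const, nsmul_eq_mul]
  gcongr
  refine (Finset.card_le_univ _).trans ?_
  simp

lemma lint_nu (F : ℝ → ℝ≥0∞) : ∫⁻ t, F t ∂nu = ENNReal.ofReal (1 / (2 * π)) * ∫⁻ t in Set.Ico 0 (2 * π), F t := by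
  rw [nu, lintegral_smul_measure, smul_eq_mul, one_div, ENNReal.ofReal_inv_of_pos (by positivity)]

lemma lint_q (u : ℝ) (hs : 0 ≤ s) : ∫⁻ v in Set.Ioc u (u + s), ENNReal.ofReal (qq n (v - u)) = ENNReal.ofReal ((n : ℝ) ^ 4 * s ^ 3 / 36) := by
  have hc : Continuous fun v => qq n (v - u) := by unfold qq; fun_prop
  rw [← ofReal_integral_eq_lintegral_ofReal]
  · congr 1
    rw [← intervalIntegral.integral_of_le (by linarith), intervalIntegral.integral_comp_sub_right (fun d => qq n d)]
    simp only [qq, sub_self, add_sub_cancel_left]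
    rw [intervalIntegral.integral_div, intervalIntegral.integral_const_mul, integral_pow]
    ring
  · exact (hc.integrableOn_Icc (a := u) (b := u + s)).mono_set Set.Ioc_subset_Icc_self
  · exact Eventually.of_forall fun v => qq_nonneg _

lemma phi_upper (hs : 0 ≤ s) (u : ℝ) : phi n a b s u ≤ ENNReal.ofReal ((n : ℝ) ^ 4 * s ^ 3 / (72 * π)) * ind (Set.Icc (a - s / 2) b) u := by
  by_cases hu : u ∈ Set.Icc (a - s / 2) b
  · rw [ind, Set.indicator_of_mem hu, Pi.one_apply, mul_one, phi, lint_nu]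
    have h1 : ∀ v, fk n a b s u v ≤ (Set.Ioc u (u + s)).indicator (fun v => ENNReal.ofReal (qq n (v - u))) v := by
      intro v
      rw [fk]
      by_cases h : (u, v) ∈ {p : ℝ × ℝ | rr a b s p.1 p.2}
      · have h2 : v ∈ Set.Ioc u (u + s) := by obtain ⟨h3, h4, -, -⟩ := h; simp only at h3 h4; constructor <;> linarith
        rw [ind, Set.indicator_of_mem h, Set.indicator_of_mem h2, Pi.one_apply, one_mul]
      · simp [h]
    calc _ ≤ ENNReal.ofReal (1 / (2 * π)) * ∫⁻ v, (Set.Ioc u (u + s)).indicator (fun v => ENNReal.ofReal (qq n (v - u))) v := by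
          refine mul_le_mul_right ?_ _
          exact (setLIntegral_le_lintegral _ _).trans (lintegral_mono h1)
      _ = _ := by
          rw [lintegral_indicator measurableSet_Ioc, lint_q u hs, ← ENNReal.ofReal_mul (by positivity)]
          congr 1; field_simp; ring
  · have h1 : ∀ v, fk n a b s u v = 0 := by
      intro v
      rw [fk, ind, Set.indicator_of_notMem, zero_mul]
      rintro ⟨h3, h4, h5, h6⟩
      simp only at *
      exact hu ⟨by linarith, by linarith⟩
    rw [phi]; simp [h1]

lemma phi_lower (hs : 0 ≤ s) (ha : 0 ≤ a) (hb : b ≤ 2 * π) (u : ℝ) (hu : u ∈ Set.Ico a (b - s)) :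
    ENNReal.ofReal ((n : ℝ) ^ 4 * s ^ 3 / (72 * π)) ≤ phi n a b s u := by
  rw [phi, lint_nu, ← lintegral_indicator measurableSet_Ico]
  have h1 : ∀ v, (Set.Ioc u (u + s)).indicator (fun v => ENNReal.ofReal (qq n (v - u))) v ≤ (Set.Ico 0 (2 * π)).indicator (fk n a b s u) v := by
    intro v
    by_cases hv : v ∈ Set.Ioc u (u + s)
    · have h2 : v ∈ Set.Ico 0 (2 * π) := ⟨by linarith [hv.1, hu.1], by linarith [hv.2, hu.2]⟩
      have h3 : (u, v) ∈ {p : ℝ × ℝ | rr a b s p.1 p.2} := by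
        obtain ⟨h4, h5⟩ := hv
        obtain ⟨h6, h7⟩ := hu
        refine ⟨?_, ?_, ?_, ?_⟩ <;> simp only <;> linarith
      rw [Set.indicator_of_mem hv, Set.indicator_of_mem h2, fk, ind, Set.indicator_of_mem h3, Pi.one_apply, one_mul]
    · simp [hv]
  calc _ = ENNReal.ofReal (1 / (2 * π)) * ∫⁻ v, (Set.Ioc u (u + s)).indicator (fun v => ENNReal.ofReal (qq n (v - u))) v := by
          rw [lintegral_indicator measurableSet_Ioc, lint_q u hs, ← ENNReal.ofReal_mul (by positivity)]
          congr 1; field_simp; ring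
    _ ≤ _ := by gcongr with v; exact h1 v

lemma Lam_upper (hs : 0 ≤ s) (hab : a ≤ b) : LamP n a b s ≤ ENNReal.ofReal ((n : ℝ) ^ 4 * s ^ 3 / (144 * π ^ 2) * (b - a + s)) := by
  rw [LamP]
  refine (lintegral_mono fun u => phi_upper hs u).trans ?_
  rw [lintegral_const_mul _ (ind_meas measurableSet_Icc), lintegral_indicator_one measurableSet_Icc]
  refine (mul_le_mul_right (nu_Icc _ _) _).trans ?_
  rw [← ENNReal.ofReal_mul (by positivity)]
  refine ENNReal.ofReal_le_ofReal ?_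
  calc _ = (n : ℝ) ^ 4 * s ^ 3 / (144 * π ^ 2) * (b - a + s / 2) := by field_simp; ring
    _ ≤ _ := by gcongr; linarith

lemma Lam_lower (hs : 0 ≤ s) (ha : 0 ≤ a) (hb : b ≤ 2 * π) : ENNReal.ofReal ((n : ℝ) ^ 4 * s ^ 3 / (144 * π ^ 2) * (b - a - s)) ≤ LamP n a b s := by
  rw [LamP, lint_nu, ← lintegral_indicator measurableSet_Ico]
  have h1 : ∀ u, ENNReal.ofReal ((n : ℝ) ^ 4 * s ^ 3 / (72 * π)) * ind (Set.Ico a (b - s)) u ≤ (Set.Ico 0 (2 * π)).indicator (phi n a b s) u := by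
    intro u
    by_cases hu : u ∈ Set.Ico a (b - s)
    · have h2 : u ∈ Set.Ico 0 (2 * π) := ⟨by linarith [hu.1], by linarith [hu.2]⟩
      rw [ind, Set.indicator_of_mem hu, Set.indicator_of_mem h2, Pi.one_apply, mul_one]
      exact phi_lower hs ha hb u hu
    · simp [hu]
  calc _ = ENNReal.ofReal (1 / (2 * π)) * ∫⁻ u, ENNReal.ofReal ((n : ℝ) ^ 4 * s ^ 3 / (72 * π)) * ind (Set.Ico a (b - s)) u := by
          rw [lintegral_const_mul _ (ind_meas measurableSet_Ico), lintegral_indicator_one measurableSet_Ico, Real.volume_Ico,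
            ← ENNReal.ofReal_mul (by positivity), ← ENNReal.ofReal_mul (by positivity)]
          congr 1; field_simp; ring
    _ ≤ _ := by gcongr with u; exact h1 u

end
end CUE

open MeasureTheory Filter Topology Real
open scoped ENNReal

namespace CUE

noncomputable section
variable {n : ℕ}
variable {a b s : ℝ}

/-- no close pairs -/
def S0 (n : ℕ) (a b s : ℝ) : Set (Fin n → ℝ) := {x | ∀ j k, j ≠ k → (x j + x k) / 2 ∈ Set.Ico a b → s < |x j - x k|}

lemma S0_meas : MeasurableSet (S0 n a b s) := by
  have : S0 n a b s = ⋂ j, ⋂ k, ⋂ (_ : j ≠ k), ({x : Fin n → ℝ | (x j + x k) / 2 ∈ Set.Ico a b}ᶜ ∪ {x | s < |x j - x k|}) := by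
    ext x; simp only [S0, Set.mem_iInter, Set.mem_union, Set.mem_compl_iff, Set.mem_ofPred_eq, imp_iff_not_or (b := s < _)]
  rw [this]
  refine MeasurableSet.iInter fun j => MeasurableSet.iInter fun k => MeasurableSet.iInter fun _ => ?_
  refine MeasurableSet.union (MeasurableSet.compl ?_) (measurableSet_lt measurable_const (absd_meas _ _))
  have h : Measurable fun x : Fin n → ℝ => (x j + x k) / 2 := ((measurable_pi_apply j).add (measurable_pi_apply k)).div_const 2
  exact h measurableSet_Ico

lemma S0_sym (σ : Equiv.Perm (Fin n)) (x : Fin n → ℝ) (hx : x ∈ S0 n a b s) : x ∘ σ ∈ S0 n a b s :=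
  fun j k hjk h => hx (σ j) (σ k) (fun h' => hjk (σ.injective h')) h

lemma wden_tie (x : Fin n → ℝ) (i j : Fin n) (hij : i ≠ j) (h : x i = x j) : wden x = 0 := by
  rw [wden_eq, rho, Matrix.det_zero_of_row_eq hij]
  · simp
  · funext k
    simp [Km, Am, Matrix.mul_apply, h]

lemma W_tie : ∀ᵐ x ∂(W n), ∀ i j, i ≠ j → x i ≠ x j := by
  rw [W, ae_withDensity_iff wden_meas]
  refine Eventually.of_forall fun x hx i j hij h => hx ?_
  rw [wden_tie x i j hij h]; simp

lemma Nh_zero_of_S0 {x : Fin n → ℝ} (hx : x ∈ S0 n a b s) : Nh a b s x = 0 := by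
  classical
  rw [Nh, Finset.card_eq_zero, Finset.filter_eq_empty_iff]
  rintro ⟨i, j⟩ - ⟨⟨h1, h2, h3, h4⟩, -⟩
  simp only at h1 h2 h3 h4
  have hij : i ≠ j := by rintro rfl; simp at h1
  have := hx i j hij ⟨h3, h4⟩
  rw [abs_sub_comm, abs_of_pos h1] at this
  linarith

lemma ev_le : W n (S0 n a b s) ≤ W n {x | Nh a b s x = 0} := measure_mono fun _ => Nh_zero_of_S0

lemma ev_ge (hn : 2 ≤ n) : W n {x | Nh a b s x = 0} + ∫⁻ x, ((Nh a b s x).descFactorial 1 : ℝ≥0∞) ∂(W n) ≤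
    W n (S0 n a b s) + ∫⁻ y, ind (RR a b s) y * ENNReal.ofReal (rho n y) ∂piN (Fin 1 ⊕ Fin 1) := by
  classical
  have hm0 : MeasurableSet {x : Fin n → ℝ | Nh a b s x = 0} := Nh_meas (measurableSet_singleton 0)
  have hmT : ∀ Φ : Fin 1 ⊕ Fin 1 ↪ Fin n, Measurable fun x : Fin n → ℝ => ind (RR a b s) (x ∘ Φ) :=
    fun Φ => (ind_meas RR_meas).comp (comp_meas _)
  rw [← sum_corr (by simpa using hn) _ (ind_meas RR_meas), ← lintegral_indicator_one hm0, ← lintegral_indicator_one S0_meas,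
    ← lintegral_finsetSum _ fun Φ _ => hmT Φ, ← lintegral_add_left (ind_meas hm0), ← lintegral_add_left (ind_meas S0_meas)]
  refine lintegral_mono_ae ?_
  filter_upwards [W_tie] with x hx
  simp only [ind]
  by_cases h0 : x ∈ S0 n a b s
  · have h1 : x ∈ {x : Fin n → ℝ | Nh a b s x = 0} := Nh_zero_of_S0 h0
    rw [Set.indicator_of_mem h0, Set.indicator_of_mem h1, Nh_zero_of_S0 h0]
    simp
  · refine le_trans ?_ le_add_self
    by_cases h1 : x ∈ {x : Fin n → ℝ | Nh a b s x = 0}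
    · have h1' : Nh a b s x = 0 := h1
      rw [Set.indicator_of_mem h1, h1']
      obtain ⟨i, j, hij, hr⟩ : ∃ i j, i ≠ j ∧ rr a b s (x i) (x j) := by
        simp only [S0, Set.mem_ofPred_eq] at h0
        push Not at h0
        obtain ⟨j, k, hjk, hm, hd⟩ := h0
        rcases lt_or_gt_of_ne (hx j k hjk) with h | h
        · refine ⟨j, k, hjk, by linarith, ?_, hm.1, hm.2⟩
          have := neg_le_of_abs_le hd; linarith
        · refine ⟨k, j, hjk.symm, by linarith, ?_, by linarith [hm.1], by linarith [hm.2]⟩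
          have := le_of_abs_le hd; linarith
      let Φ : Fin 1 ⊕ Fin 1 ↪ Fin n := ⟨Sum.elim (fun _ => i) (fun _ => j), by
        rintro (u | u) (v | v) h
        · rw [Subsingleton.elim u v]
        · exact absurd h hij
        · exact absurd h hij.symm
        · rw [Subsingleton.elim u v]⟩
      refine le_trans ?_ (Finset.single_le_sum (f := fun Φ : Fin 1 ⊕ Fin 1 ↪ Fin n => ind (RR a b s) (x ∘ Φ)) (fun _ _ => zero_le) (Finset.mem_univ Φ))
      have : x ∘ Φ ∈ RR a b s := fun k => hr
      rw [ind, Set.indicator_of_mem this]; simp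
    · rw [Set.indicator_of_notMem h1, zero_add, Nh_desc, Finset.card_filter]
      push_cast
      refine Finset.sum_le_sum fun Φ _ => ?_
      split_ifs with h
      · have : x ∘ Φ ∈ RR a b s := fun k => (h k).1
        rw [Set.indicator_of_mem this]; simp
      · exact zero_le

section lim
variable {a b s : ℕ → ℝ} {l : ℝ}

theorem mom_lim (hs : ∀ᶠ n in atTop, 0 < s n) (hns : Tendsto (fun n : ℕ => (n : ℝ) * s n) atTop (𝓝 0)) 
    (hL : Tendsto (fun n => LamP n (a n) (b n) (s n)) atTop (𝓝 (ENNReal.ofReal l))) (m : ℕ) :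
    Tendsto (fun n => ∫⁻ x, ((Nh (a n) (b n) (s n) x).descFactorial m : ℝ≥0∞) ∂(W n)) atTop (𝓝 (ENNReal.ofReal l ^ m)) := by
  have hLm : ∀ m, Tendsto (fun n => LamP n (a n) (b n) (s n) ^ m) atTop (𝓝 (ENNReal.ofReal l ^ m)) := fun m => ENNReal.Tendsto.pow hL
  have hfin : ∀ m, ENNReal.ofReal l ^ m ≠ ⊤ := fun m => ENNReal.pow_ne_top ENNReal.ofReal_ne_top
  rw [tendsto_order]
  constructor
  swap
  · intro c hc
    filter_upwards [(tendsto_order.1 (hLm m)).2 c hc, eventually_ge_atTop (m + m + 1)] with n h1 h2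
    exact ((mom_upper m (by omega)).trans (up_int (by omega) m)).trans_lt h1
  intro c hc
  obtain ⟨ε, hε, hε1, hcε⟩ : ∃ ε : ℝ, 0 < ε ∧ ε < 1 ∧ c < ENNReal.ofReal (1 - ε) * ENNReal.ofReal l ^ m := by
    have h1 : Tendsto (fun ε : ℝ => ENNReal.ofReal (1 - ε) * ENNReal.ofReal l ^ m) (𝓝[>] 0) (𝓝 (1 * ENNReal.ofReal l ^ m)) := by
      refine ENNReal.Tendsto.mul_const ?_ (Or.inr (hfin m))
      have : Continuous fun ε : ℝ => ENNReal.ofReal (1 - ε) := ENNReal.continuous_ofReal.comp (by fun_prop)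
      have h2 := (this.tendsto 0).mono_left (nhdsWithin_le_nhds (s := Set.Ioi 0))
      simpa using h2
    rw [one_mul] at h1
    have h2 := (tendsto_order.1 h1).1 c hc
    have h3 : ∀ᶠ ε : ℝ in 𝓝[>] 0, ε ∈ Set.Ioo (0 : ℝ) 1 := Ioo_mem_nhdsGT one_pos
    obtain ⟨ε, h4, h5⟩ := (h2.and h3).exists
    exact ⟨ε, h5.1, h5.2, h4⟩
  obtain ⟨R, hR, η, hη, N0, h⟩ := low_int m ε hε hε1
  have hz : ∀ C : ℝ, Tendsto (fun n : ℕ => ENNReal.ofReal (C * ((n : ℝ) * s n) ^ 3)) atTop (𝓝 0) := by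
    intro C
    have := ENNReal.tendsto_ofReal ((hns.pow 3).const_mul C)
    simpa using this
  have hE1 : Tendsto (fun n : ℕ => ((m * m : ℕ) : ℝ≥0∞) * (LamP n (a n) (b n) (s n) ^ (m - 1) * ENNReal.ofReal (4 * R / (72 * π) * ((n : ℝ) * s n) ^ 3))) atTop (𝓝 0) := by
    have h1 := ENNReal.Tendsto.mul (hLm (m - 1)) (Or.inr ENNReal.zero_ne_top) (hz (4 * R / (72 * π))) (Or.inr (hfin _))
    have h2 := ENNReal.Tendsto.const_mul h1 (a := ((m * m : ℕ) : ℝ≥0∞)) (Or.inr (ENNReal.natCast_ne_top _))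
    simpa using h2
  have hE2 : Tendsto (fun n : ℕ => (m : ℝ≥0∞) * (LamP n (a n) (b n) (s n) ^ m * ENNReal.ofReal (((n : ℝ) * s n) ^ 3))) atTop (𝓝 0) := by
    have h1 := ENNReal.Tendsto.mul (hLm m) (Or.inr ENNReal.zero_ne_top) (hz 1) (Or.inr (hfin _))
    have h2 := ENNReal.Tendsto.const_mul h1 (a := (m : ℝ≥0∞)) (Or.inr (ENNReal.natCast_ne_top _))
    simpa using h2
  have h0 := ENNReal.Tendsto.const_mul (hLm m) (a := ENNReal.ofReal (1 - ε)) (Or.inr ENNReal.ofReal_ne_top)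
  have hT := ENNReal.Tendsto.sub h0 (hE2.add hE1) (Or.inr (by simp))
  rw [add_zero, tsub_zero] at hT
  filter_upwards [(tendsto_order.1 hT).1 c hcε, hs, (tendsto_order.1 hns).2 η hη, eventually_ge_atTop (N0 + m + m + 1)] with n h1 h2 h3 h4
  refine h1.trans_le ?_
  rw [tsub_le_iff_right]
  have hn0 : (0 : ℝ) < n := by exact_mod_cast (by omega : 0 < n)
  obtain ⟨h5, h6⟩ := h n (by omega) (a n) (b n) (s n) ((n : ℝ) ^ 4 * s n ^ 3 / (72 * π)) h2 h3.le (fun u => by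
    refine (phi_upper h2.le u).trans ?_
    refine (mul_le_mul_right (b := ind _ u) (c := 1) ?_ _).trans (mul_one _).le
    exact Set.indicator_le_self' (fun _ _ => zero_le) u) (by positivity)
  refine h6.trans ?_
  have h7 := mom_lower (n := n) (a := a n) (b := b n) m (by omega) _ h5 h2.le
  refine (add_le_add_left h7 _).trans ?_
  rw [add_assoc]
  refine add_le_add_right (add_le_add ?_ (le_of_eq ?_)) _
  · refine (Finset.sum_le_sum fun k _ => tri_int (by omega) h2 k).trans ?_
    simp
  · congr 3
    field_simp

end lim
end
end CUE

open MeasureTheory Filter Topology Real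
open scoped ENNReal

namespace CUE

noncomputable section
variable {n : ℕ}

section lim
variable {a b s : ℕ → ℝ} {l : ℝ}

lemma int_desc (a b s : ℝ) (m : ℕ) : ∫ x, ((Nh a b s x).descFactorial m : ℝ) ∂(W n) =
    (∫⁻ x, ((Nh a b s x).descFactorial m : ℝ≥0∞) ∂(W n)).toReal := by
  rw [integral_eq_lintegral_of_nonneg_ae]
  · congr 1
    refine lintegral_congr fun x => ?_
    simp
  · exact Eventually.of_forall fun x => by positivity
  · exact (Measurable.comp (measurable_of_countable (fun k : ℕ => ((k.descFactorial m : ℕ) : ℝ))) Nh_meas).aestronglyMeasurable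

theorem S0_lim (hl : 0 ≤ l) (hs : ∀ᶠ n in atTop, 0 < s n) (hns : Tendsto (fun n : ℕ => (n : ℝ) * s n) atTop (𝓝 0)) 
    (hL : Tendsto (fun n => LamP n (a n) (b n) (s n)) atTop (𝓝 (ENNReal.ofReal l))) :
    Tendsto (fun n => (W n).real (S0 n (a n) (b n) (s n))) atTop (𝓝 (exp (-l))) := by
  have hm := mom_lim hs hns hL
  have h1 := poisson_lim (Ω := fun n => Fin n → ℝ) (fun n => W n) (fun n => Nh (a n) (b n) (s n)) (fun n => Nh_meas)
    (fun n => ⟨n * n, Nh_le⟩) l (fun m => by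
      have h2 := (ENNReal.tendsto_toReal (ENNReal.pow_ne_top ENNReal.ofReal_ne_top)).comp (hm m)
      rw [ENNReal.toReal_pow, ENNReal.toReal_ofReal hl] at h2
      refine h2.congr fun n => ?_
      rw [int_desc]; rfl)
  have hd : Tendsto (fun n => (∫⁻ x, ((Nh (a n) (b n) (s n) x).descFactorial 1 : ℝ≥0∞) ∂(W n)).toReal - (LamP n (a n) (b n) (s n)).toReal) atTop (𝓝 0) := by
    have h2 := (ENNReal.tendsto_toReal (ENNReal.pow_ne_top ENNReal.ofReal_ne_top)).comp (hm 1)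
    have h3 := (ENNReal.tendsto_toReal ENNReal.ofReal_ne_top).comp hL
    have := h2.sub h3
    simpa using this
  have h4 := h1.add hd
  rw [add_zero] at h4
  refine tendsto_of_tendsto_of_tendsto_of_le_of_le' h4 h1 ?_ ?_
  · filter_upwards [eventually_ge_atTop 2, hL.eventually_lt_const ENNReal.ofReal_lt_top, (hm 1).eventually_lt_const (ENNReal.pow_lt_top ENNReal.ofReal_lt_top)] with n hn hf hf1
    have h5 := (ev_ge (n := n) (a := a n) (b := b n) (s := s n) hn).trans (add_le_add_right (up_int (by omega) 1) _)
    rw [pow_one] at h5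
    have h6 := ENNReal.toReal_mono (ENNReal.add_ne_top.2 ⟨measure_ne_top _ _, hf.ne⟩) h5
    rw [ENNReal.toReal_add (measure_ne_top _ _) hf1.ne, ENNReal.toReal_add (measure_ne_top _ _) hf.ne] at h6
    simp only [Measure.real]
    linarith
  · exact Eventually.of_forall fun n => ENNReal.toReal_mono (measure_ne_top _ _) ev_le
end lim

theorem asym (a b : ℕ → ℝ) (hab : ∀ n, 0 ≤ a n ∧ a n ≤ b n ∧ b n ≤ 2 * π)
    (hgrow : Tendsto (fun n : ℕ => (n : ℝ) * (b n - a n)) atTop atTop) (β : ℝ) (hβ : 0 < β) (c s : ℕ → ℝ)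
    (hc : ∀ n, c n = ((n : ℝ) ^ 4 * (b n - a n) / (144 * π ^ 2)) ^ ((1 : ℝ) / 3)) (hs : ∀ n, s n = β / c n) :
    (∀ᶠ n in atTop, 0 < c n) ∧ Tendsto (fun n => (W n).real (S0 n (a n) (b n) (s n))) atTop (𝓝 (exp (-β ^ 3))) := by
  have hev : ∀ᶠ n : ℕ in atTop, 0 < (n : ℝ) ∧ 0 < b n - a n := by
    filter_upwards [hgrow.eventually_gt_atTop 0, eventually_gt_atTop 0] with n h1 h2
    have h3 : (0 : ℝ) < n := by exact_mod_cast h2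
    exact ⟨h3, pos_of_mul_pos_right h1 h3.le⟩
  have hcp : ∀ᶠ n in atTop, 0 < c n := by
    filter_upwards [hev] with n ⟨h1, h2⟩
    rw [hc]; positivity
  have hsp : ∀ᶠ n in atTop, 0 < s n := by
    filter_upwards [hcp] with n h1
    rw [hs]; positivity
  have hs3 : ∀ᶠ n : ℕ in atTop, (n : ℝ) ^ 4 * s n ^ 3 * (b n - a n) = 144 * π ^ 2 * β ^ 3 := by
    filter_upwards [hev] with n ⟨h1, h2⟩
    have h3 : c n ^ 3 = (n : ℝ) ^ 4 * (b n - a n) / (144 * π ^ 2) := by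
      rw [hc, ← Real.rpow_natCast, ← Real.rpow_mul (by positivity)]; norm_num
    rw [hs, div_pow, h3]
    field_simp
  have hinv := hgrow.inv_tendsto_atTop
  have hns3 : Tendsto (fun n : ℕ => ((n : ℝ) * s n) ^ 3) atTop (𝓝 0) := by
    have h1 := hinv.const_mul (144 * π ^ 2 * β ^ 3)
    rw [mul_zero] at h1
    refine h1.congr' ?_
    filter_upwards [hs3, hev] with n h2 ⟨h3, h4⟩
    rw [← h2, Pi.inv_apply]
    field_simp
  have hns : Tendsto (fun n : ℕ => (n : ℝ) * s n) atTop (𝓝 0) := by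
    rw [tendsto_order]
    constructor
    · intro d hd
      filter_upwards [hsp] with n h1
      have : 0 ≤ (n : ℝ) * s n := by positivity
      linarith
    · intro d hd
      filter_upwards [(tendsto_order.1 hns3).2 (d ^ 3) (by positivity)] with n h1
      exact lt_of_pow_lt_pow_left₀ 3 hd.le h1
  have hsL : Tendsto (fun n : ℕ => β ^ 3 * (s n / (b n - a n))) atTop (𝓝 0) := by
    have h1 := (hns.mul hinv).const_mul (β ^ 3)
    rw [mul_zero, mul_zero] at h1
    refine h1.congr' ?_
    filter_upwards [hev] with n ⟨h3, h4⟩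
    rw [Pi.inv_apply]
    field_simp
  have key : ∀ᶠ n : ℕ in atTop, ∀ t : ℝ, (n : ℝ) ^ 4 * s n ^ 3 / (144 * π ^ 2) * (b n - a n + t * s n) = β ^ 3 + t * (β ^ 3 * (s n / (b n - a n))) := by
    filter_upwards [hs3, hev] with n h2 ⟨h3, h4⟩ t
    have : (n : ℝ) ^ 4 * s n ^ 3 = 144 * π ^ 2 * β ^ 3 / (b n - a n) := by rw [← h2]; field_simp
    rw [this]; field_simp
  have hlim : ∀ t : ℝ, Tendsto (fun n : ℕ => ENNReal.ofReal ((n : ℝ) ^ 4 * s n ^ 3 / (144 * π ^ 2) * (b n - a n + t * s n))) atTop (𝓝 (ENNReal.ofReal (β ^ 3))) := by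
    intro t
    refine ENNReal.tendsto_ofReal ?_
    have h1 := (hsL.const_mul t).const_add (β ^ 3)
    rw [mul_zero, add_zero] at h1
    refine h1.congr' ?_
    filter_upwards [key] with n h
    exact (h t).symm
  refine ⟨hcp, S0_lim (by positivity) hsp hns ?_⟩
  refine tendsto_of_tendsto_of_tendsto_of_le_of_le' (hlim (-1)) (hlim 1) ?_ ?_
  · filter_upwards [hsp] with n h
    refine le_trans (le_of_eq ?_) (Lam_lower h.le (hab n).1 (hab n).2.2)
    congr 1; ring
  · filter_upwards [hsp] with n h
    refine (Lam_upper h.le (hab n).2.1).trans (le_of_eq ?_)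
    congr 1; ring

lemma event (a b β c : ℝ) (hβ : 0 < β) (hc : 0 < c) (x : Fin n → ℝ) :
    (⨅ p : {p : Fin n × Fin n // p.1 ≠ p.2 ∧ (x p.1 + x p.2) / 2 ∈ Set.Ico a b},
        ENNReal.ofReal |x (p : Fin n × Fin n).1 - x (p : Fin n × Fin n).2|) * ENNReal.ofReal c > ENNReal.ofReal β ↔
    x ∈ S0 n a b (β / c) := by
  have h0 : (0 : ℝ) ≤ β / c := by positivity
  rw [gt_iff_lt, ← ENNReal.div_lt_iff (Or.inl (by simpa using hc)) (Or.inl ENNReal.ofReal_ne_top), ← ENNReal.ofReal_div_of_pos hc]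
  constructor
  · intro h j k hjk hm
    have h1 := h.trans_le (iInf_le _ ⟨(j, k), hjk, hm⟩)
    exact (ENNReal.ofReal_lt_ofReal_iff_of_nonneg h0).1 h1
  · intro h
    rcases isEmpty_or_nonempty {p : Fin n × Fin n // p.1 ≠ p.2 ∧ (x p.1 + x p.2) / 2 ∈ Set.Ico a b} with he | he
    · rw [iInf_of_empty]; exact ENNReal.ofReal_lt_top
    · obtain ⟨p, hp⟩ := exists_eq_ciInf_of_finite (f := fun p : {p : Fin n × Fin n // p.1 ≠ p.2 ∧ (x p.1 + x p.2) / 2 ∈ Set.Ico a b} =>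
        ENNReal.ofReal |x (p : Fin n × Fin n).1 - x (p : Fin n × Fin n).2|)
      rw [← hp]
      exact (ENNReal.ofReal_lt_ofReal_iff_of_nonneg h0).2 (h _ _ p.2.1 p.2.2)

end
end CUE

theorem closest_spacing_CUE_interval
    (μ : ∀ n : ℕ, Measure (Matrix.unitaryGroup (Fin n) ℂ))
    (hμ : ∀ n, (μ n).IsHaarMeasure)
    (hμprob : ∀ n, IsProbabilityMeasure (μ n))
    -- the intervals `I n = [a n, b n) ⊆ [0, 2π)` with `n * |I n| → ∞`:
    (a b : ℕ → ℝ)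
    (hab : ∀ n, 0 ≤ a n ∧ a n ≤ b n ∧ b n ≤ 2 * π)
    (hgrow : Tendsto (fun n : ℕ => (n : ℝ) * (b n - a n)) atTop atTop)
    -- `θ n U` lists the eigenvalue angles of `U` in `[0, 2π)`, with multiplicity:
    (θ : ∀ n : ℕ, Matrix.unitaryGroup (Fin n) ℂ → Fin n → ℝ)
    (hθmem : ∀ n U j, θ n U j ∈ Set.Ico (0 : ℝ) (2 * π))
    (hθeig : ∀ n (U : Matrix.unitaryGroup (Fin n) ℂ),
      (Matrix.charpoly (U : Matrix (Fin n) (Fin n) ℂ)).roots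
        = Multiset.map (fun j => Complex.exp ((θ n U j : ℂ) * Complex.I))
            (Finset.univ : Finset (Fin n)).val)
    -- `Z n U` is the infimum spacing (in `[0,∞]`) over pairs with average in `I n`:
    (Z : ∀ n : ℕ, Matrix.unitaryGroup (Fin n) ℂ → ℝ≥0∞)
    (hZ : ∀ n U, Z n U =
      ⨅ p : {p : Fin n × Fin n // p.1 ≠ p.2 ∧
          (θ n U p.1 + θ n U p.2) / 2 ∈ Set.Ico (a n) (b n)},
        ENNReal.ofReal |θ n U (p : Fin n × Fin n).1 - θ n U (p : Fin n × Fin n).2|)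
    (β : ℝ) (hβ : 0 < β) :
    Tendsto
      (fun n : ℕ =>
        (μ n {U | Z n U *
            ENNReal.ofReal
              (((n : ℝ) ^ 4 * (b n - a n) / (144 * π ^ 2)) ^ ((1 : ℝ) / 3))
          > ENNReal.ofReal β}).toReal)
      atTop (𝓝 (Real.exp (-β ^ 3))) := by
  obtain ⟨hc, hlim⟩ := CUE.asym a b hab hgrow β hβ _ _ (fun n => rfl) (fun n => rfl)
  refine hlim.congr' ?_
  filter_upwards [hc] with n hn
  have := hμ n
  have := hμprob n
  rw [Measure.real]
  congr 1
  rw [← CUE.weyl_sym (μ n) (θ n) (hθmem n) (hθeig n) _ CUE.S0_meas CUE.S0_sym]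
  congr 1
  ext U
  rw [Set.mem_ofPred_eq, Set.mem_ofPred_eq, hZ, CUE.event _ _ _ _ hβ hn]
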